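/- Under the multi-layer network assumptions (weights i.i.d. standard Gaussian; activation σ twice differentiable with |σ'|,|σ''| ≤ λ_σ, E[σ(ξ)]=0, E[σ(ξ)²]=1 for ξ ~ N(0,1); input X = X₀ ∈ ℝ^{d₀×n} being (ε_n,B)-orthonormal with ε_n n^{1/4} → 0; the empirical spectral distribution of X₀ᵀX₀ converging weakly almost surely to a probability distribution μ₀ on [0,∞); and n/d_ℓ → γ_ℓ ∈ (0,∞) for each layer ℓ = 1,…,L as n → ∞), for each ℓ = 1,…,L the empirical eigenvalue distribution of the conjugate kernel X_ℓᵀX_ℓ converges weakly almost surely to the deterministic probability distribution μ_ℓ defined recursively by μ_ℓ = ρ^MP_{γ_ℓ} ⊠ ((1−b_σ²) + b_σ²·μ_{ℓ−1}); in particular the empirical eigenvalue distribution of K^CK = X_LᵀX_L converges weakly almost surely to μ_L. Furthermore there exists a constant C > 0 such that ‖K^CK‖ ≤ C almost surely for all large n. -/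

import Mathlib

/-!
Theorem 1 (CK spectrum): under the multi-layer network assumptions, the empirical
eigenvalue distribution of the conjugate kernel `X_ℓᵀ X_ℓ` converges weakly almost surely
to the measure `μ_ℓ` defined recursively by the Marcenko-Pastur map, and `‖K^CK‖` is
bounded almost surely for all large `n`.
-/

open MeasureTheory ProbabilityTheory Filter Topology Matrix

noncomputable abbrev stdGaussian : Measure ℝ := gaussianReal 0 1

noncomputable abbrev gaussianVec (d : ℕ) : Measure (Fin d → ℝ) :=
  Measure.pi fun _ => stdGaussian

noncomputable abbrev gaussianMat (a b : ℕ) : Measure (Fin a → Fin b → ℝ) :=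
  Measure.pi fun _ => gaussianVec b

/-- ℓ₂→ℓ₂ operator norm of a real matrix. -/
noncomputable def opNorm {m n : ℕ} (X : Matrix (Fin m) (Fin n) ℝ) : ℝ :=
  ‖LinearMap.toContinuousLinearMap (Matrix.toEuclideanLin X)‖

/-- `(ε,B)`-orthonormality of the columns of a matrix. -/
def IsOrthonormal {d n : ℕ} (ε B : ℝ) (X : Matrix (Fin d) (Fin n) ℝ) : Prop :=
  (∀ α : Fin n, |(∑ i, X i α ^ 2) - 1| ≤ ε) ∧
  (∀ α β : Fin n, α ≠ β → |∑ i, X i α * X i β| ≤ ε) ∧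
  opNorm X ≤ B ∧
  ∑ α : Fin n, ((∑ i, X i α ^ 2) - 1) ^ 2 ≤ B ^ 2

open Classical in
/-- Integral of `f` against the empirical eigenvalue distribution of a symmetric matrix. -/
noncomputable def esd {n : ℕ} (M : Matrix (Fin n) (Fin n) ℝ) (f : ℝ → ℝ) : ℝ :=
  if h : M.IsHermitian then (n : ℝ)⁻¹ * ∑ α, f (h.eigenvalues α) else 0

/-- The layers `X_ℓ = σ(W_ℓ X_{ℓ-1})/√d_ℓ` of the network. -/
noncomputable def netLayer (σ : ℝ → ℝ) (d : ℕ → ℕ) (n : ℕ)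
    (W : (ℓ : ℕ) → Fin (d (ℓ + 1)) → Fin (d ℓ) → ℝ)
    (X0 : Matrix (Fin (d 0)) (Fin n) ℝ) : (ℓ : ℕ) → Matrix (Fin (d ℓ)) (Fin n) ℝ
  | 0 => X0
  | ℓ + 1 => (Real.sqrt (d (ℓ + 1)))⁻¹ • ((Matrix.of (W ℓ) * netLayer σ d n W X0 ℓ).map σ)

/-- Stieltjes transform of a measure on ℝ. -/
noncomputable def stieltjesT (ν : Measure ℝ) (z : ℂ) : ℂ := ∫ x, ((x : ℂ) - z)⁻¹ ∂ν

/-- `ν = ρ^MP_γ ⊠ μ`: `ν` is the probability distribution on `[0,∞)` whose Stieltjes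
transform satisfies the Marcenko-Pastur fixed-point equation with respect to `μ`. -/
def IsMPMap (γ : ℝ) (μ ν : Measure ℝ) : Prop :=
  IsProbabilityMeasure ν ∧ ν (Set.Iio 0) = 0 ∧
  ∀ z : ℂ, 0 < z.im →
    stieltjesT ν z = ∫ x, ((x : ℂ) * (1 - γ - γ * z * stieltjesT ν z) - z)⁻¹ ∂μ


section
open scoped ENNReal NNReal
section gauss
variable {E : Type*} [NormedAddCommGroup E] [NormedSpace ℝ E] [MeasurableSpace E] [BorelSpace E]
  [CompleteSpace E] [SecondCountableTopology E]

lemma jensen_path {Ψ : ℝ → ℝ} (hc : ConvexOn ℝ Set.univ Ψ) (hcont : Continuous Ψ) {φ : ℝ → ℝ}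
    (hφ : Continuous φ) : Ψ (∫ θ in (0:ℝ)..(Real.pi/2), φ θ) ≤
      (2/Real.pi) * ∫ θ in (0:ℝ)..(Real.pi/2), Ψ (Real.pi/2 * φ θ) := by
  have hpi := Real.pi_pos
  have h0 : volume (Set.Ioc (0:ℝ) (Real.pi/2)) ≠ 0 := by simp [hpi]
  have h1 : volume (Set.Ioc (0:ℝ) (Real.pi/2)) ≠ ⊤ := by simp
  have h2 := hc.map_set_average_le (μ := volume) (f := fun θ => Real.pi/2 * φ θ)
    hcont.continuousOn isClosed_univ h0 h1 (by simp)
    ((Continuous.intervalIntegrable (by fun_prop) 0 (Real.pi/2)).1)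
    ((Continuous.intervalIntegrable (u := fun θ => Ψ (Real.pi/2 * φ θ)) (by fun_prop) 0 (Real.pi/2)).1)
  rw [setAverage_eq, setAverage_eq] at h2
  have h3 : volume.real (Set.Ioc (0:ℝ) (Real.pi/2)) = Real.pi/2 := by
    simp [measureReal_def]; positivity
  rw [h3, integral_const_mul] at h2
  rw [intervalIntegral.integral_of_le (by positivity), intervalIntegral.integral_of_le (by positivity)]
  simp only [smul_eq_mul] at h2
  have e1 : (Real.pi/2)⁻¹ * (Real.pi/2 * ∫ θ in Set.Ioc (0:ℝ) (Real.pi/2), φ θ)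
    = ∫ θ in Set.Ioc (0:ℝ) (Real.pi/2), φ θ := by field_simp
  rw [e1] at h2
  have e2 : (Real.pi/2)⁻¹ = 2/Real.pi := by field_simp
  rwa [e2] at h2

lemma maurey_pisier (γ : Measure E) [IsGaussian γ] (h0 : γ[id] = 0) {f : E → ℝ}
    {D : E × E → ℝ} (hD : Continuous D)
    (hf : ∀ x y : E, ∀ θ : ℝ, HasDerivAt (fun t : ℝ => f (Real.cos t • x + Real.sin t • y))
      (D (Real.cos θ • x + Real.sin θ • y, -Real.sin θ • x + Real.cos θ • y)) θ) {Ψ : ℝ → ℝ}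
    (hc : ConvexOn ℝ Set.univ Ψ) (hcont : Continuous Ψ) :
    ∫⁻ p, ENNReal.ofReal (Ψ (f p.2 - f p.1)) ∂(γ.prod γ) ≤
      ∫⁻ p, ENNReal.ofReal (Ψ (Real.pi/2 * D p)) ∂(γ.prod γ) := by
  have hpi := Real.pi_pos
  let F : E × E → ℝ := fun p => Ψ (Real.pi/2 * D p)
  have hFc : Continuous F := hcont.comp (continuous_const.mul hD)
  let R : ℝ → E × E → E × E := fun θ p =>
    (Real.cos θ • p.1 + Real.sin θ • p.2, -Real.sin θ • p.1 + Real.cos θ • p.2)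
  have hrot : ∀ θ : ℝ, (fun p => R θ p) = ⇑(ContinuousLinearMap.rotation (E := E) θ) := by
    intro θ; funext p; simp only [ContinuousLinearMap.rotation_apply]; rfl
  have hrc : Continuous (fun q : (E × E) × ℝ => R q.2 q.1) := by
    simp only [R]
    fun_prop
  have key : ∀ p : E × E, ENNReal.ofReal (Ψ (f p.2 - f p.1)) ≤ ENNReal.ofReal (2/Real.pi) *
      ∫⁻ θ in Set.Ioc (0:ℝ) (Real.pi/2), ENNReal.ofReal (F (R θ p)) := by
    intro p
    have hr : Continuous (fun θ : ℝ => R θ p) := by simp only [R]; fun_prop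
    have hφ : Continuous (fun θ : ℝ => D (R θ p)) := hD.comp hr
    have hint : ∫ θ in (0:ℝ)..(Real.pi/2), D (R θ p) = f p.2 - f p.1 := by
      rw [intervalIntegral.integral_eq_sub_of_hasDerivAt (fun θ _ => hf p.1 p.2 θ) (hφ.intervalIntegrable _ _)]
      simp
    have hj := jensen_path hc hcont hφ
    rw [hint, intervalIntegral.integral_of_le (by positivity)] at hj
    refine (ENNReal.ofReal_le_ofReal hj).trans ?_
    rw [ENNReal.ofReal_mul (by positivity)]
    gcongr
    have hi2 : IntegrableOn (fun θ => max (F (R θ p)) 0) (Set.Ioc (0:ℝ) (Real.pi/2)) :=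
      (Continuous.intervalIntegrable ((hFc.comp hr).max continuous_const) 0 (Real.pi/2)).1
    have hle : ∫ θ in Set.Ioc (0:ℝ) (Real.pi/2), Ψ (Real.pi/2 * D (R θ p)) ≤
        ∫ θ in Set.Ioc (0:ℝ) (Real.pi/2), max (F (R θ p)) 0 :=
      integral_mono (Continuous.intervalIntegrable (hFc.comp hr) 0 (Real.pi/2)).1 hi2
        (fun θ => le_max_left _ _)
    refine (ENNReal.ofReal_le_ofReal hle).trans ?_
    rw [ofReal_integral_eq_lintegral_ofReal hi2 (Eventually.of_forall fun θ => le_max_right _ _)]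
    refine lintegral_mono fun θ => ?_
    rw [ENNReal.ofReal_max]; simp
  calc _ ≤ ∫⁻ p, (ENNReal.ofReal (2/Real.pi) *
      ∫⁻ θ in Set.Ioc (0:ℝ) (Real.pi/2), ENNReal.ofReal (F (R θ p))) ∂(γ.prod γ) :=
        lintegral_mono key
    _ = ENNReal.ofReal (2/Real.pi) * ∫⁻ θ in Set.Ioc (0:ℝ) (Real.pi/2), ∫⁻ p,
        ENNReal.ofReal (F (R θ p)) ∂(γ.prod γ) := by
        rw [lintegral_const_mul' _ _ ENNReal.ofReal_ne_top, lintegral_lintegral_swap]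
        exact (ENNReal.continuous_ofReal.comp (hFc.comp hrc)).measurable.aemeasurable
    _ = ENNReal.ofReal (2/Real.pi) * ∫⁻ θ in Set.Ioc (0:ℝ) (Real.pi/2),
        (∫⁻ p, ENNReal.ofReal (F p) ∂(γ.prod γ)) := by
        congr 1
        refine lintegral_congr fun θ => ?_
        have e : (γ.prod γ).map (fun p => R θ p) = γ.prod γ := by
          rw [hrot θ, IsGaussian.map_rotation_eq_self h0]
        conv_rhs => rw [← e]
        rw [lintegral_map]
        · exact (ENNReal.continuous_ofReal.comp hFc).measurable
        · exact (by simp only [R]; fun_prop : Continuous (fun p => R θ p)).measurable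
    _ = _ := by
        rw [setLIntegral_const, Real.volume_Ioc, mul_comm, mul_assoc, ← ENNReal.ofReal_mul (by linarith)]
        have e1 : (Real.pi/2 - 0) * (2/Real.pi) = 1 := by field_simp; simp
        rw [e1]
        simp [F]

end gauss

instance isGaussian_pi {ι : Type*} [Fintype ι] {E : Type*} [NormedAddCommGroup E] [NormedSpace ℝ E]
    [MeasurableSpace E] [BorelSpace E] [CompleteSpace E] [SecondCountableTopology E] (μ : Measure E)
    [IsGaussian μ] : IsGaussian (Measure.pi fun _ : ι => μ) := by
  have h := iIndepFun.hasGaussianLaw (P := Measure.pi fun _ : ι => μ) (X := fun (i : ι) ω => ω i)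
    (fun i => ⟨by
      have := (measurePreserving_eval (fun _ : ι => μ) i).map_eq
      change IsGaussian (Measure.map (Function.eval i) (Measure.pi fun _ : ι => μ))
      rw [this]; infer_instance⟩)
    (iIndepFun_pi (μ := fun _ : ι => μ) (X := fun _ => (id : E → E)) (fun i => aemeasurable_id))
  have h2 := h.isGaussian_map
  simpa using h2

lemma integral_id_pi {ι : Type*} [Fintype ι] {E : Type*} [NormedAddCommGroup E] [NormedSpace ℝ E]
    [MeasurableSpace E] [BorelSpace E] [CompleteSpace E] [SecondCountableTopology E] (μ : Measure E)
    [IsGaussian μ] (h : μ[id] = 0) : (Measure.pi fun _ : ι => μ)[id] = 0 := by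
  funext i
  have h1 := IsGaussian.integrable_id (μ := Measure.pi fun _ : ι => μ)
  have h2 := (ContinuousLinearMap.proj (R := ℝ) (φ := fun _ : ι => E) i).integral_comp_comm h1
  have h3 := integral_comp_eval (μ := fun _ : ι => μ) (i := i) (f := (id : E → E)) aestronglyMeasurable_id
  exact h2.symm.trans (h3.trans h)
end

section
open scoped ENNReal NNReal
lemma pi_lin {ι : Type*} [Fintype ι] {E : Type*} [MeasurableSpace E] (μ : Measure E)
    [IsProbabilityMeasure μ] (L : ι → E → ℝ) (hL : ∀ i, Measurable (L i)) (v : ι → ℝ≥0)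
    (h : ∀ i, μ.map (L i) = gaussianReal 0 (v i)) :
    (Measure.pi fun _ : ι => μ).map (fun ω => ∑ i, L i (ω i)) = gaussianReal 0 (∑ i, v i) := by
  have hmap : ∀ i, (Measure.pi fun _ : ι => μ).map (fun ω => L i (ω i)) = gaussianReal 0 (v i) := by
    intro i
    rw [← h i]
    have := (measurePreserving_eval (fun _ : ι => μ) i).map_eq
    conv_rhs => rw [← this]
    rw [Measure.map_map (hL i) (measurable_pi_apply i)]; rfl
  have hg : ∀ i, HasGaussianLaw (fun ω : ι → E => L i (ω i)) (Measure.pi fun _ : ι => μ) :=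
    fun i => ⟨by rw [hmap i]; infer_instance⟩
  have h1 := iIndepFun.hasGaussianLaw_fun_sum (P := Measure.pi fun _ : ι => μ)
    (X := fun (i : ι) ω => L i (ω i)) hg
    (iIndepFun_pi (μ := fun _ : ι => μ) (X := fun i => L i) (fun i => (hL i).aemeasurable))
  rw [h1.map_eq_gaussianReal]
  have hint : ∀ i, ∫ ω, L i (ω i) ∂(Measure.pi fun _ : ι => μ) = 0 := by
    intro i
    have := integral_map (μ := Measure.pi fun _ : ι => μ) (φ := fun ω => L i (ω i)) (f := id)
      ((hL i).comp (measurable_pi_apply i)).aemeasurable (by fun_prop)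
    rw [hmap i] at this
    simpa using this.symm
  have hL2 : ∀ i, MemLp (L i) 2 μ := by
    intro i
    have h5 : MemLp (id : ℝ → ℝ) 2 (μ.map (L i)) := by rw [h i]; exact IsGaussian.memLp_two_id
    exact (memLp_map_measure_iff (by fun_prop) (hL i).aemeasurable).1 h5
  have hvar : ∀ i, Var[L i; μ] = v i := by
    intro i
    have h5 := variance_map (μ := μ) (Y := L i) (X := (id : ℝ → ℝ)) (by fun_prop) (hL i).aemeasurable
    rw [h i, variance_id_gaussianReal] at h5
    exact h5.symm
  congr 1
  · rw [integral_finsetSum _ fun i _ => (hg i).integrable]; simp [hint]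
  · have := variance_sum_pi (μ := fun _ : ι => μ) hL2
    rw [show (∑ i, fun ω : ι → E => L i (ω i)) = fun ω => ∑ i, L i (ω i) by
      funext ω; simp] at this
    rw [this]; simp only [hvar]
    rw [← NNReal.coe_sum, Real.toNNReal_coe]

lemma gaussVec_lin {ι : Type*} [Fintype ι] (u : ι → ℝ) :
    (Measure.pi fun _ : ι => gaussianReal 0 1).map (fun w => ∑ j, w j * u j) =
      gaussianReal 0 (∑ j, u j ^ 2).toNNReal := by
  have := pi_lin (gaussianReal 0 1) (fun (j : ι) (x : ℝ) => x * u j) (fun j => by fun_prop)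
    (fun j => (u j ^ 2).toNNReal) (fun j => by
      rw [gaussianReal_map_mul_const]; congr 1
      · simp
      · ext; simp [sq_nonneg])
  rw [this, Real.toNNReal_sum_of_nonneg]; intros; positivity

lemma gaussMat_lin {ι κ : Type*} [Fintype ι] [Fintype κ] (u : κ → ι → ℝ) :
    (Measure.pi fun _ : κ => Measure.pi fun _ : ι => gaussianReal 0 1).map
      (fun W => ∑ i, ∑ j, W i j * u i j) = gaussianReal 0 (∑ i, ∑ j, u i j ^ 2).toNNReal := by
  have := pi_lin (Measure.pi fun _ : ι => gaussianReal 0 1) (fun (i : κ) w => ∑ j, w j * u i j)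
    (fun j => by fun_prop) (fun i => (∑ j, u i j ^ 2).toNNReal) (fun i => gaussVec_lin (u i))
  rw [this, Real.toNNReal_sum_of_nonneg]; intros; positivity

lemma gaussReal_scale (v : ℝ) (hv : 0 ≤ v) (h : ℝ → ℝ) :
    ∫ x, h x ∂(gaussianReal 0 v.toNNReal) = ∫ x, h (√v * x) ∂(gaussianReal 0 1) := by
  have e : gaussianReal 0 v.toNNReal = (gaussianReal 0 1).map (fun x => √v * x) := by
    rw [gaussianReal_map_const_mul]; congr 1
    · simp
    · ext; simp [hv]
  rcases eq_or_lt_of_le hv with h0 | h0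
  · subst h0; simp [gaussianReal_zero_var]
  · have := (MeasurableEquiv.mulLeft₀ (√v) (by positivity)).measurableEmbedding.integral_map
      (μ := gaussianReal 0 1) h
    rw [e]; exact this

/-- polynomial growth -/
def PG {E : Type*} [NormedAddCommGroup E] (f : E → ℝ) : Prop :=
  Continuous f ∧ ∃ (C : ℝ) (k : ℕ), ∀ x, |f x| ≤ C * (1 + ‖x‖) ^ k

section PG
variable {E : Type*} [NormedAddCommGroup E]

lemma PG.cont {f : E → ℝ} (h : PG f) : Continuous f := h.1

lemma PG.const (c : ℝ) : PG (fun _ : E => c) := ⟨continuous_const, |c|, 0, by simp⟩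

lemma PG.add {f g : E → ℝ} (hf : PG f) (hg : PG g) : PG (fun x => f x + g x) := by
  obtain ⟨cf, C, k, h1⟩ := hf
  obtain ⟨cg, D, l, h2⟩ := hg
  refine ⟨cf.add cg, |C| + |D|, k + l, fun x => ?_⟩
  have hx : 1 ≤ 1 + ‖x‖ := by linarith [norm_nonneg x]
  have a1 : (1 + ‖x‖) ^ k ≤ (1 + ‖x‖) ^ (k + l) := pow_le_pow_right₀ hx (by omega)
  have a2 : (1 + ‖x‖) ^ l ≤ (1 + ‖x‖) ^ (k + l) := pow_le_pow_right₀ hx (by omega)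
  calc |f x + g x| ≤ |f x| + |g x| := abs_add_le _ _
    _ ≤ |C| * (1 + ‖x‖) ^ k + |D| * (1 + ‖x‖) ^ l := by
        gcongr
        · exact (h1 x).trans (by gcongr; exact le_abs_self C)
        · exact (h2 x).trans (by gcongr; exact le_abs_self D)
    _ ≤ |C| * (1 + ‖x‖) ^ (k+l) + |D| * (1 + ‖x‖) ^ (k+l) := by gcongr
    _ = _ := by ring

lemma PG.mul {f g : E → ℝ} (hf : PG f) (hg : PG g) : PG (fun x => f x * g x) := by
  obtain ⟨cf, C, k, h1⟩ := hf
  obtain ⟨cg, D, l, h2⟩ := hg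
  refine ⟨cf.mul cg, |C| * |D|, k + l, fun x => ?_⟩
  have hx : 1 ≤ 1 + ‖x‖ := by linarith [norm_nonneg x]
  calc |f x * g x| = |f x| * |g x| := abs_mul _ _
    _ ≤ (|C| * (1 + ‖x‖) ^ k) * (|D| * (1 + ‖x‖) ^ l) := by
        gcongr
        · exact (h1 x).trans (by gcongr; exact le_abs_self C)
        · exact (h2 x).trans (by gcongr; exact le_abs_self D)
    _ = _ := by ring

lemma PG.neg {f : E → ℝ} (hf : PG f) : PG (fun x => - f x) :=
  ⟨hf.1.neg, by simpa using hf.2⟩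

lemma PG.sub {f g : E → ℝ} (hf : PG f) (hg : PG g) : PG (fun x => f x - g x) := by
  simpa [sub_eq_add_neg] using hf.add hg.neg

lemma PG.pow {f : E → ℝ} (hf : PG f) (p : ℕ) : PG (fun x => f x ^ p) := by
  induction p with
  | zero => simpa using PG.const 1
  | succ p ih => simpa [pow_succ] using ih.mul hf

lemma PG.sum {ι : Type*} (s : Finset ι) {f : ι → E → ℝ} (hf : ∀ i, PG (f i)) :
    PG (fun x => ∑ i ∈ s, f i x) := by
  classical
  induction s using Finset.induction_on with
  | empty => simpa using PG.const 0
  | insert a s ha ih => simpa [Finset.sum_insert ha] using (hf a).add ih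

lemma PG.of_le {f g : E → ℝ} (hf : Continuous f) (hg : PG g) (h : ∀ x, |f x| ≤ g x) : PG f := by
  obtain ⟨_, C, k, h1⟩ := hg
  exact ⟨hf, C, k, fun x => (h x).trans ((le_abs_self _).trans (h1 x))⟩

lemma PG.lin [NormedSpace ℝ E] (L : E →L[ℝ] ℝ) : PG (fun x => L x) := by
  refine ⟨L.continuous, ‖L‖, 1, fun x => ?_⟩
  have := L.le_opNorm x
  rw [Real.norm_eq_abs] at this
  nlinarith [norm_nonneg L, norm_nonneg x]

lemma PG.comp {F : Type*} [NormedAddCommGroup F] {f : E → ℝ} (hf : PG f) {T : F → E}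
    (hT : Continuous T) {K : ℝ} (hK : ∀ x, ‖T x‖ ≤ K * (1 + ‖x‖)) : PG (fun x => f (T x)) := by
  obtain ⟨cf, C, k, h1⟩ := hf
  refine ⟨cf.comp hT, |C| * (1 + |K|) ^ k, k, fun x => ?_⟩
  have hx : 1 ≤ 1 + ‖x‖ := by linarith [norm_nonneg x]
  calc |f (T x)| ≤ |C| * (1 + ‖T x‖) ^ k := (h1 _).trans (by gcongr; exact le_abs_self C)
    _ ≤ |C| * ((1 + |K|) * (1 + ‖x‖)) ^ k := by
        gcongr
        have : K * (1 + ‖x‖) ≤ |K| * (1 + ‖x‖) := by gcongr; exact le_abs_self K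
        linarith [hK x]
    _ = _ := by rw [mul_pow]; ring

lemma PG.fst {F : Type*} [NormedAddCommGroup F] {f : E → ℝ} (hf : PG f) :
    PG (fun p : E × F => f p.1) :=
  hf.comp continuous_fst (K := 1) fun x => by linarith [norm_fst_le x]

lemma PG.snd {F : Type*} [NormedAddCommGroup F] {f : E → ℝ} (hf : PG f) :
    PG (fun p : F × E => f p.2) :=
  hf.comp continuous_snd (K := 1) fun x => by linarith [norm_snd_le x]

lemma PG.integrable [NormedSpace ℝ E] [MeasurableSpace E] [BorelSpace E] [CompleteSpace E]
    [SecondCountableTopology E] (μ : Measure E) [IsGaussian μ] {f : E → ℝ} (hf : PG f) :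
    Integrable f μ := by
  obtain ⟨cf, C, k, h1⟩ := hf
  have h2 : Integrable (fun x : E => ((1 : ℝ) + ‖x‖) ^ k) μ := by
    rcases Nat.eq_zero_or_pos k with rfl | hk
    · simp
    · have hm : MemLp (fun x : E => (1 : ℝ) + ‖x‖) k μ := by
        refine MemLp.add (memLp_const 1) ?_
        exact (IsGaussian.memLp_id μ k (by simp)).norm
      have := hm.integrable_norm_pow (by omega)
      refine this.congr (Eventually.of_forall fun x => ?_)
      have : 0 ≤ 1 + ‖x‖ := by positivity
      simp [abs_of_nonneg this]
  exact (h2.const_mul C).mono' cf.aestronglyMeasurable (Eventually.of_forall fun x => by simpa using h1 x)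
end PG
end

section
open scoped ENNReal NNReal
lemma opNorm_nonneg' {m n : ℕ} (X : Matrix (Fin m) (Fin n) ℝ) : 0 ≤ opNorm X := norm_nonneg _

lemma opNorm_mulVec_sq {m n : ℕ} (X : Matrix (Fin m) (Fin n) ℝ) (v : Fin n → ℝ) :
    ∑ j, (∑ α, X j α * v α) ^ 2 ≤ opNorm X ^ 2 * ∑ α, v α ^ 2 := by
  have h := (LinearMap.toContinuousLinearMap (Matrix.toEuclideanLin X)).le_opNorm (WithLp.toLp 2 v)
  have h2 := pow_le_pow_left₀ (norm_nonneg _) h 2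
  rw [mul_pow, EuclideanSpace.norm_sq_eq, EuclideanSpace.norm_sq_eq] at h2
  simpa [Matrix.toEuclideanLin, Matrix.mulVec, dotProduct, opNorm] using h2

lemma opNorm_le_of {m n : ℕ} (X : Matrix (Fin m) (Fin n) ℝ) {K : ℝ} (hK : 0 ≤ K)
    (h : ∀ v : Fin n → ℝ, ∑ j, (∑ α, X j α * v α) ^ 2 ≤ K ^ 2 * ∑ α, v α ^ 2) : opNorm X ≤ K := by
  refine ContinuousLinearMap.opNorm_le_bound _ hK fun v => ?_
  refine le_of_sq_le_sq ?_ (by positivity)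
  rw [mul_pow, EuclideanSpace.norm_sq_eq, EuclideanSpace.norm_sq_eq]
  simpa [Matrix.toEuclideanLin, Matrix.mulVec, dotProduct] using h v

/-- pre-activations -/
def pre {d m n : ℕ} (X : Matrix (Fin m) (Fin n) ℝ) (W : Fin d → Fin m → ℝ) (i : Fin d) (α : Fin n) : ℝ :=
  ∑ j, W i j * X j α

/-- activations -/
def Yv {d m n : ℕ} (σ : ℝ → ℝ) (X : Matrix (Fin m) (Fin n) ℝ) (W : Fin d → Fin m → ℝ) :
    Fin d → Fin n → ℝ := fun i α => σ (pre X W i α)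

/-- Gaussian moments -/
noncomputable def gM (p : ℕ) : ℝ := ∫ x, x ^ (2 * p) ∂(gaussianReal 0 1)

lemma gM_nonneg (p : ℕ) : 0 ≤ gM p := integral_nonneg fun x => by
  rw [pow_mul]; positivity

lemma pre_lin {d m n : ℕ} (X : Matrix (Fin m) (Fin n) ℝ) (h : Fin d → Fin n → ℝ) (V : Fin d → Fin m → ℝ) :
    ∑ i, ∑ α, h i α * pre X V i α = ∑ i, ∑ j, V i j * (∑ α, X j α * h i α) := by
  refine Finset.sum_congr rfl fun i _ => ?_
  simp only [pre, Finset.mul_sum]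
  rw [Finset.sum_comm]
  refine Finset.sum_congr rfl fun j _ => Finset.sum_congr rfl fun α _ => by ring

lemma pre_PG {d m n : ℕ} (X : Matrix (Fin m) (Fin n) ℝ) (i : Fin d) (α : Fin n) :
    PG (fun W : Fin d → Fin m → ℝ => pre X W i α) := by
  unfold pre
  refine PG.sum _ fun j => ?_
  refine PG.mul ?_ (PG.const _)
  exact PG.lin ((ContinuousLinearMap.proj (R := ℝ) (φ := fun _ : Fin m => ℝ) j).comp
    (ContinuousLinearMap.proj (R := ℝ) (φ := fun _ : Fin d => Fin m → ℝ) i))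

lemma sigma_lip {σ σ' : ℝ → ℝ} {l : ℝ} (h : ∀ x, HasDerivAt σ (σ' x) x) (hb : ∀ x, |σ' x| ≤ l) (x y : ℝ) :
    |σ y - σ x| ≤ l * |y - x| := by
  have := Convex.norm_image_sub_le_of_norm_hasDerivWithin_le (f := σ) (f' := σ') (s := Set.univ) (C := l)
    (fun x _ => (h x).hasDerivWithinAt) (fun x _ => hb x) convex_univ (Set.mem_univ x) (Set.mem_univ y)
  simpa using this

lemma sigma_PG {E : Type*} [NormedAddCommGroup E] {σ σ' : ℝ → ℝ} {l : ℝ} (h : ∀ x, HasDerivAt σ (σ' x) x)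
    (hb : ∀ x, |σ' x| ≤ l) {f : E → ℝ} (hf : PG f) : PG (fun x => σ (f x)) := by
  have hc : Continuous σ := continuous_iff_continuousAt.2 fun x => (h x).continuousAt
  have hl : 0 ≤ l := (abs_nonneg _).trans (hb 0)
  refine PG.of_le (hc.comp hf.1) ((PG.const |σ 0|).add ((PG.const l).mul ((hf.pow 2).add (PG.const 1)))) fun x => ?_
  have h1 := sigma_lip h hb 0 (f x)
  have h2 : |σ (f x)| ≤ |σ 0| + |σ (f x) - σ 0| := by
    have := abs_add_le (σ 0) (σ (f x) - σ 0); simpa using this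
  have h3 : |f x - 0| ≤ f x ^ 2 + 1 := by
    rw [sub_zero]; nlinarith [sq_nonneg (|f x| - 1), sq_abs (f x), abs_nonneg (f x)]
  have := mul_le_mul_of_nonneg_left h3 hl
  linarith

lemma lin_moment {d m n : ℕ} (X : Matrix (Fin m) (Fin n) ℝ) (h : Fin d → Fin n → ℝ) (p : ℕ) :
    ∫ V, (∑ i, ∑ α, h i α * pre X V i α) ^ (2 * p) ∂(gaussianMat d m) ≤
      (opNorm X ^ 2 * ∑ i, ∑ α, h i α ^ 2) ^ p * gM p := by
  simp only [pre_lin]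
  set u : Fin d → Fin m → ℝ := fun i j => ∑ α, X j α * h i α
  have h1 := integral_map (μ := gaussianMat d m) (φ := fun W => ∑ i, ∑ j, W i j * u i j)
    (f := fun x => x ^ (2*p)) (by fun_prop : Measurable _).aemeasurable (by fun_prop)
  rw [gaussMat_lin, gaussReal_scale _ (by positivity)] at h1
  rw [← h1]
  simp only [mul_pow, integral_const_mul]
  rw [pow_mul, Real.sq_sqrt (by positivity)]
  refine mul_le_mul_of_nonneg_right ?_ (gM_nonneg p)
  rw [← mul_pow]
  refine pow_le_pow_left₀ (by positivity) ?_ p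
  rw [Finset.mul_sum]
  exact Finset.sum_le_sum fun i _ => opNorm_mulVec_sq X (h i)

lemma lin_exp {d m n : ℕ} (X : Matrix (Fin m) (Fin n) ℝ) (h : Fin d → Fin n → ℝ) :
    ∫⁻ V, ENNReal.ofReal (Real.exp (∑ i, ∑ α, h i α * pre X V i α)) ∂(gaussianMat d m) ≤
      ENNReal.ofReal (Real.exp ((opNorm X ^ 2 * ∑ i, ∑ α, h i α ^ 2) / 2)) := by
  simp only [pre_lin]
  set u : Fin d → Fin m → ℝ := fun i j => ∑ α, X j α * h i α
  have h1 := lintegral_map (μ := gaussianMat d m) (g := fun W => ∑ i, ∑ j, W i j * u i j)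
    (f := fun x => ENNReal.ofReal (Real.exp x)) (by fun_prop) (by fun_prop)
  rw [gaussMat_lin] at h1
  rw [← h1]
  have h2 := mgf_gaussianReal (p := gaussianReal 0 (∑ i, ∑ j, u i j ^ 2).toNNReal) (X := id)
    (μ := 0) (v := (∑ i, ∑ j, u i j ^ 2).toNNReal) (by simp) 1
  have h3 : Integrable (fun x : ℝ => Real.exp x) (gaussianReal 0 (∑ i, ∑ j, u i j ^ 2).toNNReal) := by
    have := integrable_exp_mul_gaussianReal (μ := 0) (v := (∑ i, ∑ j, u i j ^ 2).toNNReal) 1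
    simpa using this
  rw [← ofReal_integral_eq_lintegral_ofReal h3 (Eventually.of_forall fun x => (Real.exp_pos x).le)]
  refine ENNReal.ofReal_le_ofReal ?_
  have h4 : ∫ x, Real.exp x ∂(gaussianReal 0 (∑ i, ∑ j, u i j ^ 2).toNNReal) =
      Real.exp ((∑ i, ∑ j, u i j ^ 2) / 2) := by
    have e : (0:ℝ) ≤ ∑ i, ∑ j, u i j ^ 2 := by positivity
    simpa [mgf, e] using h2
  rw [h4]
  refine Real.exp_le_exp.2 (div_le_div_of_nonneg_right ?_ (by norm_num))
  rw [Finset.mul_sum]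
  exact Finset.sum_le_sum fun i _ => opNorm_mulVec_sq X (h i)

lemma gaussMat_mean (d m : ℕ) : (gaussianMat d m)[id] = 0 :=
  integral_id_pi _ (integral_id_pi _ (by simp))

/-- chain-rule data for `g` -/
def HasGrad {d n : ℕ} (g : (Fin d → Fin n → ℝ) → ℝ) (dg : (Fin d → Fin n → ℝ) → Fin d → Fin n → ℝ) : Prop :=
  ∀ (c : ℝ → Fin d → Fin n → ℝ) (c' : Fin d → Fin n → ℝ) (t : ℝ),
    (∀ i α, HasDerivAt (fun s => c s i α) (c' i α) t) →
    HasDerivAt (fun s => g (c s)) (∑ i, ∑ α, dg (c t) i α * c' i α) t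

section conc
variable {d m n : ℕ} {σ σ' : ℝ → ℝ} {l : ℝ} (X : Matrix (Fin m) (Fin n) ℝ)

/-- derivative functional -/
def Dfun (σ σ' : ℝ → ℝ) (X : Matrix (Fin m) (Fin n) ℝ) (dg : (Fin d → Fin n → ℝ) → Fin d → Fin n → ℝ)
    (p : (Fin d → Fin m → ℝ) × (Fin d → Fin m → ℝ)) : ℝ :=
  ∑ i, ∑ α, (dg (Yv σ X p.1) i α * σ' (pre X p.1 i α)) * pre X p.2 i α

lemma conc_deriv (hσ : ∀ x, HasDerivAt σ (σ' x) x) {g : (Fin d → Fin n → ℝ) → ℝ}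
    {dg : (Fin d → Fin n → ℝ) → Fin d → Fin n → ℝ} (hg : HasGrad g dg) (x y : Fin d → Fin m → ℝ) (θ : ℝ) :
    HasDerivAt (fun t : ℝ => g (Yv σ X (Real.cos t • x + Real.sin t • y)))
      (Dfun σ σ' X dg (Real.cos θ • x + Real.sin θ • y, -Real.sin θ • x + Real.cos θ • y)) θ := by
  have h1 := hg (fun t => Yv σ X (Real.cos t • x + Real.sin t • y))
    (fun i α => σ' (pre X (Real.cos θ • x + Real.sin θ • y) i α) *
      pre X (-Real.sin θ • x + Real.cos θ • y) i α) θ (fun i α => by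
      refine (hσ _).comp θ ?_
      unfold pre
      refine HasDerivAt.fun_sum fun j _ => ?_
      have := (((Real.hasDerivAt_cos θ).mul_const (x i j)).add
        ((Real.hasDerivAt_sin θ).mul_const (y i j))).mul_const (X j α)
      exact this)
  unfold Dfun
  simpa only [mul_assoc] using h1

lemma Dfun_PG (hσ' : Continuous σ') (hb : ∀ x, |σ' x| ≤ l)
    {dg : (Fin d → Fin n → ℝ) → Fin d → Fin n → ℝ}
    (hdg : ∀ i α, PG (fun W : Fin d → Fin m → ℝ => dg (Yv σ X W) i α)) : PG (Dfun σ σ' X dg) := by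
  unfold Dfun
  refine PG.sum _ fun i => PG.sum _ fun α => ?_
  refine PG.mul (PG.fst (f := fun W => dg (Yv σ X W) i α * σ' (pre X W i α)) ?_) (PG.snd (pre_PG X i α))
  refine (hdg i α).mul ?_
  exact PG.of_le (hσ'.comp (pre_PG X i α).1) (PG.const l) fun W => hb _

lemma conc_moment (hσ : ∀ x, HasDerivAt σ (σ' x) x) (hσ' : Continuous σ') (hb : ∀ x, |σ' x| ≤ l)
    {g : (Fin d → Fin n → ℝ) → ℝ}
    {dg : (Fin d → Fin n → ℝ) → Fin d → Fin n → ℝ} (hg : HasGrad g dg)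
    (hgPG : PG (fun W : Fin d → Fin m → ℝ => g (Yv σ X W)))
    (hdg : ∀ i α, PG (fun W : Fin d → Fin m → ℝ => dg (Yv σ X W) i α)) (p : ℕ) :
    ∫ W, (g (Yv σ X W) - ∫ W', g (Yv σ X W') ∂(gaussianMat d m)) ^ (2 * p) ∂(gaussianMat d m) ≤
      ((Real.pi / 2 * opNorm X * l) ^ (2 * p) * gM p) *
        ∫ W, (∑ i, ∑ α, dg (Yv σ X W) i α ^ 2) ^ p ∂(gaussianMat d m) := by
  set γ := gaussianMat d m
  set f : (Fin d → Fin m → ℝ) → ℝ := fun W => g (Yv σ X W)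
  have hDPG := Dfun_PG X (σ := σ) hσ' hb hdg
  have hconv : ConvexOn ℝ Set.univ (fun x : ℝ => x ^ (2 * p)) := (even_two_mul p).convexOn_pow
  have h1 := maurey_pisier γ (gaussMat_mean d m) (f := f) hDPG.1 (conc_deriv X hσ hg)
    hconv (by fun_prop)
  have hi1 : Integrable (fun q : (Fin d → Fin m → ℝ) × (Fin d → Fin m → ℝ) => (f q.2 - f q.1) ^ (2*p)) (γ.prod γ) :=
    ((hgPG.snd.sub hgPG.fst).pow (2*p)).integrable _
  have hi2 : Integrable (fun q => (Real.pi / 2 * Dfun σ σ' X dg q) ^ (2*p)) (γ.prod γ) :=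
    (((PG.const _).mul hDPG).pow (2*p)).integrable _
  rw [← ofReal_integral_eq_lintegral_ofReal hi1 (Eventually.of_forall fun x => (even_two_mul p).pow_nonneg _),
    ← ofReal_integral_eq_lintegral_ofReal hi2 (Eventually.of_forall fun x => (even_two_mul p).pow_nonneg _),
    ENNReal.ofReal_le_ofReal_iff (integral_nonneg fun x => (even_two_mul p).pow_nonneg _),
    integral_prod _ hi1, integral_prod _ hi2] at h1
  have hif : Integrable f γ := hgPG.integrable _
  calc ∫ W, (f W - ∫ W', f W' ∂γ) ^ (2 * p) ∂γ ≤ ∫ x, ∫ y, (f y - f x) ^ (2*p) ∂γ ∂γ := by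
        refine integral_mono (((hgPG.sub (PG.const _)).pow _).integrable _) hi1.integral_prod_left fun x => ?_
        have := hconv.map_integral_le (μ := γ) (f := fun y => f y - f x) (by fun_prop) isClosed_univ
          (by simp) (hif.sub (integrable_const _)) (((hgPG.sub (PG.const (f x))).pow (2*p)).integrable γ)
        rw [integral_sub hif (integrable_const _)] at this
        simp only [integral_const, probReal_univ, smul_eq_mul, one_mul] at this
        refine le_trans (le_of_eq ?_) this
        rw [← neg_sub, (even_two_mul p).neg_pow]
    _ ≤ _ := h1
    _ ≤ ∫ x, ((Real.pi / 2 * opNorm X * l) ^ (2 * p) * gM p) * (∑ i, ∑ α, dg (Yv σ X x) i α ^ 2) ^ p ∂γ := by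
        refine integral_mono hi2.integral_prod_left ?_ fun x => ?_
        · exact ((PG.const _).mul ((PG.sum _ fun i => PG.sum _ fun α => (hdg i α).pow 2).pow p)).integrable _
        simp only [mul_pow, integral_const_mul]
        have h3 := lin_moment X (fun i α => dg (Yv σ X x) i α * σ' (pre X x i α)) p
        have h4 : ∑ i, ∑ α, (dg (Yv σ X x) i α * σ' (pre X x i α)) ^ 2 ≤ l ^ 2 * ∑ i, ∑ α, dg (Yv σ X x) i α ^ 2 := by
          simp only [Finset.mul_sum]
          refine Finset.sum_le_sum fun i _ => Finset.sum_le_sum fun α _ => ?_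
          rw [mul_pow, mul_comm, ← sq_abs (σ' _)]
          exact mul_le_mul_of_nonneg_right (pow_le_pow_left₀ (abs_nonneg _) (hb _) 2) (sq_nonneg _)
        have h5 : (opNorm X ^ 2 * ∑ i, ∑ α, (dg (Yv σ X x) i α * σ' (pre X x i α)) ^ 2) ^ p * gM p ≤
            (opNorm X ^ 2 * (l ^ 2 * ∑ i, ∑ α, dg (Yv σ X x) i α ^ 2)) ^ p * gM p := by
          refine mul_le_mul_of_nonneg_right ?_ (gM_nonneg p)
          exact pow_le_pow_left₀ (by positivity) (mul_le_mul_of_nonneg_left h4 (sq_nonneg _)) p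
        have h6 := mul_le_mul_of_nonneg_left (h3.trans h5) (by positivity : 0 ≤ Real.pi ^ (2*p) / 2 ^ (2*p))
        unfold Dfun
        rw [div_pow]
        refine h6.trans (le_of_eq ?_)
        rw [mul_pow, mul_pow, ← pow_mul, ← pow_mul]; ring
    _ = _ := by rw [integral_const_mul]

lemma jensen_exp {E : Type*} [MeasurableSpace E] (μ : Measure E) [IsProbabilityMeasure μ] {h : E → ℝ}
    (hi : Integrable h μ) : ENNReal.ofReal (Real.exp (∫ x, h x ∂μ)) ≤ ∫⁻ x, ENNReal.ofReal (Real.exp (h x)) ∂μ := by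
  by_cases hx : Integrable (fun x => Real.exp (h x)) μ
  · rw [← ofReal_integral_eq_lintegral_ofReal hx (Eventually.of_forall fun x => (Real.exp_pos _).le)]
    exact ENNReal.ofReal_le_ofReal (convexOn_exp.map_integral_le (by fun_prop) isClosed_univ (by simp) hi hx)
  · have : ∫⁻ x, ENNReal.ofReal (Real.exp (h x)) ∂μ = ⊤ := by
      by_contra hne
      apply hx
      refine ⟨Real.continuous_exp.comp_aestronglyMeasurable hi.1, ?_⟩
      rw [hasFiniteIntegral_iff_ofReal (Eventually.of_forall fun x => (Real.exp_pos _).le)]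
      exact lt_top_iff_ne_top.2 hne
    rw [this]; exact le_top

lemma conc_exp (hσ : ∀ x, HasDerivAt σ (σ' x) x) (hσ' : Continuous σ') (hb : ∀ x, |σ' x| ≤ l)
    (h : Fin d → Fin n → ℝ) :
    ∫⁻ W, ENNReal.ofReal (Real.exp ((∑ i, ∑ α, h i α * Yv σ X W i α) -
        ∫ W', (∑ i, ∑ α, h i α * Yv σ X W' i α) ∂(gaussianMat d m))) ∂(gaussianMat d m) ≤
      ENNReal.ofReal (Real.exp ((Real.pi / 2 * opNorm X * l) ^ 2 * (∑ i, ∑ α, h i α ^ 2) / 2)) := by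
  set γ := gaussianMat d m
  set f : (Fin d → Fin m → ℝ) → ℝ := fun W => ∑ i, ∑ α, h i α * Yv σ X W i α
  have hYPG : ∀ i α, PG (fun W : Fin d → Fin m → ℝ => Yv σ X W i α) := fun i α => sigma_PG hσ hb (pre_PG X i α)
  have hfPG : PG f := PG.sum _ fun i => PG.sum _ fun α => (PG.const _).mul (hYPG i α)
  have hif : Integrable f γ := hfPG.integrable _
  have hg : HasGrad (fun Y : Fin d → Fin n → ℝ => - ∑ i, ∑ α, h i α * Y i α) (fun _ i α => - h i α) := by
    intro c c' t hc
    have : HasDerivAt (fun s => -∑ i, ∑ α, h i α * c s i α) (-∑ i, ∑ α, h i α * c' i α) t := by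
      refine HasDerivAt.neg ?_
      exact HasDerivAt.fun_sum fun i _ => HasDerivAt.fun_sum fun α _ => (hc i α).const_mul _
    simpa [neg_mul, Finset.sum_neg_distrib] using this
  have hDPG := Dfun_PG X (σ := σ) (dg := fun _ i α => - h i α) hσ' hb (fun i α => PG.const _)
  have h1 := maurey_pisier γ (gaussMat_mean d m) (f := fun W => - f W) hDPG.1 (conc_deriv X hσ hg)
    convexOn_exp (by fun_prop)
  have hm1 : Measurable (fun q : (Fin d → Fin m → ℝ) × (Fin d → Fin m → ℝ) => ENNReal.ofReal (Real.exp (-f q.2 - -f q.1))) :=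
    (ENNReal.continuous_ofReal.comp (Real.continuous_exp.comp (hfPG.snd.neg.sub hfPG.fst.neg).1)).measurable
  have hm2 : Measurable (fun q : (Fin d → Fin m → ℝ) × (Fin d → Fin m → ℝ) => ENNReal.ofReal (Real.exp
      (Real.pi / 2 * Dfun σ σ' X (fun _ i α => - h i α) q))) :=
    (ENNReal.continuous_ofReal.comp (Real.continuous_exp.comp (continuous_const.mul hDPG.1))).measurable
  rw [lintegral_prod _ hm1.aemeasurable, lintegral_prod _ hm2.aemeasurable] at h1
  calc _ ≤ ∫⁻ x, ∫⁻ y, ENNReal.ofReal (Real.exp (- f y - - f x)) ∂γ ∂γ := by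
        refine lintegral_mono fun x => ?_
        have := jensen_exp γ (h := fun y => - f y - - f x) (hif.neg.sub (integrable_const _))
        refine le_trans (le_of_eq ?_) this
        have e2 : ∫ y, (- f y - - f x) ∂γ = f x - integral γ f := by
          rw [integral_sub (f := fun y => - f y) hif.neg (integrable_const _), integral_neg]
          simp; ring
        rw [e2]
    _ ≤ _ := h1
    _ ≤ ∫⁻ x, ENNReal.ofReal (Real.exp ((Real.pi / 2 * opNorm X * l) ^ 2 * (∑ i, ∑ α, h i α ^ 2) / 2)) ∂γ := by
        refine lintegral_mono fun x => ?_
        have h3 := lin_exp X (fun i α => Real.pi / 2 * (- h i α * σ' (pre X x i α)))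
        have e : ∀ y, Real.pi / 2 * Dfun σ σ' X (fun _ i α => - h i α) (x, y) =
          ∑ i, ∑ α, Real.pi / 2 * (- h i α * σ' (pre X x i α)) * pre X y i α := by
          intro y; simp only [Dfun, Finset.mul_sum, mul_assoc]
        simp only [e]
        refine h3.trans (ENNReal.ofReal_le_ofReal (Real.exp_le_exp.2 ?_))
        refine div_le_div_of_nonneg_right ?_ (by norm_num)
        rw [show (Real.pi / 2 * opNorm X * l) ^ 2 * (∑ i, ∑ α, h i α ^ 2) =
          opNorm X ^ 2 * ((Real.pi / 2 * l)^2 * (∑ i, ∑ α, h i α ^ 2)) by ring]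
        refine mul_le_mul_of_nonneg_left ?_ (sq_nonneg _)
        simp only [Finset.mul_sum]
        refine Finset.sum_le_sum fun i _ => Finset.sum_le_sum fun α _ => ?_
        have h5 := pow_le_pow_left₀ (abs_nonneg _) (hb (pre X x i α)) 2
        rw [sq_abs] at h5
        have := mul_le_mul_of_nonneg_left h5 (by positivity : 0 ≤ (Real.pi/2)^2 * h i α ^ 2)
        nlinarith
    _ = _ := by simp
end conc
end

section
open scoped ENNReal NNReal
lemma PG_id : PG (fun x : ℝ => x) := PG.lin (ContinuousLinearMap.id ℝ ℝ)

lemma PG_abs {E : Type*} [NormedAddCommGroup E] {f : E → ℝ} (hf : PG f) : PG (fun x => |f x|) :=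
  ⟨hf.1.abs, by simpa using hf.2⟩

lemma stein {σ σ' : ℝ → ℝ} {l : ℝ} (h : ∀ x, HasDerivAt σ (σ' x) x) (hc : Continuous σ')
    (hb : ∀ x, |σ' x| ≤ l) :
    ∫ x, x * σ x ∂(gaussianReal 0 1) = ∫ x, σ' x ∂(gaussianReal 0 1) := by
  have hσPG : PG σ := sigma_PG h hb PG_id
  have hσ'PG : PG σ' := PG.of_le hc (PG.const l) hb
  have hint : ∀ f : ℝ → ℝ, PG f → Integrable (fun x => gaussianPDFReal 0 1 x * f x) := by
    intro f hf
    have h1 : Integrable f (gaussianReal 0 1) := hf.integrable _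
    rw [gaussianReal_of_var_ne_zero _ one_ne_zero, integrable_withDensity_iff_integrable_smul'
      (measurable_gaussianPDF _ _) (Eventually.of_forall fun x => gaussianPDF_lt_top)] at h1
    simpa [toReal_gaussianPDF] using h1
  rw [integral_gaussianReal_eq_integral_smul one_ne_zero, integral_gaussianReal_eq_integral_smul one_ne_zero]
  have hv : ∀ x, HasDerivAt (gaussianPDFReal 0 1) (- x * gaussianPDFReal 0 1 x) x := by
    intro x
    have : HasDerivAt (fun x : ℝ => (√(2 * Real.pi * ((1:ℝ≥0):ℝ)))⁻¹ * Real.exp (-(x - 0) ^ 2 / (2 * ((1:ℝ≥0):ℝ))))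
      ((√(2 * Real.pi * ((1:ℝ≥0):ℝ)))⁻¹ * (Real.exp (-(x - 0) ^ 2 / (2 * ((1:ℝ≥0):ℝ))) * (-(2 * (x - 0) ^ 1 * 1) / (2 * ((1:ℝ≥0):ℝ))))) x := by
      refine HasDerivAt.const_mul _ (HasDerivAt.exp ?_)
      refine HasDerivAt.div_const ?_ _
      exact (((hasDerivAt_id x).sub_const 0).pow 2).neg
    have e : (fun x : ℝ => (√(2 * Real.pi * ((1:ℝ≥0):ℝ)))⁻¹ * Real.exp (-(x - 0) ^ 2 / (2 * ((1:ℝ≥0):ℝ)))) =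
      gaussianPDFReal 0 1 := by funext x; simp only [gaussianPDFReal]
    rw [e] at this
    convert this using 1
    simp only [gaussianPDFReal, NNReal.coe_one]
    ring
  have := integral_mul_deriv_eq_deriv_mul_of_integrable (u := σ) (v := gaussianPDFReal 0 1)
    (u' := σ') (v' := fun x => - x * gaussianPDFReal 0 1 x) (fun x _ => h x) (fun x _ => hv x)
    (by simpa [Pi.mul_def, mul_comm, mul_left_comm, mul_assoc] using (hint _ (PG_id.mul hσPG)).neg)
    (by simpa [Pi.mul_def, mul_comm] using hint _ hσ'PG) (by simpa [Pi.mul_def, mul_comm] using hint _ hσPG)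
  simp only [smul_eq_mul]
  have e1 : ∫ x, gaussianPDFReal 0 1 x * (x * σ x) = - ∫ x, σ x * (-x * gaussianPDFReal 0 1 x) := by
    rw [← integral_neg]; congr 1; funext x; ring
  rw [e1, this, neg_neg]; congr 1; funext x; ring

lemma taylor2 {σ σ' σ'' : ℝ → ℝ} {l : ℝ} (h : ∀ x, HasDerivAt σ (σ' x) x)
    (h2 : ∀ x, HasDerivAt σ' (σ'' x) x) (hb2 : ∀ x, |σ'' x| ≤ l) (r t : ℝ) :
    |σ (r + t) - σ r - t * σ' r| ≤ l * t ^ 2 := by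
  have hl : 0 ≤ l := (abs_nonneg _).trans (hb2 0)
  have := Convex.norm_image_sub_le_of_norm_hasDerivWithin_le (f := fun s => σ (r + s) - s * σ' r)
    (f' := fun s => σ' (r + s) - σ' r) (s := Set.uIcc 0 t) (C := l * |t|) (x := 0) (y := t)
    (fun x _ => ?_) (fun x hx => ?_) (convex_uIcc 0 t) Set.left_mem_uIcc Set.right_mem_uIcc
  · simp only [Real.norm_eq_abs, add_zero, zero_mul, sub_zero] at this
    rw [show σ (r+t) - σ r - t * σ' r = σ (r+t) - t * σ' r - σ r by ring]
    calc _ ≤ _ := this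
      _ = l * (|t| * |t|) := by ring
      _ = _ := by rw [abs_mul_abs_self]; ring
  · have a1 : HasDerivAt (fun s => σ (r + s)) (σ' (r + x)) x := (h (r+x)).comp_const_add r x
    have a2 : HasDerivAt (fun s : ℝ => s * σ' r) (1 * σ' r) x := (hasDerivAt_id x).mul_const _
    simpa using (a1.fun_sub a2).hasDerivWithinAt
  · have := sigma_lip h2 hb2 r (r + x)
    refine this.trans (mul_le_mul_of_nonneg_left ?_ hl)
    have := Set.abs_sub_left_of_mem_uIcc hx
    simpa using this

lemma sqrt_sub_one_le {a : ℝ} (ha : 0 ≤ a) : |√a - 1| ≤ |a - 1| := by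
  have h : a - 1 = (√a - 1) * (√a + 1) := by nlinarith [Real.sq_sqrt ha]
  rw [h, abs_mul]
  have : 1 ≤ |√a + 1| := by rw [abs_of_nonneg (by positivity)]; linarith [Real.sqrt_nonneg a]
  nlinarith [abs_nonneg (√a - 1)]

/-- E|ξ| -/
noncomputable def gA : ℝ := ∫ x, |x| ∂(gaussianReal 0 1)

lemma gA_nonneg : 0 ≤ gA := integral_nonneg fun x => abs_nonneg x

lemma PG_scale {f : ℝ → ℝ} (hf : PG f) (s : ℝ) : PG (fun x => f (s * x)) :=
  hf.comp (by fun_prop) (K := |s|) fun x => by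
    rw [norm_mul, Real.norm_eq_abs]; nlinarith [abs_nonneg s, norm_nonneg x]

lemma lip_mean {h h' : ℝ → ℝ} {l : ℝ} (hd : ∀ x, HasDerivAt h (h' x) x) (hb : ∀ x, |h' x| ≤ l) {a : ℝ}
    (ha : 0 ≤ a) : |∫ x, h (√a * x) ∂(gaussianReal 0 1) - ∫ x, h x ∂(gaussianReal 0 1)| ≤ l * gA * |a - 1| := by
  have hl : 0 ≤ l := (abs_nonneg _).trans (hb 0)
  have hPG : PG h := sigma_PG hd hb PG_id
  rw [← integral_sub ((PG_scale hPG _).integrable _) (hPG.integrable _)]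
  refine (abs_integral_le_integral_abs).trans ?_
  have : ∫ x, |h (√a * x) - h x| ∂(gaussianReal 0 1) ≤ ∫ x, (l * |a - 1|) * |x| ∂(gaussianReal 0 1) := by
    refine integral_mono ((PG_abs ((PG_scale hPG _).sub hPG)).integrable _)
      (((PG.const _).mul (PG_abs PG_id)).integrable _) fun x => ?_
    refine (sigma_lip hd hb x (√a * x)).trans ?_
    rw [show √a * x - x = (√a - 1) * x by ring, abs_mul, mul_assoc]
    exact mul_le_mul_of_nonneg_left (mul_le_mul_of_nonneg_right (sqrt_sub_one_le ha) (abs_nonneg x)) hl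
  refine this.trans (le_of_eq ?_)
  rw [integral_const_mul]; simp only [gA]; ring

lemma lin_int {m : ℕ} (u : Fin m → ℝ) {h : ℝ → ℝ} (hc : Continuous h) :
    ∫ w, h (∑ j, w j * u j) ∂(gaussianVec m) = ∫ x, h (√(∑ j, u j ^ 2) * x) ∂(gaussianReal 0 1) := by
  have h1 := integral_map (μ := gaussianVec m) (φ := fun w => ∑ j, w j * u j)
    (f := h) (by fun_prop : Measurable _).aemeasurable (by fun_prop)
  rw [gaussVec_lin, gaussReal_scale _ (by positivity)] at h1
  exact h1.symm

/-- linear functional -/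
noncomputable def linF {m : ℕ} (u : Fin m → ℝ) : (Fin m → ℝ) →L[ℝ] ℝ :=
  ∑ j, u j • ContinuousLinearMap.proj (R := ℝ) (φ := fun _ : Fin m => ℝ) j

lemma linF_apply {m : ℕ} (u w : Fin m → ℝ) : linF u w = ∑ j, w j * u j := by
  simp [linF, mul_comm]

lemma var_linF {m : ℕ} (u : Fin m → ℝ) : Var[linF u; gaussianVec m] = ∑ j, u j ^ 2 := by
  have h5 := variance_map (μ := gaussianVec m) (Y := linF u) (X := (id : ℝ → ℝ)) (by fun_prop)
    (linF u).continuous.measurable.aemeasurable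
  have e : (⇑(linF u)) = fun w => ∑ j, w j * u j := funext (linF_apply u)
  rw [Function.id_comp] at h5
  rw [← h5, e, gaussVec_lin, variance_id_gaussianReal]
  simp; positivity

lemma indep_lin {m : ℕ} {u r : Fin m → ℝ} (h : ∑ j, u j * r j = 0) :
    IndepFun (linF u) (linF r) (gaussianVec m) := by
  refine HasGaussianLaw.indepFun_of_covariance_eq_zero ?_ ?_
  · exact (IsGaussian.hasGaussianLaw_id (μ := gaussianVec m)).map_fun ((linF u).prod (linF r))
  · have h1 := variance_add (μ := gaussianVec m) (X := linF u) (Y := linF r)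
      (IsGaussian.memLp_dual _ _ 2 (by simp)) (IsGaussian.memLp_dual _ _ 2 (by simp))
    have e : (⇑(linF u) + ⇑(linF r)) = ⇑(linF (u + r)) := by
      funext w; simp [linF_apply, mul_add, Finset.sum_add_distrib]
    rw [e, var_linF, var_linF, var_linF] at h1
    have : ∑ j, (u + r) j ^ 2 = ∑ j, u j ^ 2 + 2 * ∑ j, u j * r j + ∑ j, r j ^ 2 := by
      rw [Finset.mul_sum, ← Finset.sum_add_distrib, ← Finset.sum_add_distrib]
      exact Finset.sum_congr rfl fun j _ => by simp; ring
    rw [this, h] at h1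
    linarith

lemma indep_int {m : ℕ} {u r : Fin m → ℝ} (h : ∑ j, u j * r j = 0) {f g : ℝ → ℝ} (hf : Continuous f)
    (hg : Continuous g) : ∫ w, f (linF u w) * g (linF r w) ∂(gaussianVec m) =
      (∫ x, f (√(∑ j, u j ^ 2) * x) ∂(gaussianReal 0 1)) * ∫ x, g (√(∑ j, r j ^ 2) * x) ∂(gaussianReal 0 1) := by
  have h1 := (indep_lin h).comp hf.measurable hg.measurable
  have h2 := h1.integral_fun_mul_eq_mul_integral (hf.comp (linF u).continuous).aestronglyMeasurable
    (hg.comp (linF r).continuous).aestronglyMeasurable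
  simp only [Function.comp_apply] at h2
  rw [h2, ← lin_int u hf, ← lin_int r hg]
  simp only [linF_apply]

section means
variable {σ σ' σ'' : ℝ → ℝ} {l : ℝ}

lemma sigma_bd (h : ∀ x, HasDerivAt σ (σ' x) x) (hb : ∀ x, |σ' x| ≤ l) {K a : ℝ}
    (haK : a ≤ K) (x : ℝ) : |σ (√a * x)| ≤ |σ 0| + l * √K * |x| := by
  have hl : 0 ≤ l := (abs_nonneg _).trans (hb 0)
  have h1 := sigma_lip h hb 0 (√a * x)
  have h2 : |σ (√a * x)| ≤ |σ 0| + |σ (√a * x) - σ 0| := by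
    have := abs_add_le (σ 0) (σ (√a * x) - σ 0); simpa using this
  rw [sub_zero, abs_mul, abs_of_nonneg (Real.sqrt_nonneg a)] at h1
  have h3 : l * (√a * |x|) ≤ l * √K * |x| := by
    rw [mul_assoc]
    exact mul_le_mul_of_nonneg_left (mul_le_mul_of_nonneg_right (Real.sqrt_le_sqrt haK) (abs_nonneg x)) hl
  linarith

lemma mom_bd (h : ∀ x, HasDerivAt σ (σ' x) x) (hb : ∀ x, |σ' x| ≤ l) (K : ℝ) (p : ℕ) :
    ∃ C : ℝ, 0 ≤ C ∧ ∀ a ≤ K, ∫ x, σ (√a * x) ^ (2 * p) ∂(gaussianReal 0 1) ≤ C := by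
  have hl : 0 ≤ l := (abs_nonneg _).trans (hb 0)
  have hPG : PG (fun x : ℝ => (|σ 0| + l * √K * |x|) ^ (2 * p)) :=
    ((PG.const _).add ((PG.const _).mul (PG_abs PG_id))).pow _
  refine ⟨_, integral_nonneg fun x => ?_, fun a haK => integral_mono
    (((PG_scale (sigma_PG h hb PG_id) _).pow _).integrable _) (hPG.integrable _) fun x => ?_⟩
  · positivity
  · simp only []
    rw [← (even_two_mul p).pow_abs (σ (√a * x))]
    exact pow_le_pow_left₀ (abs_nonneg _) (sigma_bd h hb haK x) _

lemma sq_mean (h : ∀ x, HasDerivAt σ (σ' x) x) (hb : ∀ x, |σ' x| ≤ l)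
    (hvar : ∫ x, σ x ^ 2 ∂(gaussianReal 0 1) = 1) (K : ℝ) : ∃ C : ℝ, 0 ≤ C ∧ ∀ a, 0 ≤ a → a ≤ K →
    |∫ x, σ (√a * x) ^ 2 ∂(gaussianReal 0 1) - 1| ≤ C * |a - 1| := by
  have hl : 0 ≤ l := (abs_nonneg _).trans (hb 0)
  have hPG : PG σ := sigma_PG h hb PG_id
  have hPG2 : PG (fun x : ℝ => l * |x| * (|σ 0| + l * √K * |x| + (|σ 0| + l * √1 * |x|))) :=
    ((PG.const _).mul (PG_abs PG_id)).mul (((PG.const _).add ((PG.const _).mul (PG_abs PG_id))).add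
      ((PG.const _).add ((PG.const _).mul (PG_abs PG_id))))
  refine ⟨∫ x, l * |x| * (|σ 0| + l * √K * |x| + (|σ 0| + l * √1 * |x|)) ∂(gaussianReal 0 1),
    integral_nonneg fun x => by positivity, fun a ha haK => ?_⟩
  · have e0 : ∫ x, σ (√a * x) ^ 2 ∂(gaussianReal 0 1) - 1 =
        ∫ x, (σ (√a * x) ^ 2 - σ x ^ 2) ∂(gaussianReal 0 1) := by
      rw [integral_sub (((PG_scale hPG _).pow 2).integrable _) ((hPG.pow 2).integrable _), hvar]
    rw [e0]
    refine (abs_integral_le_integral_abs).trans ?_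
    rw [← integral_mul_const]
    refine integral_mono ((PG_abs (((PG_scale hPG _).pow 2).sub (hPG.pow 2))).integrable _)
      ((hPG2.mul (PG.const _)).integrable _) fun x => ?_
    simp only []
    have h1 : |σ (√a * x) - σ x| ≤ l * |a - 1| * |x| := by
      refine (sigma_lip h hb x (√a * x)).trans ?_
      rw [show √a * x - x = (√a - 1) * x by ring, abs_mul, mul_assoc]
      exact mul_le_mul_of_nonneg_left (mul_le_mul_of_nonneg_right (sqrt_sub_one_le ha) (abs_nonneg x)) hl
    have h2 := sigma_bd h hb haK x
    have h3 := sigma_bd h hb (le_refl (1:ℝ)) x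
    rw [Real.sqrt_one, one_mul] at h3
    have h4 := abs_add_le (σ (√a * x)) (σ x)
    rw [show σ (√a * x) ^ 2 - σ x ^ 2 = (σ (√a * x) - σ x) * (σ (√a * x) + σ x) by ring, abs_mul]
    have := mul_le_mul h1 (h4.trans (add_le_add h2 h3)) (abs_nonneg _) (by positivity)
    rw [Real.sqrt_one]
    refine this.trans (le_of_eq (by ring))

/-- covariance of activations -/
noncomputable def phi (σ : ℝ → ℝ) {m : ℕ} (u v : Fin m → ℝ) : ℝ :=
  ∫ w, σ (∑ j, w j * u j) * σ (∑ j, w j * v j) ∂(gaussianVec m)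

lemma phi_comm {m : ℕ} (u v : Fin m → ℝ) : phi σ u v = phi σ v u := by
  simp only [phi, mul_comm]

lemma phi_self (h : ∀ x, HasDerivAt σ (σ' x) x) {m : ℕ} (u : Fin m → ℝ) :
    phi σ u u = ∫ x, σ (√(∑ j, u j ^ 2) * x) ^ 2 ∂(gaussianReal 0 1) := by
  have hc : Continuous σ := continuous_iff_continuousAt.2 fun x => (h x).continuousAt
  rw [← lin_int u (h := fun x => σ x ^ 2) (by fun_prop)]
  simp only [phi, sq]

lemma phi_main (h : ∀ x, HasDerivAt σ (σ' x) x) (h2 : ∀ x, HasDerivAt σ' (σ'' x) x)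
    (hb : ∀ x, |σ' x| ≤ l) (hb2 : ∀ x, |σ'' x| ≤ l) (K : ℝ) :
    ∃ T : ℝ, 0 ≤ T ∧ ∀ (m : ℕ) (u v : Fin m → ℝ), 1/2 ≤ ∑ j, u j ^ 2 → ∑ j, u j ^ 2 ≤ K →
      ∃ w, 0 ≤ w ∧ |w - 1| ≤ |∑ j, v j ^ 2 - 1| + 2 * (∑ j, u j * v j) ^ 2 ∧
      |phi σ u v - ((∫ x, σ (√(∑ j, u j ^ 2) * x) ∂(gaussianReal 0 1)) * (∫ x, σ (√w * x) ∂(gaussianReal 0 1)) +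
        (∑ j, u j * v j) * (∫ x, σ' (√(∑ j, u j ^ 2) * x) ∂(gaussianReal 0 1)) *
          (∫ x, σ' (√w * x) ∂(gaussianReal 0 1)))| ≤ T * (∑ j, u j * v j) ^ 2 := by
  have hl : 0 ≤ l := (abs_nonneg _).trans (hb 0)
  have hPG : PG σ := sigma_PG h hb PG_id
  have hc' : Continuous σ' := continuous_iff_continuousAt.2 fun x => (h2 x).continuousAt
  have hPG' : PG σ' := PG.of_le hc' (PG.const l) hb
  have hTPG : PG (fun x : ℝ => (|σ 0| + l * √K * |x|) * (K * x ^ 2)) :=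
    ((PG.const _).add ((PG.const _).mul (PG_abs PG_id))).mul ((PG.const _).mul (PG_id.pow 2))
  refine ⟨4 * l * |∫ x, (|σ 0| + l * √K * |x|) * (K * x ^ 2) ∂(gaussianReal 0 1)|, by positivity, ?_⟩
  intro m u v ha haK
  set a := ∑ j, u j ^ 2
  set c := ∑ j, u j * v j
  have ha0 : 0 < a := by linarith
  let t := c / a
  let r : Fin m → ℝ := fun j => v j - t * u j
  have hta : t * a = c := div_mul_cancel₀ c ha0.ne'
  have hur : ∑ j, u j * r j = 0 := by
    have : ∑ j, u j * r j = c - t * a := by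
      simp only [r, c, a, Finset.mul_sum, ← Finset.sum_sub_distrib]
      exact Finset.sum_congr rfl fun j _ => by ring
    rw [this, hta, sub_self]
  have hw : ∑ j, r j ^ 2 = ∑ j, v j ^ 2 - t * c := by
    have : ∑ j, r j ^ 2 = ∑ j, v j ^ 2 - 2 * t * c + t * (t * a) := by
      simp only [r, c, a, Finset.mul_sum, ← Finset.sum_sub_distrib, ← Finset.sum_add_distrib]
      exact Finset.sum_congr rfl fun j _ => by ring
    rw [this, hta]; ring
  have htc : 0 ≤ t * c ∧ t * c ≤ 2 * c ^ 2 := by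
    have e : t * c = c ^ 2 / a := by simp only [t]; ring
    rw [e]; constructor
    · positivity
    · rw [div_le_iff₀ ha0]; nlinarith [sq_nonneg c]
  refine ⟨∑ j, r j ^ 2, by positivity, ?_, ?_⟩
  · rw [hw]
    have := abs_sub (∑ j, v j ^ 2 - 1) (t * c)
    rw [abs_of_nonneg htc.1] at this
    rw [show ∑ j, v j ^ 2 - t * c - 1 = ∑ j, v j ^ 2 - 1 - t * c by ring]
    linarith [htc.2]
  have hV : ∀ w, ∑ j, w j * v j = linF r w + t * linF u w := by
    intro w
    simp only [linF_apply, r, Finset.mul_sum, ← Finset.sum_add_distrib]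
    exact Finset.sum_congr rfl fun j _ => by ring
  have e1 := indep_int hur hPG.1 hPG.1
  have e2 := indep_int hur (f := fun x => x * σ x) (continuous_id.mul hPG.1) hc'
  have hst : ∫ x, (√a * x) * σ (√a * x) ∂(gaussianReal 0 1) = a * ∫ x, σ' (√a * x) ∂(gaussianReal 0 1) := by
    have := stein (σ := fun x => σ (√a * x)) (σ' := fun x => √a * σ' (√a * x)) (l := √a * l)
      (fun x => by
        have := (h (√a * x)).comp x ((hasDerivAt_id x).const_mul (√a))
        rw [mul_one, mul_comm] at this
        exact this) (by fun_prop) (fun x => by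
          rw [abs_mul, abs_of_nonneg (Real.sqrt_nonneg a)]
          exact mul_le_mul_of_nonneg_left (hb _) (Real.sqrt_nonneg a))
    simp only [mul_assoc, integral_const_mul] at this ⊢
    rw [this, ← mul_assoc, Real.mul_self_sqrt ha0.le]
  have hPu : PG (fun w : Fin m → ℝ => linF u w) := PG.lin _
  have hPr : PG (fun w : Fin m → ℝ => linF r w) := PG.lin _
  have s1 : PG (fun w : Fin m → ℝ => σ (linF u w)) := sigma_PG h hb hPu
  have s2 : PG (fun w : Fin m → ℝ => σ (linF r w)) := sigma_PG h hb hPr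
  have s3 : PG (fun w : Fin m → ℝ => σ' (linF r w)) := PG.of_le (hc'.comp hPr.1) (PG.const l) fun w => hb _
  have s4 : PG (fun w : Fin m → ℝ => σ (linF r w + t * linF u w)) :=
    sigma_PG h hb (hPr.add ((PG.const _).mul hPu))
  have e3 : phi σ u v = ∫ w, σ (linF u w) * σ (linF r w + t * linF u w) ∂(gaussianVec m) := by
    simp only [phi, hV, linF_apply]
  have e4 : (∫ x, σ (√a * x) ∂(gaussianReal 0 1)) * (∫ x, σ (√(∑ j, r j ^ 2) * x) ∂(gaussianReal 0 1)) +
        c * (∫ x, σ' (√a * x) ∂(gaussianReal 0 1)) * (∫ x, σ' (√(∑ j, r j ^ 2) * x) ∂(gaussianReal 0 1)) =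
      ∫ w, (σ (linF u w) * σ (linF r w) + t * (linF u w * σ (linF u w) * σ' (linF r w))) ∂(gaussianVec m) := by
    rw [integral_add ((s1.mul s2).integrable _) (((PG.const t).mul ((hPu.mul s1).mul s3)).integrable _),
      integral_const_mul, e1, e2, hst, ← hta]
    ring
  rw [e3, e4, ← integral_sub ((s1.mul s4).integrable _)
    (((s1.mul s2).add ((PG.const t).mul ((hPu.mul s1).mul s3))).integrable _)]
  refine (abs_integral_le_integral_abs).trans ?_
  have hb3 : ∫ w, |σ (linF u w) * σ (linF r w + t * linF u w) -
      (σ (linF u w) * σ (linF r w) + t * (linF u w * σ (linF u w) * σ' (linF r w)))| ∂(gaussianVec m) ≤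
      ∫ w, l * t ^ 2 * (|σ (linF u w)| * linF u w ^ 2) ∂(gaussianVec m) := by
    refine integral_mono ((PG_abs ((s1.mul s4).sub ((s1.mul s2).add ((PG.const t).mul ((hPu.mul s1).mul s3))))).integrable _)
      (((PG.const _).mul ((PG_abs s1).mul (hPu.pow 2))).integrable _) fun w => ?_
    simp only []
    rw [show σ (linF u w) * σ (linF r w + t * linF u w) -
      (σ (linF u w) * σ (linF r w) + t * (linF u w * σ (linF u w) * σ' (linF r w))) =
      σ (linF u w) * (σ (linF r w + t * linF u w) - σ (linF r w) - (t * linF u w) * σ' (linF r w)) by ring, abs_mul]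
    have := mul_le_mul_of_nonneg_left (taylor2 h h2 hb2 (linF r w) (t * linF u w)) (abs_nonneg (σ (linF u w)))
    refine this.trans (le_of_eq (by ring))
  refine hb3.trans ?_
  rw [integral_const_mul]
  have e5 := lin_int u (h := fun x => |σ x| * x ^ 2) (by have := hPG.1; fun_prop)
  simp only [linF_apply]
  rw [e5]
  have hb4 : ∫ x, |σ (√a * x)| * (√a * x) ^ 2 ∂(gaussianReal 0 1) ≤
      |∫ x, (|σ 0| + l * √K * |x|) * (K * x ^ 2) ∂(gaussianReal 0 1)| := by
    refine le_trans ?_ (le_abs_self _)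
    refine integral_mono (((PG_abs (PG_scale hPG _)).mul (((PG.const _).mul PG_id).pow 2)).integrable _)
      (hTPG.integrable _) fun x => ?_
    simp only []
    rw [mul_pow, Real.sq_sqrt ha0.le]
    have hK : 0 ≤ K := ha0.le.trans haK
    exact mul_le_mul (sigma_bd h hb haK x) (mul_le_mul_of_nonneg_right haK (sq_nonneg x)) (by positivity) (by positivity)
  have ht2 : t ^ 2 ≤ 4 * c ^ 2 := by
    rw [← hta]
    have : 1/4 ≤ a ^ 2 := by nlinarith
    nlinarith [sq_nonneg t]
  calc l * t ^ 2 * ∫ x, |σ (√a * x)| * (√a * x) ^ 2 ∂(gaussianReal 0 1)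
      ≤ l * t ^ 2 * |∫ x, (|σ 0| + l * √K * |x|) * (K * x ^ 2) ∂(gaussianReal 0 1)| := by gcongr
    _ ≤ l * (4 * c ^ 2) * |∫ x, (|σ 0| + l * √K * |x|) * (K * x ^ 2) ∂(gaussianReal 0 1)| := by gcongr
    _ = _ := by ring
end means
end

section
open scoped ENNReal NNReal
section cov
variable {σ σ' σ'' : ℝ → ℝ} {l : ℝ}

lemma b_sq_le (h : ∀ x, HasDerivAt σ (σ' x) x) (hc' : Continuous σ') (hb : ∀ x, |σ' x| ≤ l)
    (hvar : ∫ x, σ x ^ 2 ∂(gaussianReal 0 1) = 1) : (∫ x, σ' x ∂(gaussianReal 0 1)) ^ 2 ≤ 1 := by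
  have hPG : PG σ := sigma_PG h hb PG_id
  have hst := stein h hc' hb
  set b := ∫ x, σ' x ∂(gaussianReal 0 1)
  have h2 : ∫ x : ℝ, x ^ 2 ∂(gaussianReal 0 1) = 1 := by
    have := variance_id_gaussianReal (μ := 0) (v := 1)
    rw [variance_eq_integral measurable_id.aemeasurable] at this
    simpa using this
  have h3 : 0 ≤ ∫ x, (σ x - b * x) ^ 2 ∂(gaussianReal 0 1) := integral_nonneg fun x => sq_nonneg _
  have h4 : ∫ x, (σ x - b * x) ^ 2 ∂(gaussianReal 0 1) =
      ∫ x, (σ x ^ 2 - (2 * b) * (x * σ x) + b ^ 2 * x ^ 2) ∂(gaussianReal 0 1) := by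
    congr 1; ext x; ring
  rw [h4, integral_add (((hPG.pow 2).sub ((PG.const _).mul (PG_id.mul hPG))).integrable _)
    (((PG.const _).mul (PG_id.pow 2)).integrable _), integral_sub ((hPG.pow 2).integrable _)
    (((PG.const _).mul (PG_id.mul hPG)).integrable _), integral_const_mul, integral_const_mul, hvar, h2, hst] at h3
  nlinarith

lemma phi_abs_le (h : ∀ x, HasDerivAt σ (σ' x) x) (hb : ∀ x, |σ' x| ≤ l) {m : ℕ} (u v : Fin m → ℝ) :
    |phi σ u v| ≤ phi σ u u + phi σ v v := by
  have hP : ∀ u : Fin m → ℝ, PG (fun w : Fin m → ℝ => σ (∑ j, w j * u j)) := fun u => by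
    have := sigma_PG h hb (PG.lin (linF u)); simpa only [linF_apply] using this
  unfold phi
  rw [← integral_add (((hP u).mul (hP u)).integrable _) (((hP v).mul (hP v)).integrable _)]
  refine (abs_integral_le_integral_abs).trans (integral_mono ((PG_abs ((hP u).mul (hP v))).integrable _)
    ((((hP u).mul (hP u)).add ((hP v).mul (hP v))).integrable _) fun w => ?_)
  simp only []
  rw [abs_le]
  constructor <;> nlinarith [sq_nonneg (σ (∑ j, w j * u j) - σ (∑ j, w j * v j)),
    sq_nonneg (σ (∑ j, w j * u j) + σ (∑ j, w j * v j))]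

lemma phi_half (h : ∀ x, HasDerivAt σ (σ' x) x) (h2 : ∀ x, HasDerivAt σ' (σ'' x) x)
    (hb : ∀ x, |σ' x| ≤ l) (hb2 : ∀ x, |σ'' x| ≤ l) (hmean : ∫ x, σ x ∂(gaussianReal 0 1) = 0) (K : ℝ) :
    ∃ C : ℝ, 0 ≤ C ∧ ∀ (m : ℕ) (u v : Fin m → ℝ), 1/2 ≤ ∑ j, u j ^ 2 → ∑ j, u j ^ 2 ≤ K → ∑ j, v j ^ 2 ≤ K →
      |phi σ u v - (∫ x, σ' x ∂(gaussianReal 0 1)) ^ 2 * ∑ j, u j * v j| ≤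
      C * (|∑ j, u j ^ 2 - 1| * |∑ j, v j ^ 2 - 1| + |∑ j, u j * v j| * (|∑ j, u j ^ 2 - 1| + |∑ j, v j ^ 2 - 1|)
        + (∑ j, u j * v j) ^ 2) := by
  obtain ⟨T, hT, H⟩ := phi_main h h2 hb hb2 K
  have hl : 0 ≤ l := (abs_nonneg _).trans (hb 0)
  have hg := gA_nonneg
  set b := ∫ x, σ' x ∂(gaussianReal 0 1)
  refine ⟨(l * gA) ^ 2 * (1 + 2 * (|K| + 1)) + l * (l * gA) * (1 + 2 * |K|) + T, by positivity, ?_⟩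
  intro m u v ha haK hvK
  obtain ⟨w, hw, hw1, hp⟩ := H m u v ha haK
  have hcK : |∑ j, u j * v j| ≤ |K| := by
    have h1 : |∑ j, u j * v j| ≤ ∑ j, (u j ^ 2 + v j ^ 2) / 2 := by
      refine (Finset.abs_sum_le_sum_abs _ _).trans (Finset.sum_le_sum fun j _ => ?_)
      rw [abs_le]; constructor <;> nlinarith [sq_nonneg (u j - v j), sq_nonneg (u j + v j)]
    rw [← Finset.sum_div, Finset.sum_add_distrib] at h1
    have := le_abs_self K
    linarith
  set a := ∑ j, u j ^ 2
  set a' := ∑ j, v j ^ 2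
  set c := ∑ j, u j * v j
  have ea := lip_mean h hb (a := a) (by linarith)
  have ew := lip_mean h hb hw
  have sa := lip_mean h2 hb2 (a := a) (by linarith)
  have sw := lip_mean h2 hb2 hw
  rw [hmean, sub_zero] at ea ew
  have sal : |∫ x, σ' (√w * x) ∂(gaussianReal 0 1)| ≤ l := by
    refine (abs_integral_le_integral_abs).trans ?_
    have hPG' : PG (fun x => σ' (√w * x)) := PG.of_le (by
      have : Continuous σ' := continuous_iff_continuousAt.2 fun x => (h2 x).continuousAt
      fun_prop) (PG.const l) fun x => hb _
    refine (integral_mono ((PG_abs hPG').integrable _) ((PG.const l).integrable _) fun x => hb _).trans ?_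
    simp
  have bl : |b| ≤ l := by
    refine (abs_integral_le_integral_abs).trans ?_
    have hPG' : PG (fun x => σ' x) := PG.of_le (
      continuous_iff_continuousAt.2 fun x => (h2 x).continuousAt) (PG.const l) fun x => hb _
    refine (integral_mono ((PG_abs hPG').integrable _) ((PG.const l).integrable _) fun x => hb _).trans ?_
    simp
  set Ea := ∫ x, σ (√a * x) ∂(gaussianReal 0 1)
  set Ew := ∫ x, σ (√w * x) ∂(gaussianReal 0 1)
  set Sa := ∫ x, σ' (√a * x) ∂(gaussianReal 0 1)
  set Sw := ∫ x, σ' (√w * x) ∂(gaussianReal 0 1)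
  have hlg : 0 ≤ l * gA := by positivity
  have haK1 : |a - 1| ≤ |K| + 1 := by
    rw [abs_le]; constructor <;> linarith [le_abs_self K, abs_nonneg K]
  have k1 : |Ea * Ew| ≤ (l * gA) ^ 2 * (|a - 1| * |a' - 1| + 2 * (|K| + 1) * c ^ 2) := by
    rw [abs_mul]
    calc |Ea| * |Ew| ≤ (l * gA * |a - 1|) * (l * gA * (|a' - 1| + 2 * c ^ 2)) := by
          refine mul_le_mul ea (ew.trans (mul_le_mul_of_nonneg_left hw1 hlg)) (abs_nonneg _) (by positivity)
      _ = (l * gA) ^ 2 * (|a - 1| * |a' - 1| + 2 * |a - 1| * c ^ 2) := by ring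
      _ ≤ _ := by gcongr
  have k2 : |Sa * Sw - b ^ 2| ≤ l * (l * gA) * (|a - 1| + |a' - 1| + 2 * c ^ 2) := by
    rw [show Sa * Sw - b ^ 2 = (Sa - b) * Sw + b * (Sw - b) by ring]
    refine (abs_add_le _ _).trans ?_
    rw [abs_mul, abs_mul]
    have i1 : |Sa - b| * |Sw| ≤ (l * gA * |a - 1|) * l := mul_le_mul sa sal (abs_nonneg _) (by positivity)
    have i2 : |b| * |Sw - b| ≤ l * (l * gA * (|a' - 1| + 2 * c ^ 2)) :=
      mul_le_mul bl (sw.trans (mul_le_mul_of_nonneg_left hw1 hlg)) (abs_nonneg _) hl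
    refine (add_le_add i1 i2).trans (le_of_eq (by ring))
  have k3 : |c * (Sa * Sw - b ^ 2)| ≤ l * (l * gA) * (|c| * (|a - 1| + |a' - 1|) + 2 * |K| * c ^ 2) := by
    rw [abs_mul]
    calc |c| * |Sa * Sw - b ^ 2| ≤ |c| * (l * (l * gA) * (|a - 1| + |a' - 1| + 2 * c ^ 2)) := by gcongr
      _ = l * (l * gA) * (|c| * (|a - 1| + |a' - 1|) + 2 * |c| * c ^ 2) := by ring
      _ ≤ _ := by gcongr
  have e : phi σ u v - b ^ 2 * c = (phi σ u v - (Ea * Ew + c * Sa * Sw)) + (Ea * Ew + c * (Sa * Sw - b ^ 2)) := by ring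
  rw [e]
  refine (abs_add_le _ _).trans ?_
  have k4 := abs_add_le (Ea * Ew) (c * (Sa * Sw - b ^ 2))
  have P1 : 0 ≤ |a - 1| * |a' - 1| := by positivity
  have P2 : 0 ≤ |c| * (|a - 1| + |a' - 1|) := by positivity
  have P3 : 0 ≤ c ^ 2 := sq_nonneg c
  set A1 := |a - 1| * |a' - 1|
  set A2 := |c| * (|a - 1| + |a' - 1|)
  set A3 := c ^ 2
  set k := |K|
  have hk : 0 ≤ k := abs_nonneg K
  have Q1 : 0 ≤ (l * gA) ^ 2 := by positivity
  have Q2 : 0 ≤ l * (l * gA) := by positivity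
  set q1 := (l * gA) ^ 2
  set q2 := l * (l * gA)
  have : (q1 * (1 + 2 * (k + 1)) + q2 * (1 + 2 * k) + T) * (A1 + A2 + A3) -
    (T * A3 + (q1 * (A1 + 2 * (k + 1) * A3) + q2 * (A2 + 2 * k * A3))) =
    q1 * (2 * (k + 1) * (A1 + A2)) + q1 * (A2 + A3) + q2 * (A1 + A3) + q2 * (2 * k * (A1 + A2)) + T * (A1 + A2) := by ring
  have : 0 ≤ q1 * (2 * (k + 1) * (A1 + A2)) + q1 * (A2 + A3) + q2 * (A1 + A3) + q2 * (2 * k * (A1 + A2)) + T * (A1 + A2) := by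
    positivity
  linarith

lemma phi_off (h : ∀ x, HasDerivAt σ (σ' x) x) (h2 : ∀ x, HasDerivAt σ' (σ'' x) x)
    (hb : ∀ x, |σ' x| ≤ l) (hb2 : ∀ x, |σ'' x| ≤ l) (hmean : ∫ x, σ x ∂(gaussianReal 0 1) = 0) (K : ℝ) :
    ∃ C : ℝ, 0 ≤ C ∧ ∀ (m : ℕ) (u v : Fin m → ℝ), ∑ j, u j ^ 2 ≤ K → ∑ j, v j ^ 2 ≤ K →
      |phi σ u v - (∫ x, σ' x ∂(gaussianReal 0 1)) ^ 2 * ∑ j, u j * v j| ≤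
      C * (|∑ j, u j ^ 2 - 1| * |∑ j, v j ^ 2 - 1| + |∑ j, u j * v j| * (|∑ j, u j ^ 2 - 1| + |∑ j, v j ^ 2 - 1|)
        + (∑ j, u j * v j) ^ 2) := by
  obtain ⟨C, hC, H⟩ := phi_half h h2 hb hb2 hmean K
  obtain ⟨M, hM, HM⟩ := mom_bd h hb K 1
  set b := ∫ x, σ' x ∂(gaussianReal 0 1)
  refine ⟨C + 4 * (2 * M + b ^ 2 * |K|), by positivity, fun m u v huK hvK => ?_⟩
  have P : 0 ≤ |∑ j, u j ^ 2 - 1| * |∑ j, v j ^ 2 - 1| + |∑ j, u j * v j| * (|∑ j, u j ^ 2 - 1| + |∑ j, v j ^ 2 - 1|)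
        + (∑ j, u j * v j) ^ 2 := by positivity
  have P2 : 0 ≤ 4 * (2 * M + b ^ 2 * |K|) := by positivity
  rw [add_mul]
  have huv : ∑ j, v j * u j = ∑ j, u j * v j := Finset.sum_congr rfl fun j _ => mul_comm _ _
  by_cases c1 : 1/2 ≤ ∑ j, u j ^ 2
  · linarith [H m u v c1 huK hvK, mul_nonneg P2 P]
  by_cases c2 : 1/2 ≤ ∑ j, v j ^ 2
  · have := H m v u c2 hvK huK
    rw [phi_comm, huv, mul_comm |∑ j, v j ^ 2 - 1|, add_comm |∑ j, v j ^ 2 - 1|] at this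
    linarith [mul_nonneg P2 P]
  have hcK : |∑ j, u j * v j| ≤ |K| := by
    have h1 : |∑ j, u j * v j| ≤ ∑ j, (u j ^ 2 + v j ^ 2) / 2 := by
      refine (Finset.abs_sum_le_sum_abs _ _).trans (Finset.sum_le_sum fun j _ => ?_)
      rw [abs_le]; constructor <;> nlinarith [sq_nonneg (u j - v j), sq_nonneg (u j + v j)]
    rw [← Finset.sum_div, Finset.sum_add_distrib] at h1
    have := le_abs_self K
    linarith
  have k1 := phi_abs_le h hb u v
  rw [phi_self h u, phi_self h v] at k1
  have k2 := HM _ huK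
  have k3 := HM _ hvK
  rw [mul_one] at k2 k3
  have k4 : |b ^ 2 * ∑ j, u j * v j| ≤ b ^ 2 * |K| := by
    rw [abs_mul, abs_of_nonneg (sq_nonneg b)]; gcongr
  have k5 := abs_sub (phi σ u v) (b ^ 2 * ∑ j, u j * v j)
  have k6 : 1/4 ≤ |∑ j, u j ^ 2 - 1| * |∑ j, v j ^ 2 - 1| := by
    push Not at c1 c2
    rw [abs_of_neg (by linarith), abs_of_neg (by linarith)]
    nlinarith
  have k7 : 1/4 ≤ |∑ j, u j ^ 2 - 1| * |∑ j, v j ^ 2 - 1| + |∑ j, u j * v j| * (|∑ j, u j ^ 2 - 1| + |∑ j, v j ^ 2 - 1|)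
        + (∑ j, u j * v j) ^ 2 := by
    have : 0 ≤ |∑ j, u j * v j| * (|∑ j, u j ^ 2 - 1| + |∑ j, v j ^ 2 - 1|) := by positivity
    have := sq_nonneg (∑ j, u j * v j)
    linarith
  have k8 := mul_le_mul_of_nonneg_left k7 P2
  linarith [mul_nonneg hC P]

/-- Good inputs -/
def Good (B : ℝ) {m n : ℕ} (X : Matrix (Fin m) (Fin n) ℝ) : Prop :=
  opNorm X ≤ B ∧ ∑ α : Fin n, ((∑ i, X i α ^ 2) - 1) ^ 2 ≤ B ^ 2

noncomputable def offd {m n : ℕ} (X : Matrix (Fin m) (Fin n) ℝ) : ℝ :=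
  ∑ α, ∑ β, if α = β then 0 else (∑ j, X j α * X j β) ^ 4

lemma Good.col {B : ℝ} {m n : ℕ} {X : Matrix (Fin m) (Fin n) ℝ} (h : Good B X) (α : Fin n) :
    ∑ j, X j α ^ 2 ≤ B ^ 2 := by
  have h1 := opNorm_mulVec_sq X (Pi.single α 1)
  have h2 : opNorm X ^ 2 ≤ B ^ 2 := pow_le_pow_left₀ (opNorm_nonneg' X) h.1 2
  simp [Pi.single_apply] at h1
  linarith

lemma opNorm_T_sq {m n : ℕ} (X : Matrix (Fin m) (Fin n) ℝ) (v : Fin m → ℝ) :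
    ∑ α, (∑ j, X j α * v j) ^ 2 ≤ opNorm X ^ 2 * ∑ j, v j ^ 2 := by
  set w : Fin n → ℝ := fun α => ∑ j, X j α * v j
  have h1 : ∑ α, w α ^ 2 = ∑ j, (∑ α, X j α * w α) * v j := by
    simp only [Finset.sum_mul]
    rw [Finset.sum_comm]
    refine Finset.sum_congr rfl fun α _ => ?_
    rw [sq]; nth_rewrite 1 [show w α = ∑ j, X j α * v j from rfl]
    rw [Finset.sum_mul]; exact Finset.sum_congr rfl fun j _ => by ring
  have h2 := Finset.sum_mul_sq_le_sq_mul_sq Finset.univ (fun j => ∑ α, X j α * w α) v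
  rw [← h1] at h2
  have h3 := opNorm_mulVec_sq X w
  have hs : 0 ≤ ∑ α, w α ^ 2 := by positivity
  have hv : 0 ≤ ∑ j, v j ^ 2 := by positivity
  change ∑ α, w α ^ 2 ≤ _
  rcases hs.eq_or_lt with h0 | h0
  · rw [← h0]; positivity
  · have h4 : (∑ α, w α ^ 2) * (∑ α, w α ^ 2) ≤ (∑ α, w α ^ 2) * (opNorm X ^ 2 * ∑ j, v j ^ 2) := by
      nlinarith [mul_le_mul_of_nonneg_right h3 hv]
    exact le_of_mul_le_mul_left h4 h0

lemma frob_bound (h : ∀ x, HasDerivAt σ (σ' x) x) (h2 : ∀ x, HasDerivAt σ' (σ'' x) x)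
    (hb : ∀ x, |σ' x| ≤ l) (hb2 : ∀ x, |σ'' x| ≤ l) (hmean : ∫ x, σ x ∂(gaussianReal 0 1) = 0)
    (hvar : ∫ x, σ x ^ 2 ∂(gaussianReal 0 1) = 1) (B : ℝ) :
    ∃ C : ℝ, 0 ≤ C ∧ ∀ (m n : ℕ) (X : Matrix (Fin m) (Fin n) ℝ), Good B X →
      ∑ α, ∑ β, (phi σ (fun j => X j α) (fun j => X j β) -
        ((if α = β then 1 - (∫ x, σ' x ∂(gaussianReal 0 1)) ^ 2 else 0) +
          (∫ x, σ' x ∂(gaussianReal 0 1)) ^ 2 * ∑ j, X j α * X j β)) ^ 2 ≤ C * (1 + offd X) := by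
  obtain ⟨C1, hC1, H1⟩ := phi_off h h2 hb hb2 hmean (B ^ 2)
  obtain ⟨C2, hC2, H2⟩ := sq_mean h hb hvar (B ^ 2)
  have hb1 := b_sq_le h (continuous_iff_continuousAt.2 fun x => (h2 x).continuousAt) hb hvar
  set b := ∫ x, σ' x ∂(gaussianReal 0 1)
  refine ⟨(C2 + 1) ^ 2 * B ^ 2 + 3 * C1 ^ 2 * (B ^ 4 + 4 * B ^ 6 + 1), by positivity, fun m n X hX => ?_⟩
  have hop : opNorm X ^ 2 ≤ B ^ 2 := pow_le_pow_left₀ (opNorm_nonneg' X) hX.1 2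
  set a : Fin n → ℝ := fun α => ∑ j, X j α ^ 2
  set c : Fin n → Fin n → ℝ := fun α β => ∑ j, X j α * X j β
  have hterm : ∀ α β, (phi σ (fun j => X j α) (fun j => X j β) -
        ((if α = β then 1 - b ^ 2 else 0) + b ^ 2 * c α β)) ^ 2 ≤
      (if α = β then (C2 + 1) ^ 2 * (a α - 1) ^ 2 else 0) +
      3 * C1 ^ 2 * ((a α - 1) ^ 2 * (a β - 1) ^ 2 + 2 * (c α β ^ 2 * (a α - 1) ^ 2 + c α β ^ 2 * (a β - 1) ^ 2) +
        (if α = β then 0 else c α β ^ 4)) := by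
    intro α β
    by_cases hab : α = β
    · subst hab
      have e : c α α = a α := Finset.sum_congr rfl fun j _ => (sq _).symm
      simp only [if_true]
      have h3 := H2 (a α) (by positivity) (hX.col α)
      rw [← phi_self h] at h3
      rw [e]
      have h4 : |phi σ (fun j => X j α) (fun j => X j α) - (1 - b ^ 2 + b ^ 2 * a α)| ≤ (C2 + 1) * |a α - 1| := by
        rw [show phi σ (fun j => X j α) (fun j => X j α) - (1 - b ^ 2 + b ^ 2 * a α) =
          (phi σ (fun j => X j α) (fun j => X j α) - 1) - b ^ 2 * (a α - 1) by ring]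
        refine (abs_sub _ _).trans ?_
        rw [abs_mul, abs_of_nonneg (sq_nonneg b), add_mul]
        have := mul_le_mul_of_nonneg_right hb1 (abs_nonneg (a α - 1))
        exact add_le_add h3 this
      have h5 := pow_le_pow_left₀ (abs_nonneg _) h4 2
      rw [sq_abs, mul_pow, sq_abs] at h5
      refine h5.trans (le_add_of_nonneg_right (by positivity))
    · simp only [if_neg hab, zero_add]
      have h3 := H1 m _ _ (hX.col α) (hX.col β)
      have h5 := pow_le_pow_left₀ (abs_nonneg _) h3 2
      rw [sq_abs, mul_pow] at h5
      refine h5.trans ?_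
      rw [mul_comm 3, mul_assoc]
      refine mul_le_mul_of_nonneg_left ?_ (sq_nonneg C1)
      change (|a α - 1| * |a β - 1| + |c α β| * (|a α - 1| + |a β - 1|) + c α β ^ 2) ^ 2 ≤ _
      rw [← sq_abs (a α - 1), ← sq_abs (a β - 1), show c α β ^ 4 = (c α β ^ 2) ^ 2 by ring, ← sq_abs (c α β)]
      generalize |a α - 1| = x
      generalize |a β - 1| = y
      generalize |c α β| = z
      nlinarith [sq_nonneg (x * y - z * (x + y)), sq_nonneg (x * y - z ^ 2), sq_nonneg (z * (x + y) - z ^ 2), sq_nonneg (z * (x - y))]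
  refine (Finset.sum_le_sum fun α _ => Finset.sum_le_sum fun β _ => hterm α β).trans ?_
  have hS : ∑ α, (a α - 1) ^ 2 ≤ B ^ 2 := hX.2
  have hS0 : 0 ≤ ∑ α, (a α - 1) ^ 2 := by positivity
  have hc : ∀ α, ∑ β, c α β ^ 2 ≤ B ^ 4 := by
    intro α
    have h3 := opNorm_T_sq X (fun j => X j α)
    have h4 : ∑ β, c α β ^ 2 = ∑ β, (∑ j, X j β * X j α) ^ 2 :=
      Finset.sum_congr rfl fun β _ => by simp only [c, mul_comm]
    rw [h4]
    refine h3.trans ?_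
    rw [show B ^ 4 = B ^ 2 * B ^ 2 by ring]
    exact mul_le_mul hop (hX.col α) (by positivity) (by positivity)
  have T2 : ∑ α, ∑ β, c α β ^ 2 * (a α - 1) ^ 2 ≤ B ^ 6 := by
    calc ∑ α, ∑ β, c α β ^ 2 * (a α - 1) ^ 2 ≤ ∑ α, B ^ 4 * (a α - 1) ^ 2 := by
          refine Finset.sum_le_sum fun α _ => ?_
          rw [← Finset.sum_mul]
          exact mul_le_mul_of_nonneg_right (hc α) (sq_nonneg _)
      _ ≤ B ^ 4 * B ^ 2 := by rw [← Finset.mul_sum]; gcongr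
      _ = B ^ 6 := by ring
  have T3 : ∑ α, ∑ β, c α β ^ 2 * (a β - 1) ^ 2 = ∑ α, ∑ β, c α β ^ 2 * (a α - 1) ^ 2 := by
    rw [Finset.sum_comm]
    refine Finset.sum_congr rfl fun α _ => Finset.sum_congr rfl fun β _ => ?_
    simp only [c, mul_comm]
  have T1 : ∑ α, ∑ β, (a α - 1) ^ 2 * (a β - 1) ^ 2 ≤ B ^ 4 := by
    rw [← Finset.sum_mul_sum, show B ^ 4 = B ^ 2 * B ^ 2 by ring]
    exact mul_le_mul hS hS hS0 (by positivity)
  have hO : 0 ≤ offd X := Finset.sum_nonneg fun α _ => Finset.sum_nonneg fun β _ => by split_ifs <;> positivity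
  have e : ∑ α, ∑ β, ((if α = β then (C2 + 1) ^ 2 * (a α - 1) ^ 2 else 0) +
      3 * C1 ^ 2 * ((a α - 1) ^ 2 * (a β - 1) ^ 2 + 2 * (c α β ^ 2 * (a α - 1) ^ 2 + c α β ^ 2 * (a β - 1) ^ 2) +
        (if α = β then 0 else c α β ^ 4))) = (C2 + 1) ^ 2 * ∑ α, (a α - 1) ^ 2 + 3 * C1 ^ 2 *
      (∑ α, ∑ β, (a α - 1) ^ 2 * (a β - 1) ^ 2 + 2 * (∑ α, ∑ β, c α β ^ 2 * (a α - 1) ^ 2 +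
        ∑ α, ∑ β, c α β ^ 2 * (a β - 1) ^ 2) + offd X) := by
    simp only [Finset.sum_add_distrib, ← Finset.mul_sum, Finset.sum_ite_eq, Finset.mem_univ, if_true]
    rfl
  rw [e, T3]
  have k1 : (C2 + 1) ^ 2 * ∑ α, (a α - 1) ^ 2 ≤ (C2 + 1) ^ 2 * B ^ 2 := by gcongr
  have k2 : 3 * C1 ^ 2 * (∑ α, ∑ β, (a α - 1) ^ 2 * (a β - 1) ^ 2 + 2 * (∑ α, ∑ β, c α β ^ 2 * (a α - 1) ^ 2 +
        ∑ α, ∑ β, c α β ^ 2 * (a α - 1) ^ 2) + offd X) ≤ 3 * C1 ^ 2 * (B ^ 4 + 4 * B ^ 6 + offd X) := by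
    exact mul_le_mul_of_nonneg_left (by linarith) (by positivity)
  have k3 : 0 ≤ (C2 + 1) ^ 2 * B ^ 2 * offd X := by positivity
  have k4 : 0 ≤ 3 * C1 ^ 2 * (B ^ 4 + 4 * B ^ 6) * offd X := by positivity
  have k5 : 0 ≤ 3 * C1 ^ 2 := by positivity
  nlinarith
end cov
end

section
open scoped ENNReal NNReal
lemma row_int {d m : ℕ} (i : Fin d) {F : (Fin m → ℝ) → ℝ} (hF : Continuous F) :
    ∫ W, F (W i) ∂(gaussianMat d m) = ∫ w, F w ∂(gaussianVec m) := by
  have h1 := (measurePreserving_eval (fun _ : Fin d => gaussianVec m) i)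
  rw [← h1.map_eq, integral_map (measurable_pi_apply i).aemeasurable hF.aestronglyMeasurable]

section ent
variable {σ σ' : ℝ → ℝ} {l : ℝ}

lemma Yv_PG (h : ∀ x, HasDerivAt σ (σ' x) x) (hb : ∀ x, |σ' x| ≤ l) {d m n : ℕ} (X : Matrix (Fin m) (Fin n) ℝ)
    (i : Fin d) (α : Fin n) : PG (fun W : Fin d → Fin m → ℝ => Yv σ X W i α) :=
  sigma_PG h hb (pre_PG X i α)

lemma row_moment (h : ∀ x, HasDerivAt σ (σ' x) x) (hb : ∀ x, |σ' x| ≤ l) (B : ℝ) (p : ℕ) :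
    ∃ C : ℝ, 0 ≤ C ∧ ∀ (d m n : ℕ) (X : Matrix (Fin m) (Fin n) ℝ), Good B X → ∀ (i : Fin d) (α : Fin n),
      ∫ W, Yv σ X W i α ^ (2 * p) ∂(gaussianMat d m) ≤ C := by
  obtain ⟨C, hC, H⟩ := mom_bd h hb (B ^ 2) p
  have hc : Continuous σ := continuous_iff_continuousAt.2 fun x => (h x).continuousAt
  refine ⟨C, hC, fun d m n X hX i α => ?_⟩
  have e := row_int (d := d) i (F := fun w : Fin m → ℝ => σ (∑ j, w j * X j α) ^ (2 * p)) (by fun_prop)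
  have e2 := lin_int (fun j => X j α) (h := fun x => σ x ^ (2 * p)) (by fun_prop)
  unfold Yv pre
  rw [e, e2]
  exact H _ (hX.col α)

lemma row_cov (h : ∀ x, HasDerivAt σ (σ' x) x) {d m n : ℕ} (X : Matrix (Fin m) (Fin n) ℝ) (i : Fin d) (α β : Fin n) :
    ∫ W, Yv σ X W i α * Yv σ X W i β ∂(gaussianMat d m) = phi σ (fun j => X j α) (fun j => X j β) := by
  have hc : Continuous σ := continuous_iff_continuousAt.2 fun x => (h x).continuousAt
  exact row_int (d := d) i (F := fun w : Fin m → ℝ => σ (∑ j, w j * X j α) * σ (∑ j, w j * X j β)) (by fun_prop)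

/-- empirical covariance -/
noncomputable def cvY {d n : ℕ} (Y : Fin d → Fin n → ℝ) (α β : Fin n) : ℝ := (d : ℝ)⁻¹ * ∑ i, Y i α * Y i β

lemma cv_PG (h : ∀ x, HasDerivAt σ (σ' x) x) (hb : ∀ x, |σ' x| ≤ l) {d m n : ℕ} (X : Matrix (Fin m) (Fin n) ℝ)
    (α β : Fin n) : PG (fun W : Fin d → Fin m → ℝ => cvY (Yv σ X W) α β) :=
  (PG.const _).mul (PG.sum _ fun i => (Yv_PG h hb X i α).mul (Yv_PG h hb X i β))

lemma cv_mean (h : ∀ x, HasDerivAt σ (σ' x) x) (hb : ∀ x, |σ' x| ≤ l) {d m n : ℕ} (hd : 0 < d)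
    (X : Matrix (Fin m) (Fin n) ℝ) (α β : Fin n) :
    ∫ W, cvY (Yv σ X W) α β ∂(gaussianMat d m) = phi σ (fun j => X j α) (fun j => X j β) := by
  unfold cvY
  rw [integral_const_mul, integral_finsetSum _ fun i _ => ((Yv_PG h hb X i α).mul (Yv_PG h hb X i β)).integrable _]
  simp only [row_cov h]
  have : (d : ℝ) ≠ 0 := by positivity
  simp [this]

lemma cv_self_nonneg {d n : ℕ} (Y : Fin d → Fin n → ℝ) (α : Fin n) : 0 ≤ cvY Y α α := by
  unfold cvY
  have : 0 ≤ ∑ i, Y i α * Y i α := Finset.sum_nonneg fun i _ => mul_self_nonneg _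
  positivity

lemma cv_moment (h : ∀ x, HasDerivAt σ (σ' x) x) (hb : ∀ x, |σ' x| ≤ l) (B : ℝ) (p : ℕ) :
    ∃ C : ℝ, 0 ≤ C ∧ ∀ (d m n : ℕ) (X : Matrix (Fin m) (Fin n) ℝ), 0 < d → Good B X → ∀ (α : Fin n),
      ∫ W, cvY (Yv σ X W) α α ^ (p + 1) ∂(gaussianMat d m) ≤ C := by
  obtain ⟨C, hC, H⟩ := row_moment h hb B (p + 1)
  refine ⟨C, hC, fun d m n X hd hX α => ?_⟩
  have hd' : (0:ℝ) < d := by positivity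
  have h1 : ∀ W : Fin d → Fin m → ℝ, cvY (Yv σ X W) α α ^ (p + 1) ≤ (d : ℝ)⁻¹ * ∑ i, Yv σ X W i α ^ (2 * (p + 1)) := by
    intro W
    have h2 := pow_sum_le_card_mul_sum_pow (s := Finset.univ) (f := fun i : Fin d => Yv σ X W i α * Yv σ X W i α)
      (fun i _ => mul_self_nonneg _) p
    unfold cvY
    rw [mul_pow, pow_succ (d : ℝ)⁻¹ p, mul_comm ((d : ℝ)⁻¹ ^ p), mul_assoc]
    refine mul_le_mul_of_nonneg_left ?_ (by positivity)
    rw [inv_pow, inv_mul_le_iff₀ (by positivity)]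
    refine h2.trans (le_of_eq ?_)
    simp only [Finset.card_univ, Fintype.card_fin, pow_mul, sq]
  calc ∫ W, cvY (Yv σ X W) α α ^ (p + 1) ∂(gaussianMat d m)
      ≤ ∫ W, (d : ℝ)⁻¹ * ∑ i, Yv σ X W i α ^ (2 * (p + 1)) ∂(gaussianMat d m) :=
        integral_mono (((cv_PG h hb X α α).pow _).integrable _)
          (((PG.const _).mul (PG.sum _ fun i => (Yv_PG h hb X i α).pow _)).integrable _) h1
    _ = (d : ℝ)⁻¹ * ∑ i, ∫ W, Yv σ X W i α ^ (2 * (p + 1)) ∂(gaussianMat d m) := by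
        rw [integral_const_mul, integral_finsetSum _ fun i _ => ((Yv_PG h hb X i α).pow _).integrable _]
    _ ≤ (d : ℝ)⁻¹ * ∑ i : Fin d, C := by gcongr with i; exact H d m n X hX i α
    _ = C := by simp; field_simp

lemma grad_cv {d n : ℕ} (α β : Fin n) : HasGrad (d := d) (fun Y => cvY Y α β)
    (fun Y i κ => (d : ℝ)⁻¹ * ((if κ = α then Y i β else 0) + (if κ = β then Y i α else 0))) := by
  intro c c' t hc
  have h1 : HasDerivAt (fun s => cvY (c s) α β) ((d : ℝ)⁻¹ * ∑ i, (c' i α * c t i β + c t i α * c' i β)) t := by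
    unfold cvY
    refine HasDerivAt.const_mul _ (HasDerivAt.fun_sum fun i _ => ?_)
    exact (hc i α).mul (hc i β)
  convert h1 using 1
  rw [Finset.mul_sum]
  refine Finset.sum_congr rfl fun i _ => ?_
  simp only [mul_assoc, ← Finset.mul_sum, add_mul, Finset.sum_add_distrib, ite_mul, zero_mul, Finset.sum_ite_eq', Finset.mem_univ, if_true]
  ring

lemma entry_conc (h : ∀ x, HasDerivAt σ (σ' x) x) (hc' : Continuous σ') (hb : ∀ x, |σ' x| ≤ l) (B : ℝ) (p : ℕ) :
    ∃ C : ℝ, 0 ≤ C ∧ ∀ (d m n : ℕ) (X : Matrix (Fin m) (Fin n) ℝ), 0 < d → Good B X → ∀ (α β : Fin n),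
      ∫ W, (cvY (Yv σ X W) α β - phi σ (fun j => X j α) (fun j => X j β)) ^ (2 * (p + 1)) ∂(gaussianMat d m) ≤
        C / (d : ℝ) ^ (p + 1) := by
  obtain ⟨C, hC, H⟩ := cv_moment h hb B p
  have hl : 0 ≤ l := (abs_nonneg _).trans (hb 0)
  refine ⟨((Real.pi / 2 * |B| * l) ^ (2 * (p + 1)) * gM (p + 1)) * (2 ^ (p + 1) * (2 ^ p * (C + C))), by
    have := gM_nonneg (p + 1); positivity, fun d m n X hd hX α β => ?_⟩
  have hd' : (0:ℝ) < d := by positivity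
  have h1 := conc_moment X h hc' hb (grad_cv (d := d) α β) (cv_PG h hb X α β) (fun i κ => by
    refine (PG.const _).mul (PG.add ?_ ?_)
    · split_ifs
      · exact Yv_PG h hb X i β
      · exact PG.const 0
    · split_ifs
      · exact Yv_PG h hb X i α
      · exact PG.const 0) (p + 1)
  simp only [cv_mean h hb hd] at h1
  refine h1.trans ?_
  have hop : opNorm X ≤ |B| := hX.1.trans (le_abs_self B)
  have hPGa := cv_PG h hb (d := d) X α α
  have hPGb := cv_PG h hb (d := d) X β β
  have h2 : ∫ W, (∑ i, ∑ κ, ((d : ℝ)⁻¹ * ((if κ = α then Yv σ X W i β else 0) +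
      (if κ = β then Yv σ X W i α else 0))) ^ 2) ^ (p + 1) ∂(gaussianMat d m) ≤
      ∫ W, (2 * (d : ℝ)⁻¹) ^ (p + 1) * (2 ^ p * (cvY (Yv σ X W) α α ^ (p + 1) + cvY (Yv σ X W) β β ^ (p + 1)))
        ∂(gaussianMat d m) := by
    refine integral_mono ?_ (((PG.const _).mul ((PG.const _).mul ((hPGa.pow _).add (hPGb.pow _)))).integrable _) fun W => ?_
    · refine PG.integrable _ ((PG.sum _ fun i => PG.sum _ fun κ => PG.pow ((PG.const _).mul (PG.add ?_ ?_)) 2).pow _)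
      · split_ifs
        · exact Yv_PG h hb X i β
        · exact PG.const 0
      · split_ifs
        · exact Yv_PG h hb X i α
        · exact PG.const 0
    · simp only []
      have ha := cv_self_nonneg (Yv σ X W) α
      have hbb := cv_self_nonneg (Yv σ X W) β
      have h3 : ∑ i, ∑ κ, ((d : ℝ)⁻¹ * ((if κ = α then Yv σ X W i β else 0) +
          (if κ = β then Yv σ X W i α else 0))) ^ 2 ≤ (2 * (d : ℝ)⁻¹) * (cvY (Yv σ X W) α α + cvY (Yv σ X W) β β) := by
        unfold cvY
        rw [← mul_add, ← Finset.sum_add_distrib, ← mul_assoc, Finset.mul_sum]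
        refine Finset.sum_le_sum fun i _ => ?_
        calc ∑ κ, ((d : ℝ)⁻¹ * ((if κ = α then Yv σ X W i β else 0) + (if κ = β then Yv σ X W i α else 0))) ^ 2
            ≤ ∑ κ, (2 * (d : ℝ)⁻¹ * (d : ℝ)⁻¹) * ((if κ = α then Yv σ X W i β * Yv σ X W i β else 0) +
              (if κ = β then Yv σ X W i α * Yv σ X W i α else 0)) := by
              refine Finset.sum_le_sum fun κ _ => ?_
              rw [mul_pow, sq (d : ℝ)⁻¹, mul_assoc 2, mul_comm 2, mul_assoc _ 2]
              refine mul_le_mul_of_nonneg_left ?_ (by positivity)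
              split_ifs <;> nlinarith [sq_nonneg (Yv σ X W i β - Yv σ X W i α), sq_nonneg (Yv σ X W i α), sq_nonneg (Yv σ X W i β)]
          _ = _ := by
              rw [← Finset.mul_sum, Finset.sum_add_distrib]; simp [add_comm]
      refine (pow_le_pow_left₀ (by positivity) h3 _).trans ?_
      rw [mul_pow]
      refine mul_le_mul_of_nonneg_left ?_ (by positivity)
      exact add_pow_le ha hbb (p + 1)
  have h4 : ∫ W, (2 * (d : ℝ)⁻¹) ^ (p + 1) * (2 ^ p * (cvY (Yv σ X W) α α ^ (p + 1) + cvY (Yv σ X W) β β ^ (p + 1)))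
        ∂(gaussianMat d m) ≤ (2 * (d : ℝ)⁻¹) ^ (p + 1) * (2 ^ p * (C + C)) := by
    rw [integral_const_mul, integral_const_mul, integral_add ((hPGa.pow _).integrable _) ((hPGb.pow _).integrable _)]
    gcongr
    · exact H d m n X hd hX α
    · exact H d m n X hd hX β
  calc _ ≤ ((Real.pi / 2 * |B| * l) ^ (2 * (p + 1)) * gM (p + 1)) * ((2 * (d : ℝ)⁻¹) ^ (p + 1) * (2 ^ p * (C + C))) := by
        have := opNorm_nonneg' X
        have := gM_nonneg (p + 1)
        refine mul_le_mul ?_ (h2.trans h4) (integral_nonneg fun W => by positivity) (by positivity)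
        gcongr
    _ = _ := by rw [mul_pow 2 (d : ℝ)⁻¹, inv_pow]; field_simp

lemma grad_S {d n : ℕ} (f : Fin n → ℝ) : HasGrad (d := d) (fun Y => ∑ α, (cvY Y α α - f α) ^ 2)
    (fun Y i α => 4 * (d : ℝ)⁻¹ * (cvY Y α α - f α) * Y i α) := by
  intro c c' t hc
  have h1 : HasDerivAt (fun s => ∑ α, (cvY (c s) α α - f α) ^ 2)
      (∑ α, 2 * (cvY (c t) α α - f α) * ((d : ℝ)⁻¹ * ∑ i, (c' i α * c t i α + c t i α * c' i α))) t := by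
    refine HasDerivAt.fun_sum fun α _ => ?_
    have : HasDerivAt (fun s => cvY (c s) α α - f α) ((d : ℝ)⁻¹ * ∑ i, (c' i α * c t i α + c t i α * c' i α)) t := by
      unfold cvY
      refine HasDerivAt.sub_const _ (HasDerivAt.const_mul _ (HasDerivAt.fun_sum fun i _ => ?_))
      exact (hc i α).mul (hc i α)
    simpa using this.fun_pow 2
  convert h1 using 1
  rw [Finset.sum_comm]
  refine Finset.sum_congr rfl fun α _ => ?_
  simp only [Finset.mul_sum]
  exact Finset.sum_congr rfl fun i _ => by ring

lemma S_conc (h : ∀ x, HasDerivAt σ (σ' x) x) (hc' : Continuous σ') (hb : ∀ x, |σ' x| ≤ l) (B : ℝ) :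
    ∃ C : ℝ, 0 ≤ C ∧ ∀ (d m n : ℕ) (X : Matrix (Fin m) (Fin n) ℝ), 0 < d → Good B X → ∃ e : ℝ, e ≤ C * (n / d : ℝ) ∧
      ∫ W, ((∑ α, (cvY (Yv σ X W) α α - phi σ (fun j => X j α) (fun j => X j α)) ^ 2) - e) ^ 4 ∂(gaussianMat d m) ≤
        C * (n / d : ℝ) ^ 2 / (d : ℝ) ^ 2 := by
  obtain ⟨C, hC, H⟩ := cv_moment h hb B 3
  obtain ⟨C1, hC1, H1⟩ := entry_conc h hc' hb B 0
  obtain ⟨C4, hC4, H4⟩ := entry_conc h hc' hb B 3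
  have hl : 0 ≤ l := (abs_nonneg _).trans (hb 0)
  set D := ((Real.pi / 2 * |B| * l) ^ (2 * 2) * gM 2) * (256 * (C4 + C)) with hD
  have hD0 : 0 ≤ D := by have := gM_nonneg 2; positivity
  refine ⟨C1 + D, by positivity, fun d m n X hd hX => ?_⟩
  have hd' : (0:ℝ) < d := by positivity
  set f : Fin n → ℝ := fun α => phi σ (fun j => X j α) (fun j => X j α)
  have hP : ∀ α, PG (fun W : Fin d → Fin m → ℝ => cvY (Yv σ X W) α α) := fun α => cv_PG h hb X α α
  have hPf : ∀ α, PG (fun W : Fin d → Fin m → ℝ => cvY (Yv σ X W) α α - f α) := fun α => (hP α).sub (PG.const _)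
  have h1 := conc_moment X h hc' hb (grad_S (d := d) f) (PG.sum _ fun α => (hPf α).pow 2) (fun i α =>
    ((PG.const _).mul (hPf α)).mul (Yv_PG h hb X i α)) 2
  refine ⟨_, ?_, h1.trans ?_⟩
  · rw [integral_finsetSum _ fun α _ => ((hPf α).pow 2).integrable _]
    refine (Finset.sum_le_sum fun α _ => H1 d m n X hd hX α α).trans ?_
    simp only [zero_add, pow_one, Finset.sum_const, Finset.card_univ, Fintype.card_fin, nsmul_eq_mul]
    have : 0 ≤ D * (n / d : ℝ) := by positivity
    calc (n : ℝ) * (C1 / d) = C1 * (n / d : ℝ) := by ring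
      _ ≤ _ := by linarith
  have hop : opNorm X ≤ |B| := hX.1.trans (le_abs_self B)
  have h2 : ∀ W : Fin d → Fin m → ℝ, (∑ i, ∑ α, (4 * (d : ℝ)⁻¹ * (cvY (Yv σ X W) α α - f α) * Yv σ X W i α) ^ 2) ^ 2 ≤
      256 * (d : ℝ)⁻¹ ^ 2 * (n * ∑ α, ((d : ℝ) ^ 2 * (cvY (Yv σ X W) α α - f α) ^ (2 * (3 + 1)) +
        (d : ℝ)⁻¹ ^ 2 * cvY (Yv σ X W) α α ^ (3 + 1))) := by
    intro W
    have e : ∑ i, ∑ α, (4 * (d : ℝ)⁻¹ * (cvY (Yv σ X W) α α - f α) * Yv σ X W i α) ^ 2 =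
        16 * (d : ℝ)⁻¹ * ∑ α, (cvY (Yv σ X W) α α - f α) ^ 2 * cvY (Yv σ X W) α α := by
      rw [Finset.sum_comm, Finset.mul_sum]
      refine Finset.sum_congr rfl fun α _ => ?_
      conv_rhs => rw [show cvY (Yv σ X W) α α = (d : ℝ)⁻¹ * ∑ i, Yv σ X W i α * Yv σ X W i α from rfl]
      conv_rhs => enter [2, 1]; rw [show (d : ℝ)⁻¹ * ∑ i, Yv σ X W i α * Yv σ X W i α = cvY (Yv σ X W) α α from rfl]
      simp only [Finset.mul_sum]
      exact Finset.sum_congr rfl fun i _ => by ring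
    rw [e, mul_pow]
    have h3 := sq_sum_le_card_mul_sum_sq (s := Finset.univ)
      (f := fun α => (cvY (Yv σ X W) α α - f α) ^ 2 * cvY (Yv σ X W) α α)
    simp only [Finset.card_univ, Fintype.card_fin] at h3
    rw [show (16 * (d : ℝ)⁻¹) ^ 2 = 256 * (d : ℝ)⁻¹ ^ 2 by ring]
    refine mul_le_mul_of_nonneg_left (h3.trans ?_) (by positivity)
    refine mul_le_mul_of_nonneg_left (Finset.sum_le_sum fun α _ => ?_) (by positivity)
    generalize cvY (Yv σ X W) α α - f α = x
    generalize cvY (Yv σ X W) α α = y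
    have hdd : (d : ℝ) * (d : ℝ)⁻¹ = 1 := mul_inv_cancel₀ hd'.ne'
    have : (x ^ 2 * y) ^ 2 = (d * x ^ 4) * ((d : ℝ)⁻¹ * y ^ 2) := by
      linear_combination (-(x^4*y^2)) * hdd
    nlinarith [sq_nonneg (d * x ^ 4 - (d : ℝ)⁻¹ * y ^ 2), sq_nonneg (d * x ^ 4 + (d : ℝ)⁻¹ * y ^ 2)]
  have h5 : ∫ W, (∑ i, ∑ α, (4 * (d : ℝ)⁻¹ * (cvY (Yv σ X W) α α - f α) * Yv σ X W i α) ^ 2) ^ 2 ∂(gaussianMat d m) ≤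
      256 * (d : ℝ)⁻¹ ^ 2 * (n * ∑ α : Fin n, ((d : ℝ) ^ 2 * (C4 / (d : ℝ) ^ (3 + 1)) + (d : ℝ)⁻¹ ^ 2 * C)) := by
    refine (integral_mono ?_ ?_ h2).trans ?_
    · exact ((PG.sum _ fun i => PG.sum _ fun α => (((PG.const _).mul (hPf α)).mul (Yv_PG h hb X i α)).pow 2).pow 2).integrable _
    · exact ((PG.const _).mul ((PG.const _).mul (PG.sum _ fun α => ((PG.const _).mul ((hPf α).pow _)).add
        ((PG.const _).mul ((hP α).pow _))))).integrable _
    · rw [integral_const_mul, integral_const_mul, integral_finsetSum _ fun α _ => (((PG.const _).mul ((hPf α).pow _)).add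
        ((PG.const _).mul ((hP α).pow _))).integrable _]
      refine mul_le_mul_of_nonneg_left (mul_le_mul_of_nonneg_left (Finset.sum_le_sum fun α _ => ?_) (by positivity)) (by positivity)
      rw [integral_add (((PG.const _).mul ((hPf α).pow _)).integrable _) (((PG.const _).mul ((hP α).pow _)).integrable _),
        integral_const_mul, integral_const_mul]
      exact add_le_add (mul_le_mul_of_nonneg_left (H4 d m n X hd hX α α) (by positivity))
        (mul_le_mul_of_nonneg_left (H d m n X hd hX α) (by positivity))
  calc _ ≤ ((Real.pi / 2 * |B| * l) ^ (2 * 2) * gM 2) * (256 * (d : ℝ)⁻¹ ^ 2 * (n * ∑ α : Fin n, ((d : ℝ) ^ 2 * (C4 / (d : ℝ) ^ (3 + 1)) + (d : ℝ)⁻¹ ^ 2 * C))) := by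
        have := opNorm_nonneg' X
        have := gM_nonneg 2
        refine mul_le_mul ?_ h5 (integral_nonneg fun W => by positivity) (by positivity)
        gcongr
    _ = D * (n / d : ℝ) ^ 2 / (d : ℝ) ^ 2 := by
        rw [hD]; simp only [Finset.sum_const, Finset.card_univ, Fintype.card_fin, nsmul_eq_mul]; field_simp; try ring
    _ ≤ _ := by
        rw [add_mul, add_div]
        have : 0 ≤ C1 * (n / d : ℝ) ^ 2 / (d : ℝ) ^ 2 := by positivity
        linarith
end ent
end

section
open scoped ENNReal NNReal
lemma lint_le {E : Type*} [NormedAddCommGroup E] [NormedSpace ℝ E] [MeasurableSpace E] [BorelSpace E] [CompleteSpace E]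
    [SecondCountableTopology E] (μ : Measure E) [IsGaussian μ] {f g : E → ℝ} (hg : PG g)
    (hfg : ∀ x, f x ≤ g x) (h0 : ∀ x, 0 ≤ g x) {c : ℝ} (hc : ∫ x, g x ∂μ ≤ c) :
    ∫⁻ x, ENNReal.ofReal (f x) ∂μ ≤ ENNReal.ofReal c := by
  refine (lintegral_mono fun x => ENNReal.ofReal_le_ofReal (hfg x)).trans ?_
  rw [← ofReal_integral_eq_lintegral_ofReal (hg.integrable _) (Eventually.of_forall h0)]
  exact ENNReal.ofReal_le_ofReal hc

section ent
variable {σ σ' σ'' : ℝ → ℝ} {l : ℝ}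

lemma S_final (h : ∀ x, HasDerivAt σ (σ' x) x) (hc' : Continuous σ') (hb : ∀ x, |σ' x| ≤ l)
    (hvar : ∫ x, σ x ^ 2 ∂(gaussianReal 0 1) = 1) (B : ℝ) :
    ∃ C D : ℝ, 0 ≤ C ∧ 0 ≤ D ∧ ∀ (d m n : ℕ) (X : Matrix (Fin m) (Fin n) ℝ), 0 < d → Good B X →
      ∫⁻ W, ENNReal.ofReal (max ((∑ α, (cvY (Yv σ X W) α α - 1) ^ 2) - D * (1 + (n / d : ℝ))) 0 ^ 4) ∂(gaussianMat d m) ≤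
        ENNReal.ofReal (C * (n / d : ℝ) ^ 2 / (d : ℝ) ^ 2) := by
  obtain ⟨C, hC, H⟩ := S_conc h hc' hb B
  obtain ⟨C2, hC2, H2⟩ := sq_mean h hb hvar (B ^ 2)
  refine ⟨16 * C, 2 * C + 2 * C2 ^ 2 * B ^ 2, by positivity, by positivity, fun d m n X hd hX => ?_⟩
  obtain ⟨e, he, h1⟩ := H d m n X hd hX
  set f : Fin n → ℝ := fun α => phi σ (fun j => X j α) (fun j => X j α)
  refine lint_le (gaussianMat d m) (g := fun W => 16 * ((∑ α, (cvY (Yv σ X W) α α - f α) ^ 2) - e) ^ 4)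
    ((PG.const _).mul (((PG.sum _ fun α => ((cv_PG h hb X α α).sub (PG.const _)).pow 2).sub (PG.const _)).pow 4)) ?_
    (fun W => by positivity) ?_
  · intro W
    have h3 : ∑ α, (f α - 1) ^ 2 ≤ C2 ^ 2 * B ^ 2 := by
      calc ∑ α, (f α - 1) ^ 2 ≤ ∑ α, C2 ^ 2 * ((∑ j, X j α ^ 2) - 1) ^ 2 := by
            refine Finset.sum_le_sum fun α _ => ?_
            have := H2 _ (by positivity) (hX.col α)
            rw [← phi_self h (fun j => X j α)] at this
            have := pow_le_pow_left₀ (abs_nonneg _) this 2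
            rwa [sq_abs, mul_pow, sq_abs] at this
        _ ≤ C2 ^ 2 * B ^ 2 := by rw [← Finset.mul_sum]; exact mul_le_mul_of_nonneg_left hX.2 (by positivity)
    have h4 : ∑ α, (cvY (Yv σ X W) α α - 1) ^ 2 ≤ 2 * (∑ α, (cvY (Yv σ X W) α α - f α) ^ 2) + 2 * ∑ α, (f α - 1) ^ 2 := by
      rw [Finset.mul_sum, Finset.mul_sum, ← Finset.sum_add_distrib]
      refine Finset.sum_le_sum fun α _ => ?_
      nlinarith [sq_nonneg ((cvY (Yv σ X W) α α - f α) - (f α - 1))]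
    have hnd : (0:ℝ) ≤ n / d := by positivity
    rcases le_or_gt ((∑ α, (cvY (Yv σ X W) α α - 1) ^ 2) - (2 * C + 2 * C2 ^ 2 * B ^ 2) * (1 + (n / d : ℝ))) 0 with h5 | h5
    · rw [max_eq_right h5]
      have : 0 ≤ ((∑ α, (cvY (Yv σ X W) α α - f α) ^ 2) - e) ^ 4 := by positivity
      simp only [ne_eq, OfNat.ofNat_ne_zero, not_false_eq_true, zero_pow]
      positivity
    · rw [max_eq_left h5.le]
      have : (∑ α, (cvY (Yv σ X W) α α - 1) ^ 2) - (2 * C + 2 * C2 ^ 2 * B ^ 2) * (1 + (n / d : ℝ)) ≤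
          2 * ((∑ α, (cvY (Yv σ X W) α α - f α) ^ 2) - e) := by
        have : 0 ≤ C2 ^ 2 * B ^ 2 * (n / d : ℝ) := by positivity
        nlinarith
      refine (pow_le_pow_left₀ h5.le this 4).trans (le_of_eq (by ring))
  · rw [integral_const_mul]
    have := mul_le_mul_of_nonneg_left h1 (by norm_num : (0:ℝ) ≤ 16)
    refine this.trans (le_of_eq (by ring))

/-- off-diagonal fourth powers -/
noncomputable def offY {d n : ℕ} (Y : Fin d → Fin n → ℝ) : ℝ :=
  ∑ α, ∑ β, if α = β then 0 else cvY Y α β ^ 4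

lemma off_final (h : ∀ x, HasDerivAt σ (σ' x) x) (h2 : ∀ x, HasDerivAt σ' (σ'' x) x)
    (hb : ∀ x, |σ' x| ≤ l) (hb2 : ∀ x, |σ'' x| ≤ l) (hmean : ∫ x, σ x ∂(gaussianReal 0 1) = 0)
    (hvar : ∫ x, σ x ^ 2 ∂(gaussianReal 0 1) = 1) (B : ℝ) :
    ∃ C D : ℝ, 0 ≤ C ∧ 0 ≤ D ∧ ∀ (d m n : ℕ) (X : Matrix (Fin m) (Fin n) ℝ), 0 < d → 0 < n → Good B X →
      ∫⁻ W, ENNReal.ofReal ((max (offY (Yv σ X W) - D * (1 + offd X)) 0 / n) ^ 2) ∂(gaussianMat d m) ≤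
        ENNReal.ofReal (C * (n / d : ℝ) ^ 2 / (d : ℝ) ^ 2) := by
  have hc' : Continuous σ' := continuous_iff_continuousAt.2 fun x => (h2 x).continuousAt
  obtain ⟨C4, hC4, H4⟩ := entry_conc h hc' hb B 3
  obtain ⟨C, hC, H⟩ := frob_bound h h2 hb hb2 hmean hvar B
  obtain ⟨M, hM, HM⟩ := mom_bd h hb (B ^ 2) 1
  have hb1 := b_sq_le h hc' hb hvar
  set b := ∫ x, σ' x ∂(gaussianReal 0 1)
  refine ⟨64 * C4, 64 * ((2 * M + B ^ 2) ^ 2 * C + 1), by positivity, by positivity, fun d m n X hd hn hX => ?_⟩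
  have hn' : (0:ℝ) < n := by positivity
  have hd' : (0:ℝ) < d := by positivity
  set f : Fin n → Fin n → ℝ := fun α β => phi σ (fun j => X j α) (fun j => X j β)
  set c : Fin n → Fin n → ℝ := fun α β => ∑ j, X j α * X j β
  have hO : 0 ≤ offd X := Finset.sum_nonneg fun α _ => Finset.sum_nonneg fun β _ => by split_ifs <;> positivity
  have hf : ∑ α, ∑ β, (if α = β then 0 else f α β ^ 4) ≤ 8 * ((2 * M + B ^ 2) ^ 2 * C + 1) * (1 + offd X) := by
    have k : ∀ α β, (if α = β then 0 else f α β ^ 4) ≤ 8 * ((2 * M + B ^ 2) ^ 2 * (f α β - ((if α = β then 1 - b ^ 2 else 0) +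
          b ^ 2 * c α β)) ^ 2) + 8 * (if α = β then 0 else c α β ^ 4) := by
      intro α β
      split_ifs with hab
      · positivity
      · rw [zero_add]
        have k1 : |f α β| ≤ 2 * M := by
          refine (phi_abs_le h hb _ _).trans ?_
          rw [phi_self h, phi_self h]
          have a1 := HM _ (hX.col α)
          have a2 := HM _ (hX.col β)
          rw [mul_one] at a1 a2
          linarith
        have k2 : |c α β| ≤ B ^ 2 := by
          have h1 : |∑ j, X j α * X j β| ≤ ∑ j, (X j α ^ 2 + X j β ^ 2) / 2 := by
            refine (Finset.abs_sum_le_sum_abs _ _).trans (Finset.sum_le_sum fun j _ => ?_)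
            rw [abs_le]; constructor <;> nlinarith [sq_nonneg (X j α - X j β), sq_nonneg (X j α + X j β)]
          rw [← Finset.sum_div, Finset.sum_add_distrib] at h1
          linarith [hX.col α, hX.col β]
        have k3 : |f α β - b ^ 2 * c α β| ≤ 2 * M + B ^ 2 := by
          refine (abs_sub _ _).trans (add_le_add k1 ?_)
          rw [abs_mul, abs_of_nonneg (sq_nonneg b)]
          nlinarith [abs_nonneg (c α β)]
        have k4 := pow_le_pow_left₀ (abs_nonneg _) k3 2
        rw [sq_abs] at k4
        have k5 := mul_le_mul_of_nonneg_right k4 (sq_nonneg (f α β - b ^ 2 * c α β))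
        have k6 : (b ^ 2 * c α β) ^ 4 ≤ c α β ^ 4 := by
          rw [mul_pow]
          have : (b ^ 2) ^ 4 ≤ 1 := pow_le_one₀ (sq_nonneg b) hb1
          nlinarith [show 0 ≤ c α β ^ 4 by positivity]
        have k7 : f α β ^ 4 ≤ 8 * (f α β - b ^ 2 * c α β) ^ 4 + 8 * (b ^ 2 * c α β) ^ 4 := by
          generalize b ^ 2 * c α β = y
          generalize f α β = x
          obtain ⟨z, rfl⟩ : ∃ z, x = z + y := ⟨x - y, by ring⟩
          rw [add_sub_cancel_right]
          nlinarith [sq_nonneg (z - y), sq_nonneg (z + y), sq_nonneg (z^2 - y^2), mul_nonneg (sq_nonneg (z-y)) (sq_nonneg (z+y)), mul_nonneg (sq_nonneg (z-y)) (sq_nonneg (z-y)), mul_nonneg (sq_nonneg (z-y)) (sq_nonneg z), mul_nonneg (sq_nonneg (z-y)) (sq_nonneg y)]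
        nlinarith
    refine (Finset.sum_le_sum fun α _ => Finset.sum_le_sum fun β _ => k α β).trans ?_
    have k8 := H m n X hX
    simp only [Finset.sum_add_distrib, ← Finset.mul_sum] at k8 ⊢
    change _ + 8 * offd X ≤ _
    have : (2 * M + B ^ 2) ^ 2 * ∑ α, ∑ β, (f α β - ((if α = β then 1 - b ^ 2 else 0) + b ^ 2 * c α β)) ^ 2 ≤
      (2 * M + B ^ 2) ^ 2 * (C * (1 + offd X)) := mul_le_mul_of_nonneg_left k8 (by positivity)
    nlinarith
  have hPf : ∀ α β, PG (fun W : Fin d → Fin m → ℝ => cvY (Yv σ X W) α β - f α β) := fun α β =>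
    (cv_PG h hb X α β).sub (PG.const _)
  refine lint_le (gaussianMat d m) (g := fun W => 64 * ∑ α, ∑ β, (cvY (Yv σ X W) α β - f α β) ^ (2 * (3 + 1)))
    ((PG.const _).mul (PG.sum _ fun α => PG.sum _ fun β => (hPf α β).pow _)) ?_
    (fun W => by
      refine mul_nonneg (by norm_num) (Finset.sum_nonneg fun α _ => Finset.sum_nonneg fun β _ => ?_)
      rw [pow_mul]; positivity) ?_
  · intro W
    set F := ∑ α, ∑ β, (cvY (Yv σ X W) α β - f α β) ^ 4
    have hF0 : 0 ≤ F := by positivity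
    have k1 : offY (Yv σ X W) ≤ 8 * F + 8 * ∑ α, ∑ β, (if α = β then 0 else f α β ^ 4) := by
      simp only [offY, F, Finset.mul_sum, ← Finset.sum_add_distrib]
      refine Finset.sum_le_sum fun α _ => Finset.sum_le_sum fun β _ => ?_
      split_ifs
      · positivity
      · generalize cvY (Yv σ X W) α β = x
        generalize f α β = y
        obtain ⟨z, rfl⟩ : ∃ z, x = z + y := ⟨x - y, by ring⟩
        rw [add_sub_cancel_right]
        nlinarith [sq_nonneg (z - y), sq_nonneg (z + y), sq_nonneg (z^2 - y^2), mul_nonneg (sq_nonneg (z-y)) (sq_nonneg (z+y)), mul_nonneg (sq_nonneg (z-y)) (sq_nonneg (z-y)), mul_nonneg (sq_nonneg (z-y)) (sq_nonneg z), mul_nonneg (sq_nonneg (z-y)) (sq_nonneg y)]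
    have k2 : max (offY (Yv σ X W) - 64 * ((2 * M + B ^ 2) ^ 2 * C + 1) * (1 + offd X)) 0 ≤ 8 * F := by
      refine max_le ?_ (by positivity)
      linarith
    have k3 : F ^ 2 ≤ (n : ℝ) ^ 2 * ∑ α, ∑ β, (cvY (Yv σ X W) α β - f α β) ^ (2 * (3 + 1)) := by
      have a1 := sq_sum_le_card_mul_sum_sq (s := Finset.univ) (f := fun α => ∑ β, (cvY (Yv σ X W) α β - f α β) ^ 4)
      refine a1.trans ?_
      simp only [Finset.card_univ, Fintype.card_fin]
      rw [sq, mul_assoc]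
      refine mul_le_mul_of_nonneg_left ?_ hn'.le
      rw [Finset.mul_sum]
      refine Finset.sum_le_sum fun α _ => ?_
      have a2 := sq_sum_le_card_mul_sum_sq (s := Finset.univ) (f := fun β => (cvY (Yv σ X W) α β - f α β) ^ 4)
      simp only [Finset.card_univ, Fintype.card_fin, ← pow_mul] at a2
      exact a2
    rw [div_pow, div_le_iff₀ (by positivity)]
    refine (pow_le_pow_left₀ (le_max_right _ _) k2 2).trans ?_
    nlinarith
  · rw [integral_const_mul, integral_finsetSum _ fun α _ => (PG.sum _ fun β => (hPf α β).pow _).integrable _]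
    have : ∑ α : Fin n, ∫ W, ∑ β, (cvY (Yv σ X W) α β - f α β) ^ (2 * (3 + 1)) ∂(gaussianMat d m) ≤
        ∑ α : Fin n, ∑ β : Fin n, C4 / (d : ℝ) ^ (3 + 1) := by
      refine Finset.sum_le_sum fun α _ => ?_
      rw [integral_finsetSum _ fun β _ => ((hPf α β).pow _).integrable _]
      exact Finset.sum_le_sum fun β _ => H4 d m n X hd hX α β
    refine (mul_le_mul_of_nonneg_left this (by norm_num)).trans (le_of_eq ?_)
    simp only [Finset.sum_const, Finset.card_univ, Fintype.card_fin, nsmul_eq_mul]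
    field_simp

lemma grad_quad {d n : ℕ} (A : Matrix (Fin n) (Fin n) ℝ) (i : Fin d) :
    HasGrad (d := d) (fun Y => ∑ α, ∑ β, Y i α * A α β * Y i β)
    (fun Y i' κ => if i' = i then (∑ β, A κ β * Y i β) + ∑ β, A β κ * Y i β else 0) := by
  intro c c' t hc
  have h1 : HasDerivAt (fun s => ∑ α, ∑ β, c s i α * A α β * c s i β)
      (∑ α, ∑ β, (c' i α * A α β * c t i β + c t i α * A α β * c' i β)) t := by
    refine HasDerivAt.fun_sum fun α _ => HasDerivAt.fun_sum fun β _ => ?_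
    exact ((hc i α).mul_const (A α β)).mul (hc i β)
  convert h1 using 1
  rw [Finset.sum_eq_single i (fun i' _ hi' => by simp [hi']) (by simp)]
  simp only [if_true, Finset.sum_add_distrib, add_mul]
  congr 1
  · simp only [Finset.sum_mul]
    exact Finset.sum_congr rfl fun α _ => Finset.sum_congr rfl fun β _ => by ring
  · rw [Finset.sum_comm (f := fun α β => c t i α * A α β * c' i β)]
    simp only [Finset.sum_mul]
    exact Finset.sum_congr rfl fun α _ => Finset.sum_congr rfl fun β _ => by ring

lemma quad_conc (h : ∀ x, HasDerivAt σ (σ' x) x) (hc' : Continuous σ') (hb : ∀ x, |σ' x| ≤ l) (B : ℝ) :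
    ∃ C : ℝ, 0 ≤ C ∧ ∀ (d m n : ℕ) (X : Matrix (Fin m) (Fin n) ℝ), Good B X →
      ∀ (A : Matrix (Fin n) (Fin n) ℝ) (i : Fin d),
      ∫ W, ((∑ α, ∑ β, Yv σ X W i α * A α β * Yv σ X W i β) -
        ∑ α, ∑ β, A α β * phi σ (fun j => X j α) (fun j => X j β)) ^ 4 ∂(gaussianMat d m) ≤
        C * opNorm A ^ 4 * (n : ℝ) ^ 2 := by
  obtain ⟨C, hC, H⟩ := row_moment h hb B 2
  have hl : 0 ≤ l := (abs_nonneg _).trans (hb 0)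
  refine ⟨((Real.pi / 2 * |B| * l) ^ (2 * 2) * gM 2) * (16 * C), by
    have := gM_nonneg 2; positivity, fun d m n X hX A i => ?_⟩
  have hY : ∀ α, PG (fun W : Fin d → Fin m → ℝ => Yv σ X W i α) := fun α => Yv_PG h hb X i α
  have hq : ∀ α β, PG (fun W : Fin d → Fin m → ℝ => Yv σ X W i α * A α β * Yv σ X W i β) := fun α β =>
    ((hY α).mul (PG.const _)).mul (hY β)
  have hdg : ∀ (i' : Fin d) κ, PG (fun W : Fin d → Fin m → ℝ => if i' = i then (∑ β, A κ β * Yv σ X W i β) +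
      ∑ β, A β κ * Yv σ X W i β else 0) := fun i' κ => by
    split_ifs
    · exact (PG.sum _ fun β => (PG.const _).mul (hY β)).add (PG.sum _ fun β => (PG.const _).mul (hY β))
    · exact PG.const 0
  have h1 := conc_moment X h hc' hb (grad_quad (d := d) A i) (PG.sum _ fun α => PG.sum _ fun β => hq α β) hdg 2
  have hm : ∫ W, ∑ α, ∑ β, Yv σ X W i α * A α β * Yv σ X W i β ∂(gaussianMat d m) =
      ∑ α, ∑ β, A α β * phi σ (fun j => X j α) (fun j => X j β) := by
    rw [integral_finsetSum _ fun α _ => (PG.sum _ fun β => hq α β).integrable _]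
    refine Finset.sum_congr rfl fun α _ => ?_
    rw [integral_finsetSum _ fun β _ => (hq α β).integrable _]
    refine Finset.sum_congr rfl fun β _ => ?_
    rw [← row_cov h X i α β, ← integral_const_mul]
    congr 1; ext W; ring
  rw [hm] at h1
  refine h1.trans ?_
  have hop : opNorm X ≤ |B| := hX.1.trans (le_abs_self B)
  have h2 : ∀ W : Fin d → Fin m → ℝ, (∑ i', ∑ κ, (if i' = i then (∑ β, A κ β * Yv σ X W i β) +
      ∑ β, A β κ * Yv σ X W i β else 0) ^ 2) ^ 2 ≤ 16 * opNorm A ^ 4 * (n * ∑ α, Yv σ X W i α ^ (2 * 2)) := by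
    intro W
    rw [Finset.sum_eq_single i (fun i' _ hi' => by simp [hi']) (by simp)]
    simp only [if_true]
    set y := Yv σ X W i
    have e1 := opNorm_mulVec_sq A y
    have e2 := opNorm_T_sq A y
    have e3 : ∑ κ, ((∑ β, A κ β * y β) + ∑ β, A β κ * y β) ^ 2 ≤ 4 * opNorm A ^ 2 * ∑ α, y α ^ 2 := by
      calc _ ≤ ∑ κ, (2 * (∑ β, A κ β * y β) ^ 2 + 2 * (∑ β, A β κ * y β) ^ 2) :=
            Finset.sum_le_sum fun κ _ => by nlinarith [sq_nonneg ((∑ β, A κ β * y β) - ∑ β, A β κ * y β)]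
        _ ≤ _ := by rw [Finset.sum_add_distrib, ← Finset.mul_sum, ← Finset.mul_sum]; linarith
    refine (pow_le_pow_left₀ (by positivity) e3 2).trans ?_
    have e4 := sq_sum_le_card_mul_sum_sq (s := Finset.univ) (f := fun α => y α ^ 2)
    simp only [Finset.card_univ, Fintype.card_fin, ← pow_mul] at e4
    rw [mul_pow]
    have : (4 * opNorm A ^ 2) ^ 2 = 16 * opNorm A ^ 4 := by ring
    rw [this]
    exact mul_le_mul_of_nonneg_left e4 (by positivity)
  have h5 : ∫ W, (∑ i', ∑ κ, (if i' = i then (∑ β, A κ β * Yv σ X W i β) +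
      ∑ β, A β κ * Yv σ X W i β else 0) ^ 2) ^ 2 ∂(gaussianMat d m) ≤ 16 * opNorm A ^ 4 * (n * ∑ α : Fin n, C) := by
    refine (integral_mono ((PG.sum _ fun i' => PG.sum _ fun κ => (hdg i' κ).pow 2).pow 2 |>.integrable _)
      (((PG.const _).mul ((PG.const _).mul (PG.sum _ fun α => (hY α).pow _))).integrable _) h2).trans ?_
    rw [integral_const_mul, integral_const_mul, integral_finsetSum _ fun α _ => ((hY α).pow _).integrable _]
    have := opNorm_nonneg' A
    gcongr with α
    exact H d m n X hX i α
  calc _ ≤ ((Real.pi / 2 * |B| * l) ^ (2 * 2) * gM 2) * (16 * opNorm A ^ 4 * (n * ∑ α : Fin n, C)) := by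
        have := opNorm_nonneg' X
        have := gM_nonneg 2
        refine mul_le_mul ?_ h5 (integral_nonneg fun W => by positivity) (by positivity)
        gcongr
    _ = _ := by
        simp only [Finset.sum_const, Finset.card_univ, Fintype.card_fin, nsmul_eq_mul]; ring
end ent
end

section
open scoped ENNReal NNReal
lemma vol_opn {d n : ℕ} (M : Matrix (Fin d) (Fin n) ℝ) {t : ℝ} (ht : 0 ≤ t) :
    ENNReal.ofReal (Real.exp (t * opNorm M / 4)) *
      (volume (Metric.ball (0 : EuclideanSpace ℝ (Fin d)) (1/4)) *
        volume (Metric.ball (0 : EuclideanSpace ℝ (Fin n)) (1/4))) ≤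
    ∫⁻ p in Metric.ball (0 : EuclideanSpace ℝ (Fin d)) 2 ×ˢ Metric.ball (0 : EuclideanSpace ℝ (Fin n)) 2,
      ENNReal.ofReal (Real.exp (∑ i, ∑ α, (t * p.1 i * p.2 α) * M i α)) ∂((volume : Measure (EuclideanSpace ℝ (Fin d))).prod volume) := by
  set T := LinearMap.toContinuousLinearMap (Matrix.toEuclideanLin M) with hT
  have hK : opNorm M = ‖T‖ := rfl
  have hin : ∀ (u : EuclideanSpace ℝ (Fin d)) (v : EuclideanSpace ℝ (Fin n)),
      ∑ i, ∑ α, (t * u i * v α) * M i α = t * inner ℝ u (T v) := by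
    intro u v
    simp only [PiLp.inner_apply, hT, Matrix.toEuclideanLin, Matrix.mulVec, dotProduct, Finset.mul_sum]
    simp [Matrix.mulVec, dotProduct, Finset.mul_sum]
    refine Finset.sum_congr rfl fun i _ => ?_
    rw [Finset.sum_mul, Finset.mul_sum]
    exact Finset.sum_congr rfl fun α _ => by ring
  simp only [hin, hK]
  obtain ⟨u0, v0, hu0, hv0, h0⟩ : ∃ (u : EuclideanSpace ℝ (Fin d)) (v : EuclideanSpace ℝ (Fin n)),
      ‖u‖ ≤ 1 ∧ ‖v‖ ≤ 1 ∧ 15 / 16 * ‖T‖ ≤ inner ℝ u (T v) := by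
    rcases (norm_nonneg T).eq_or_lt with h | h
    · exact ⟨0, 0, by simp, by simp, by simp [← h]⟩
    · obtain ⟨v, hv, hv2⟩ := T.exists_lt_apply_of_lt_opNorm (r := 15 / 16 * ‖T‖) (by linarith)
      have hpos : 0 < ‖T v‖ := lt_of_le_of_lt (by positivity) hv2
      refine ⟨‖T v‖⁻¹ • T v, v, ?_, hv.le, ?_⟩
      · rw [norm_smul, norm_inv, norm_norm, inv_mul_cancel₀ hpos.ne']
      · rw [real_inner_smul_left, real_inner_self_eq_norm_sq, pow_two, ← mul_assoc, inv_mul_cancel₀ hpos.ne', one_mul]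
        exact hv2.le
  have hvb : volume (Metric.ball (0 : EuclideanSpace ℝ (Fin d)) (1/4)) *
        volume (Metric.ball (0 : EuclideanSpace ℝ (Fin n)) (1/4)) =
        ((volume : Measure (EuclideanSpace ℝ (Fin d))).prod volume) (Metric.ball u0 (1/4) ×ˢ Metric.ball v0 (1/4)) := by
    rw [Measure.prod_prod, Measure.addHaar_ball_center volume u0, Measure.addHaar_ball_center volume v0]
  rw [hvb, ← setLIntegral_const]
  refine le_trans ?_ (lintegral_mono_set (μ := (volume : Measure (EuclideanSpace ℝ (Fin d))).prod volume) (s := Metric.ball u0 (1/4) ×ˢ Metric.ball v0 (1/4)) ?_)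
  · refine setLIntegral_mono' (Metric.isOpen_ball.measurableSet.prod Metric.isOpen_ball.measurableSet) fun p hp => ?_
    refine ENNReal.ofReal_le_ofReal (Real.exp_le_exp.2 ?_)
    rw [mul_div_assoc]
    refine mul_le_mul_of_nonneg_left ?_ ht
    obtain ⟨h1, h2⟩ := hp
    rw [mem_ball_iff_norm] at h1 h2
    have e : inner ℝ p.1 (T p.2) = inner ℝ u0 (T v0) + inner ℝ (p.1 - u0) (T v0) + inner ℝ p.1 (T (p.2 - v0)) := by
      rw [map_sub, inner_sub_right, inner_sub_left]; ring
    have h3 := abs_real_inner_le_norm (p.1 - u0) (T v0)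
    have h4 := abs_real_inner_le_norm p.1 (T (p.2 - v0))
    have h5 : ‖p.1‖ ≤ 5 / 4 := by
      have := norm_le_norm_add_norm_sub u0 p.1
      rw [norm_sub_rev] at this; linarith
    have hN := norm_nonneg T
    have h6 : ‖p.1 - u0‖ * ‖T v0‖ ≤ 1 / 4 * ‖T‖ := by
      have : ‖T v0‖ ≤ ‖T‖ := T.unit_le_opNorm v0 hv0
      exact mul_le_mul h1.le this (norm_nonneg _) (by norm_num)
    have h7 : ‖p.1‖ * ‖T (p.2 - v0)‖ ≤ 5 / 4 * (‖T‖ * (1 / 4)) := by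
      refine mul_le_mul h5 ((T.le_opNorm _).trans ?_) (norm_nonneg _) (by norm_num)
      exact mul_le_mul_of_nonneg_left h2.le hN
    have := (abs_le.1 h3).1
    have := (abs_le.1 h4).1
    rw [e]; linarith
  · refine Set.prod_mono (Metric.ball_subset_ball' ?_) (Metric.ball_subset_ball' ?_) <;>
    · rw [dist_zero_right]; linarith

variable {σ σ' : ℝ → ℝ} {l : ℝ}

lemma opn_exp (h : ∀ x, HasDerivAt σ (σ' x) x) (hc' : Continuous σ') (hb : ∀ x, |σ' x| ≤ l)
    (hmean : ∫ x, σ x ∂(gaussianReal 0 1) = 0) (B : ℝ) :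
    ∃ C : ℝ, 0 ≤ C ∧ ∀ (d m n : ℕ) (X : Matrix (Fin m) (Fin n) ℝ), Good B X →
      ∫⁻ W, ENNReal.ofReal (Real.exp (√d * opNorm (Matrix.of (Yv σ X W)) / 4)) ∂(gaussianMat d m) ≤
        ENNReal.ofReal (Real.exp (C * (d + n))) := by
  have hl : 0 ≤ l := (abs_nonneg _).trans (hb 0)
  refine ⟨Real.log 8 + 4 * (l * gA * |B|) + 8 * (Real.pi / 2 * |B| * l) ^ 2, by
    have := gA_nonneg; have := Real.log_nonneg (by norm_num : (1:ℝ) ≤ 8); positivity, fun d m n X hX => ?_⟩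
  have hB : 0 ≤ B := (opNorm_nonneg' X).trans hX.1
  have hg := gA_nonneg
  have hσc : Continuous σ := continuous_iff_continuousAt.2 fun x => (h x).continuousAt
  set V := volume (Metric.ball (0 : EuclideanSpace ℝ (Fin d)) (1/4)) *
        volume (Metric.ball (0 : EuclideanSpace ℝ (Fin n)) (1/4)) with hV
  have hV0 : V ≠ 0 := mul_ne_zero (Metric.measure_ball_pos _ _ (by norm_num)).ne' (Metric.measure_ball_pos _ _ (by norm_num)).ne'
  have hVt : V ≠ ⊤ := ENNReal.mul_ne_top measure_ball_lt_top.ne measure_ball_lt_top.ne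
  rw [← ENNReal.mul_le_mul_iff_left hV0 hVt, ← lintegral_mul_const' _ _ hVt]
  set S := Metric.ball (0 : EuclideanSpace ℝ (Fin d)) 2 ×ˢ Metric.ball (0 : EuclideanSpace ℝ (Fin n)) 2
  have hYc : ∀ i α, Continuous (fun W : Fin d → Fin m → ℝ => Yv σ X W i α) := fun i α => (Yv_PG h hb X i α).cont
  calc _ ≤ ∫⁻ W, ∫⁻ p in S,
      ENNReal.ofReal (Real.exp (∑ i, ∑ α, (√d * p.1 i * p.2 α) * Yv σ X W i α)) ∂((volume : Measure (EuclideanSpace ℝ (Fin d))).prod volume) ∂(gaussianMat d m) :=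
        lintegral_mono fun W => vol_opn (Matrix.of (Yv σ X W)) (Real.sqrt_nonneg _)
    _ = ∫⁻ p in S, ∫⁻ W, 
      ENNReal.ofReal (Real.exp (∑ i, ∑ α, (√d * p.1 i * p.2 α) * Yv σ X W i α)) ∂(gaussianMat d m) ∂((volume : Measure (EuclideanSpace ℝ (Fin d))).prod volume) := by
        refine lintegral_lintegral_swap (Measurable.aemeasurable ?_)
        refine ENNReal.measurable_ofReal.comp (Real.measurable_exp.comp ?_)
        refine Finset.measurable_fun_sum _ fun i _ => Finset.measurable_fun_sum _ fun α _ => ?_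
        have := (hYc i α).measurable
        fun_prop
    _ ≤ ∫⁻ p in S, ENNReal.ofReal (Real.exp (4 * d * (l * gA * B)) * Real.exp ((Real.pi / 2 * B * l) ^ 2 * (16 * d) / 2))
          ∂((volume : Measure (EuclideanSpace ℝ (Fin d))).prod volume) := by
        refine setLIntegral_mono' (Metric.isOpen_ball.measurableSet.prod Metric.isOpen_ball.measurableSet) fun p hp => ?_
        obtain ⟨h1, h2⟩ := hp
        rw [mem_ball_zero_iff] at h1 h2
        have h1' : ∑ i, p.1 i ^ 2 ≤ 4 := by
          have := EuclideanSpace.norm_sq_eq p.1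
          simp only [Real.norm_eq_abs, sq_abs] at this
          rw [← this]; nlinarith [norm_nonneg p.1]
        have h2' : ∑ i, p.2 i ^ 2 ≤ 4 := by
          have := EuclideanSpace.norm_sq_eq p.2
          simp only [Real.norm_eq_abs, sq_abs] at this
          rw [← this]; nlinarith [norm_nonneg p.2]
        have hce := conc_exp X h hc' hb (fun (i : Fin d) α => √d * p.1 i * p.2 α)
        set mu := ∫ W', (∑ i, ∑ α, (√d * p.1 i * p.2 α) * Yv σ X W' i α) ∂(gaussianMat d m) with hmu
        have hmu1 : mu ≤ 4 * d * (l * gA * B) := by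
          have e1 : mu = √d * (∑ i, p.1 i) * (∑ α, p.2 α * ∫ x, σ (√(∑ j, X j α ^ 2) * x) ∂(gaussianReal 0 1)) := by
            rw [hmu, integral_finsetSum _ fun i _ => (PG.sum _ fun α => (PG.const _).mul (Yv_PG h hb X i α)).integrable _,
              Finset.mul_sum Finset.univ (fun i => p.1 i), Finset.sum_mul]
            refine Finset.sum_congr rfl fun i _ => ?_
            rw [integral_finsetSum _ fun α _ => ((PG.const _).mul (Yv_PG h hb X i α)).integrable _, Finset.mul_sum Finset.univ (fun α => p.2 α * _)]
            refine Finset.sum_congr rfl fun α _ => ?_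
            rw [integral_const_mul]
            have : ∫ W, Yv σ X W i α ∂(gaussianMat d m) = ∫ x, σ (√(∑ j, X j α ^ 2) * x) ∂(gaussianReal 0 1) := by
              rw [← lin_int _ hσc]
              exact row_int (d := d) i (F := fun w : Fin m → ℝ => σ (∑ j, w j * X j α)) (by fun_prop)
            rw [this]; ring
          have e2 : |∑ i, p.1 i| ≤ √d * 2 := by
            refine abs_le_of_sq_le_sq ?_ (by positivity)
            rw [mul_pow, Real.sq_sqrt (Nat.cast_nonneg _)]
            have := sq_sum_le_card_mul_sum_sq (s := Finset.univ) (f := fun i => p.1 i)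
            simp at this
            nlinarith [Nat.cast_nonneg (α := ℝ) d]
          have e3 : |∑ α, p.2 α * ∫ x, σ (√(∑ j, X j α ^ 2) * x) ∂(gaussianReal 0 1)| ≤ 2 * (l * gA * B) := by
            refine abs_le_of_sq_le_sq ?_ (by positivity)
            refine (Finset.sum_mul_sq_le_sq_mul_sq _ _ _).trans ?_
            have : ∑ α, (∫ x, σ (√(∑ j, X j α ^ 2) * x) ∂(gaussianReal 0 1)) ^ 2 ≤ (l * gA) ^ 2 * B ^ 2 := by
              refine le_trans ?_ (mul_le_mul_of_nonneg_left hX.2 (by positivity))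
              rw [Finset.mul_sum]
              refine Finset.sum_le_sum fun α _ => ?_
              have := lip_mean h hb (a := ∑ j, X j α ^ 2) (by positivity)
              rw [hmean, sub_zero] at this
              rw [← sq_abs, ← sq_abs ((∑ j, X j α ^ 2) - 1), ← mul_pow]
              exact pow_le_pow_left₀ (abs_nonneg _) this 2
            calc _ ≤ 4 * ((l * gA) ^ 2 * B ^ 2) := mul_le_mul h2' this (by positivity) (by norm_num)
              _ = _ := by ring
          rw [e1]
          refine (le_abs_self _).trans ?_
          rw [abs_mul, abs_mul, abs_of_nonneg (Real.sqrt_nonneg _)]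
          calc _ ≤ √d * (√d * 2) * (2 * (l * gA * B)) := by gcongr
            _ = (√d) ^ 2 * 4 * (l * gA * B) := by ring
            _ = _ := by rw [Real.sq_sqrt (Nat.cast_nonneg _)]; ring
        have hvar : ∑ i, ∑ α, (√d * p.1 i * p.2 α) ^ 2 ≤ 16 * d := by
          have : ∑ i, ∑ α, (√d * p.1 i * p.2 α) ^ 2 = d * ((∑ i, p.1 i ^ 2) * ∑ α, p.2 α ^ 2) := by
            rw [Finset.sum_mul_sum, Finset.mul_sum]
            refine Finset.sum_congr rfl fun i _ => ?_
            rw [Finset.mul_sum]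
            refine Finset.sum_congr rfl fun α _ => ?_
            rw [mul_pow, mul_pow, Real.sq_sqrt (Nat.cast_nonneg _)]; ring
          rw [this]
          have : (∑ i, p.1 i ^ 2) * ∑ α, p.2 α ^ 2 ≤ 4 * 4 := mul_le_mul h1' h2' (by positivity) (by norm_num)
          nlinarith [Nat.cast_nonneg (α := ℝ) d]
        have e4 : ∀ W : Fin d → Fin m → ℝ, ENNReal.ofReal (Real.exp (∑ i, ∑ α, (√d * p.1 i * p.2 α) * Yv σ X W i α)) =
            ENNReal.ofReal (Real.exp mu) * ENNReal.ofReal (Real.exp ((∑ i, ∑ α, (√d * p.1 i * p.2 α) * Yv σ X W i α) - mu)) := by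
          intro W
          rw [← ENNReal.ofReal_mul (Real.exp_nonneg _), ← Real.exp_add]; congr 2; ring
        simp_rw [e4]
        rw [lintegral_const_mul' _ _ ENNReal.ofReal_ne_top, ENNReal.ofReal_mul (Real.exp_nonneg _)]
        refine mul_le_mul' (ENNReal.ofReal_le_ofReal (Real.exp_le_exp.2 hmu1)) (hce.trans ?_)
        refine ENNReal.ofReal_le_ofReal (Real.exp_le_exp.2 ?_)
        have := hX.1
        have := opNorm_nonneg' X
        have := Real.pi_pos
        gcongr
    _ = ENNReal.ofReal (Real.exp (4 * d * (l * gA * B)) * Real.exp ((Real.pi / 2 * B * l) ^ 2 * (16 * d) / 2)) *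
          (ENNReal.ofReal (8 ^ d * 8 ^ n) * V) := by
        rw [setLIntegral_const]
        congr 1
        rw [Measure.prod_prod]
        have e := fun k : ℕ => Measure.addHaar_ball_mul_of_pos (volume : Measure (EuclideanSpace ℝ (Fin k))) 0 (r := 8) (by norm_num) (1/4)
        have e8 : (8 : ℝ) * (1/4) = 2 := by norm_num
        simp only [e8, finrank_euclideanSpace, Fintype.card_fin] at e
        rw [e, e, ENNReal.ofReal_mul (by positivity), hV]; ring
    _ ≤ _ := by
        rw [← mul_assoc, ← ENNReal.ofReal_mul (by positivity)]
        refine mul_le_mul' (ENNReal.ofReal_le_ofReal ?_) le_rfl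
        have e8 : ∀ k : ℕ, (8 : ℝ) ^ k = Real.exp (Real.log 8 * k) := fun k => by
          rw [mul_comm, Real.exp_nat_mul, Real.exp_log (by norm_num)]
        rw [e8, e8, ← Real.exp_add, ← Real.exp_add, ← Real.exp_add, abs_of_nonneg hB]
        refine Real.exp_le_exp.2 ?_
        have : 0 ≤ (4 * (l * gA * B) + 8 * (Real.pi / 2 * B * l) ^ 2) * n := by positivity
        nlinarith
end

section
open scoped ENNReal NNReal
section
open scoped Matrix.Norms.L2Operator
lemma opNorm_mul' {k m n : ℕ} (A : Matrix (Fin k) (Fin m) ℝ) (C : Matrix (Fin m) (Fin n) ℝ) :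
    opNorm (A * C) ≤ opNorm A * opNorm C := Matrix.l2_opNorm_mul A C
lemma opNorm_TT {m n : ℕ} (A : Matrix (Fin m) (Fin n) ℝ) : opNorm (Aᵀ * A) = opNorm A * opNorm A := 
  Matrix.l2_opNorm_conjTranspose_mul_self A
lemma opNorm_add' {m n : ℕ} (A C : Matrix (Fin m) (Fin n) ℝ) :
    opNorm (A + C) ≤ opNorm A + opNorm C := norm_add_le A C
lemma opNorm_smul' {m n : ℕ} (c : ℝ) (A : Matrix (Fin m) (Fin n) ℝ) :
    opNorm (c • A) = |c| * opNorm A := norm_smul c A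
lemma opNorm_one' {n : ℕ} : opNorm (1 : Matrix (Fin n) (Fin n) ℝ) ≤ 1 :=
  opNorm_le_of _ zero_le_one fun v => by
    have := fun j => congrFun (Matrix.one_mulVec v) j
    simp only [Matrix.mulVec, dotProduct] at this
    simp [this]
end

variable {n : ℕ}

lemma dot_self_nonneg' (v : Fin n → ℝ) : 0 ≤ v ⬝ᵥ v := Finset.sum_nonneg fun i _ => mul_self_nonneg _

lemma dot_cs (u v : Fin n → ℝ) : (u ⬝ᵥ v) ^ 2 ≤ (u ⬝ᵥ u) * (v ⬝ᵥ v) := by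
  have := Finset.sum_mul_sq_le_sq_mul_sq Finset.univ u v
  simpa only [dotProduct, pow_two] using this

lemma quad_le_opNorm (A : Matrix (Fin n) (Fin n) ℝ) (v : Fin n → ℝ) : |v ⬝ᵥ (A *ᵥ v)| ≤ opNorm A * (v ⬝ᵥ v) := by
  have h0 := dot_self_nonneg' v
  have h1 := opNorm_nonneg' A
  refine abs_le_of_sq_le_sq ?_ (by positivity)
  have h := opNorm_mulVec_sq A v
  refine (dot_cs _ _).trans ?_
  calc _ ≤ (v ⬝ᵥ v) * (opNorm A ^ 2 * (v ⬝ᵥ v)) := by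
        refine mul_le_mul_of_nonneg_left ?_ h0
        simpa only [dotProduct, Matrix.mulVec, pow_two] using h
    _ = _ := by ring

lemma col_sq_le (A : Matrix (Fin n) (Fin n) ℝ) (β : Fin n) : ∑ α, A α β ^ 2 ≤ opNorm A ^ 2 := by
  have := opNorm_mulVec_sq A (Pi.single β 1)
  simpa [Pi.single_apply] using this

lemma abs_trace_le (A : Matrix (Fin n) (Fin n) ℝ) : |A.trace| ≤ n * opNorm A := by
  refine (Finset.abs_sum_le_sum_abs _ _).trans ?_
  have : ∀ i ∈ Finset.univ, |A.diag i| ≤ opNorm A := fun i _ => by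
    refine abs_le_of_sq_le_sq ?_ (opNorm_nonneg' A)
    exact (Finset.single_le_sum (f := fun α => A α i ^ 2) (fun _ _ => sq_nonneg _) (Finset.mem_univ i)).trans (col_sq_le A i)
  refine (Finset.sum_le_sum this).trans ?_
  simp

lemma frob_le (A : Matrix (Fin n) (Fin n) ℝ) : ∑ α, ∑ β, A α β ^ 2 ≤ n * opNorm A ^ 2 := by
  rw [Finset.sum_comm]
  refine (Finset.sum_le_sum fun β _ => col_sq_le A β).trans ?_
  simp

def Psd (K : Matrix (Fin n) (Fin n) ℝ) : Prop := ∀ v : Fin n → ℝ, 0 ≤ v ⬝ᵥ (K *ᵥ v)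

noncomputable def res (K : Matrix (Fin n) (Fin n) ℝ) (y : ℝ) : Matrix (Fin n) (Fin n) ℝ := (K + y • (1 : Matrix (Fin n) (Fin n) ℝ))⁻¹

lemma Psd.low {K : Matrix (Fin n) (Fin n) ℝ} (hK : Psd K) (y : ℝ) (v : Fin n → ℝ) :
    y * (v ⬝ᵥ v) ≤ v ⬝ᵥ ((K + y • (1 : Matrix (Fin n) (Fin n) ℝ)) *ᵥ v) := by
  rw [Matrix.add_mulVec, dotProduct_add, Matrix.smul_mulVec, Matrix.one_mulVec, dotProduct_smul, smul_eq_mul]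
  linarith [hK v]

lemma Psd.unit {K : Matrix (Fin n) (Fin n) ℝ} (hK : Psd K) {y : ℝ} (hy : 0 < y) :
    IsUnit (K + y • (1 : Matrix (Fin n) (Fin n) ℝ)).det := by
  rw [isUnit_iff_ne_zero]
  intro h
  obtain ⟨v, hv, h0⟩ := Matrix.exists_mulVec_eq_zero_iff.2 h
  have := hK.low y v
  rw [h0, dotProduct_zero] at this
  have h1 : v ⬝ᵥ v = 0 := le_antisymm (by nlinarith [dot_self_nonneg' v]) (dot_self_nonneg' v)
  exact hv (dotProduct_self_eq_zero.1 h1)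

lemma Psd.mul_res {K : Matrix (Fin n) (Fin n) ℝ} (hK : Psd K) {y : ℝ} (hy : 0 < y) :
    (K + y • (1 : Matrix (Fin n) (Fin n) ℝ)) * res K y = 1 := Matrix.mul_nonsing_inv _ (hK.unit hy)

lemma Psd.res_mul {K : Matrix (Fin n) (Fin n) ℝ} (hK : Psd K) {y : ℝ} (hy : 0 < y) :
    res K y * (K + y • (1 : Matrix (Fin n) (Fin n) ℝ)) = 1 := Matrix.nonsing_inv_mul _ (hK.unit hy)

lemma Psd.res_vec {K : Matrix (Fin n) (Fin n) ℝ} (hK : Psd K) {y : ℝ} (hy : 0 < y) (v : Fin n → ℝ) :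
    y * ((res K y *ᵥ v) ⬝ᵥ (res K y *ᵥ v)) ≤ (res K y *ᵥ v) ⬝ᵥ v := by
  have := hK.low y (res K y *ᵥ v)
  rwa [Matrix.mulVec_mulVec, hK.mul_res hy, Matrix.one_mulVec] at this

lemma Psd.opNorm_res {K : Matrix (Fin n) (Fin n) ℝ} (hK : Psd K) {y : ℝ} (hy : 0 < y) : opNorm (res K y) ≤ 1 / y := by
  refine opNorm_le_of _ (by positivity) fun v => ?_
  have h1 := hK.res_vec hy v
  have h2 := dot_cs (res K y *ᵥ v) v
  set w := res K y *ᵥ v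
  have e1 : ∑ j, (∑ α, res K y j α * v α) ^ 2 = w ⬝ᵥ w := by
    simp only [dotProduct, pow_two]; rfl
  have e2 : ∑ j, v j ^ 2 = v ⬝ᵥ v := by simp only [dotProduct, pow_two]
  rw [e1, e2, div_pow, one_pow, one_div_mul_eq_div, le_div_iff₀ (by positivity)]
  have h0 := dot_self_nonneg' w
  rcases h0.eq_or_lt with h | h
  · rw [← h, zero_mul]; exact dot_self_nonneg' v
  · have h3 : (y * (w ⬝ᵥ w)) ^ 2 ≤ (w ⬝ᵥ w) * (v ⬝ᵥ v) := (pow_le_pow_left₀ (by positivity) h1 2).trans h2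
    refine le_of_mul_le_mul_left ?_ h
    calc _ = (y * (w ⬝ᵥ w)) ^ 2 := by ring
      _ ≤ _ := h3

noncomputable def cvM {d : ℕ} (Y : Fin d → Fin n → ℝ) : Matrix (Fin n) (Fin n) ℝ := Matrix.of (cvY Y)

lemma trace_cv {d : ℕ} (Y : Fin d → Fin n → ℝ) (A : Matrix (Fin n) (Fin n) ℝ) :
    (A * cvM Y).trace = (d : ℝ)⁻¹ * ∑ i, Y i ⬝ᵥ (A *ᵥ Y i) := by
  simp only [Matrix.trace, Matrix.diag, Matrix.mul_apply, cvM, Matrix.of_apply, cvY, dotProduct, Matrix.mulVec, Finset.mul_sum]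
  have : ∀ α, ∑ β, ∑ i, A α β * ((d : ℝ)⁻¹ * (Y i β * Y i α)) = ∑ i, ∑ β, A α β * ((d : ℝ)⁻¹ * (Y i β * Y i α)) := fun α => Finset.sum_comm
  simp only [this]
  rw [Finset.sum_comm]
  refine Finset.sum_congr rfl fun i _ => Finset.sum_congr rfl fun α _ => Finset.sum_congr rfl fun β _ => by ring

lemma Psd_cv {d : ℕ} (Y : Fin d → Fin n → ℝ) : Psd (cvM Y) := by
  intro v
  have : v ⬝ᵥ (cvM Y *ᵥ v) = (d : ℝ)⁻¹ * ∑ i, (Y i ⬝ᵥ v) ^ 2 := by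
    have h := trace_cv Y (vecMulVec v v)
    have h2 : (vecMulVec v v * cvM Y).trace = v ⬝ᵥ (cvM Y *ᵥ v) := by
      simp only [Matrix.trace, Matrix.diag, Matrix.mul_apply, vecMulVec_apply, dotProduct, Matrix.mulVec, Finset.mul_sum]
      refine Finset.sum_congr rfl fun i _ => Finset.sum_congr rfl fun j _ => ?_
      have : cvM Y j i = cvM Y i j := by simp [cvM, cvY, mul_comm]
      rw [this]; ring
    rw [← h2, h]
    congr 1
    refine Finset.sum_congr rfl fun i _ => ?_
    rw [Matrix.vecMulVec_mulVec, pow_two, dotProduct_comm v]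
    simp [dotProduct_smul, mul_comm]
  rw [this]; positivity

lemma cv_split {d : ℕ} (Y : Fin d → Fin n → ℝ) (i : Fin d) :
    cvM Y = cvM (Function.update Y i 0) + (d : ℝ)⁻¹ • vecMulVec (Y i) (Y i) := by
  ext α β
  simp only [cvM, Matrix.of_apply, cvY, Matrix.add_apply, Matrix.smul_apply, vecMulVec_apply, smul_eq_mul, ← mul_add]
  congr 1
  rw [← Finset.add_sum_erase _ _ (Finset.mem_univ i), ← Finset.add_sum_erase _ (fun k => Function.update Y i 0 k α * Function.update Y i 0 k β) (Finset.mem_univ i)]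
  have : ∑ k ∈ Finset.univ.erase i, Function.update Y i 0 k α * Function.update Y i 0 k β = ∑ k ∈ Finset.univ.erase i, Y k α * Y k β := by
    refine Finset.sum_congr rfl fun k hk => ?_
    rw [Function.update_of_ne (Finset.ne_of_mem_erase hk)]
  rw [this]; simp

noncomputable def eI {d : ℕ} (Φ H : Matrix (Fin n) (Fin n) ℝ) (y : ℝ) (Y : Fin d → Fin n → ℝ) (i : Fin d) : ℝ :=
  Y i ⬝ᵥ ((H * res (cvM (Function.update Y i 0)) y) *ᵥ Y i) - (Φ * (H * res (cvM (Function.update Y i 0)) y)).trace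

lemma resolvent_main {d : ℕ} (hd : 0 < d) (Y : Fin d → Fin n → ℝ) (Φ : Matrix (Fin n) (Fin n) ℝ) (hΦ : Psd Φ) {M y s : ℝ}
    (hM : opNorm Φ ≤ M) (hy : 0 < y) (hs : 0 ≤ s) :
    |(res (cvM Y) y).trace - (res (s • Φ) y).trace| ≤
      |s - (1 - n / d + y / d * (res (cvM Y) y).trace)| * (n * (M / y ^ 2)) +
      (d : ℝ)⁻¹ * ∑ i, |eI Φ (res (s • Φ) y) y Y i| + M / y ^ 2 := by
  have hdR : (0 : ℝ) < d := by exact_mod_cast hd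
  have hM0 : 0 ≤ M := (opNorm_nonneg' Φ).trans hM
  have hsΦ : Psd (s • Φ) := fun v => by
    rw [Matrix.smul_mulVec, dotProduct_smul, smul_eq_mul]; exact mul_nonneg hs (hΦ v)
  set H := res (s • Φ) y
  set G := res (cvM Y) y
  set Gi : Fin d → Matrix (Fin n) (Fin n) ℝ := fun i => res (cvM (Function.update Y i 0)) y
  set q : Fin d → ℝ := fun i => Y i ⬝ᵥ (Gi i *ᵥ Y i)
  have hKi : ∀ i, Psd (cvM (Function.update Y i 0)) := fun i => Psd_cv _
  have hK : Psd (cvM Y) := Psd_cv _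
  have hGG : G * (cvM Y + y • (1 : Matrix (Fin n) (Fin n) ℝ)) = 1 := hK.res_mul hy
  have hHH : (s • Φ + y • (1 : Matrix (Fin n) (Fin n) ℝ)) * H = 1 := hsΦ.mul_res hy
  have hGi : ∀ i, (cvM (Function.update Y i 0) + y • (1 : Matrix (Fin n) (Fin n) ℝ)) * Gi i = 1 := fun i => (hKi i).mul_res hy
  have hspl : ∀ i, cvM Y + y • (1 : Matrix (Fin n) (Fin n) ℝ) = (cvM (Function.update Y i 0) + y • (1 : Matrix (Fin n) (Fin n) ℝ)) + (d : ℝ)⁻¹ • vecMulVec (Y i) (Y i) := fun i => by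
    rw [cv_split Y i]; abel
  have hw : ∀ i, y * ((Gi i *ᵥ Y i) ⬝ᵥ (Gi i *ᵥ Y i)) ≤ q i := fun i => by
    have := (hKi i).res_vec hy (Y i)
    rwa [dotProduct_comm (Gi i *ᵥ Y i) (Y i)] at this
  have hq0 : ∀ i, 0 ≤ q i := fun i => le_trans (mul_nonneg hy.le (dot_self_nonneg' _)) (hw i)
  have hp : ∀ i, 0 < 1 + q i / d := fun i => by have := hq0 i; positivity
  set a : Fin d → ℝ := fun i => (1 + q i / d)⁻¹
  have ha0 : ∀ i, 0 < a i := fun i => inv_pos.2 (hp i)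
  have ha1 : ∀ i, a i ≤ 1 := fun i => by
    have := hq0 i
    exact inv_le_one_of_one_le₀ (le_add_of_nonneg_right (by positivity))
  have haq : ∀ i, a i * q i / d = 1 - a i := fun i => by
    have e : a i * (1 + q i / d) = 1 := inv_mul_cancel₀ (hp i).ne'
    rw [mul_div_assoc]; linarith
  -- difference of resolvents
  have hdiff : ∀ i, Gi i - G = (d : ℝ)⁻¹ • (G * vecMulVec (Y i) (Y i) * Gi i) := fun i => by
    have h1 : G * (cvM Y + y • (1 : Matrix (Fin n) (Fin n) ℝ)) * Gi i = Gi i := by rw [hGG, one_mul]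
    rw [hspl i, mul_add, add_mul, mul_assoc, hGi i, mul_one] at h1
    rw [sub_eq_iff_eq_add', ← Matrix.smul_mul, ← Matrix.mul_smul, h1]
  have hGy : ∀ i, G *ᵥ Y i = a i • (Gi i *ᵥ Y i) := fun i => by
    have h1 : G *ᵥ ((cvM Y + y • (1 : Matrix (Fin n) (Fin n) ℝ)) *ᵥ (Gi i *ᵥ Y i)) = Gi i *ᵥ Y i := by
      rw [Matrix.mulVec_mulVec, hGG, Matrix.one_mulVec]
    have h2 : (cvM Y + y • (1 : Matrix (Fin n) (Fin n) ℝ)) *ᵥ (Gi i *ᵥ Y i) = (1 + q i / d) • Y i := by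
      rw [hspl i, Matrix.add_mulVec, Matrix.mulVec_mulVec, hGi i, Matrix.one_mulVec, Matrix.smul_mulVec,
        Matrix.vecMulVec_mulVec, add_smul, one_smul]
      congr 1
      ext j
      simp [q]
      ring
    rw [h2, Matrix.mulVec_smul] at h1
    rw [← h1, smul_smul, inv_mul_cancel₀ (hp i).ne', one_smul]
  -- trace identity
  have htr1 : ∑ i, (1 - a i) = n - y * G.trace := by
    have h1 : (G * (cvM Y + y • (1 : Matrix (Fin n) (Fin n) ℝ))).trace = n := by rw [hGG]; simp
    rw [mul_add, Matrix.trace_add, trace_cv] at h1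
    have h2 : (d : ℝ)⁻¹ * ∑ i, Y i ⬝ᵥ G *ᵥ Y i = ∑ i, (1 - a i) := by
      rw [Finset.mul_sum]
      refine Finset.sum_congr rfl fun i _ => ?_
      rw [hGy, dotProduct_smul, ← haq, smul_eq_mul]
      ring
    rw [h2, Matrix.mul_smul, mul_one, Matrix.trace_smul, smul_eq_mul] at h1
    linarith
  have hasum : (d : ℝ)⁻¹ * ∑ i, a i = 1 - n / d + y / d * G.trace := by
    simp at htr1
    have : ∑ i, a i = d - n + y * G.trace := by linarith
    rw [this]; field_simp
  have hdec : G.trace - H.trace = (s - (d : ℝ)⁻¹ * ∑ i, a i) * (Φ * H * G).trace -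
      (d : ℝ)⁻¹ * ∑ i, a i * eI Φ H y Y i - (d : ℝ)⁻¹ * ∑ i, a i * (Φ * H * (Gi i - G)).trace := by
    have h1 : G - H = G * (s • Φ) * H - G * cvM Y * H := by
      have e1 : G * ((s • Φ + y • (1 : Matrix (Fin n) (Fin n) ℝ)) * H) = G := by rw [hHH, mul_one]
      have e2 : G * (cvM Y + y • (1 : Matrix (Fin n) (Fin n) ℝ)) * H = H := by rw [hGG, one_mul]
      calc G - H = G * ((s • Φ + y • (1 : Matrix (Fin n) (Fin n) ℝ)) * H) - G * (cvM Y + y • (1 : Matrix (Fin n) (Fin n) ℝ)) * H := by rw [e1, e2]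
        _ = _ := by
          simp only [mul_add, add_mul, mul_assoc, Matrix.smul_mul, Matrix.mul_smul, one_mul]
          abel
    have h2 : (G * (s • Φ) * H).trace = s * (Φ * H * G).trace := by
      rw [mul_assoc, Matrix.trace_mul_comm]; simp
    have h3 : (G * cvM Y * H).trace = (d : ℝ)⁻¹ * ∑ i, a i * (eI Φ H y Y i + ((Φ * H * (Gi i - G)).trace + (Φ * H * G).trace)) := by
      rw [Matrix.trace_mul_comm, ← mul_assoc, trace_cv]
      congr 1
      refine Finset.sum_congr rfl fun i _ => ?_
      rw [← Matrix.mulVec_mulVec, hGy, Matrix.mulVec_smul, dotProduct_smul, smul_eq_mul, mul_sub (Φ * H), Matrix.trace_sub, eI, mul_assoc Φ H, Matrix.mulVec_mulVec]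
      congr 1
      simp only [Gi]
      ring
    rw [← Matrix.trace_sub, h1, Matrix.trace_sub, h2, h3]
    simp only [mul_add, Finset.sum_add_distrib, ← Finset.sum_mul]
    ring
  have hΦH : opNorm (Φ * H) ≤ M / y := by
    refine (opNorm_mul' _ _).trans ?_
    rw [div_eq_mul_one_div]
    exact mul_le_mul hM (hsΦ.opNorm_res hy) (opNorm_nonneg' _) hM0
  have b1 : |(Φ * H * G).trace| ≤ n * (M / y ^ 2) := by
    refine (abs_trace_le _).trans (mul_le_mul_of_nonneg_left ?_ (Nat.cast_nonneg _))
    refine (opNorm_mul' _ _).trans ?_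
    calc _ ≤ M / y * (1 / y) := mul_le_mul hΦH (hK.opNorm_res hy) (opNorm_nonneg' _) (by positivity)
      _ = _ := by field_simp
  have hsym : ∀ i, (Gi i)ᵀ = Gi i := fun i => by
    simp only [Gi, res, Matrix.transpose_nonsing_inv]
    congr 1
    ext α β
    simp only [Matrix.transpose_apply, Matrix.add_apply, cvM, Matrix.of_apply, cvY, mul_comm, Matrix.smul_apply, Matrix.one_apply, eq_comm]
  have b2 : ∀ i, |(Φ * H * (Gi i - G)).trace| ≤ M / y ^ 2 := fun i => by
    rw [hdiff i, Matrix.mul_smul, Matrix.trace_smul, smul_eq_mul]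
    have e : (Φ * H * (G * vecMulVec (Y i) (Y i) * Gi i)).trace = a i * ((Gi i *ᵥ Y i) ⬝ᵥ ((Φ * H)  *ᵥ (Gi i *ᵥ Y i))) := by
      rw [Matrix.mul_vecMulVec, Matrix.vecMulVec_mul, Matrix.mul_vecMulVec, Matrix.trace_vecMulVec, hGy,
        ← Matrix.mulVec_transpose, hsym, Matrix.mulVec_smul, dotProduct_comm, dotProduct_smul, smul_eq_mul]
    rw [e, abs_mul, abs_mul, abs_of_pos (ha0 i), abs_of_pos (inv_pos.2 hdR)]
    calc _ ≤ (d : ℝ)⁻¹ * (a i * (M / y * (q i / y))) := by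
          have := ha0 i
          gcongr
          refine (quad_le_opNorm _ _).trans (mul_le_mul hΦH ?_ (dot_self_nonneg' _) (by positivity))
          rw [le_div_iff₀ hy, mul_comm]; exact hw i
      _ = M / y ^ 2 * (a i * q i / d) := by field_simp
      _ ≤ M / y ^ 2 * 1 := by
          rw [haq]
          have := ha0 i
          gcongr
          linarith
      _ = _ := mul_one _
  rw [hdec]
  refine (abs_sub _ _).trans (add_le_add ((abs_sub _ _).trans (add_le_add ?_ ?_)) ?_)
  · rw [abs_mul, hasum]
    exact mul_le_mul_of_nonneg_left b1 (abs_nonneg _)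
  · rw [abs_mul, abs_of_pos (inv_pos.2 hdR)]
    refine mul_le_mul_of_nonneg_left ((Finset.abs_sum_le_sum_abs _ _).trans (Finset.sum_le_sum fun i _ => ?_)) (by positivity)
    rw [abs_mul, abs_of_pos (ha0 i)]
    exact mul_le_of_le_one_left (abs_nonneg _) (ha1 i)
  · rw [abs_mul, abs_of_pos (inv_pos.2 hdR)]
    have : |∑ i, a i * (Φ * H * (Gi i - G)).trace| ≤ d * (M / y ^ 2) := by
      refine (Finset.abs_sum_le_sum_abs _ _).trans ?_
      have : ∀ i ∈ Finset.univ, |a i * (Φ * H * (Gi i - G)).trace| ≤ M / y ^ 2 := fun i _ => by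
        rw [abs_mul, abs_of_pos (ha0 i)]
        exact (mul_le_of_le_one_left (abs_nonneg _) (ha1 i)).trans (b2 i)
      refine (Finset.sum_le_sum this).trans ?_
      simp
    calc _ ≤ (d : ℝ)⁻¹ * (d * (M / y ^ 2)) := mul_le_mul_of_nonneg_left this (by positivity)
      _ = _ := by field_simp
end

section
open scoped ENNReal NNReal
lemma resample {ι : Type*} [Fintype ι] [DecidableEq ι] {E : ι → Type*} [∀ i, MeasurableSpace (E i)] (μ : ∀ i, Measure (E i))
    [∀ i, IsProbabilityMeasure (μ i)] (i : ι) :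
    MeasurePreserving (fun p : (∀ i, E i) × (∀ i, E i) => Function.update p.1 i (p.2 i))
      ((Measure.pi μ).prod (Measure.pi μ)) (Measure.pi μ) := by
  have hm : Measurable (fun p : (∀ i, E i) × (∀ i, E i) => Function.update p.1 i (p.2 i)) := by
    refine measurable_pi_lambda _ fun j => ?_
    by_cases hj : j = i
    · subst hj; simp; fun_prop
    · simp [hj]; fun_prop
  refine ⟨hm, (Measure.pi_eq fun s hs => ?_).symm⟩
  rw [Measure.map_apply hm (MeasurableSet.univ_pi hs)]
  have : (fun p : (∀ i, E i) × (∀ i, E i) => Function.update p.1 i (p.2 i)) ⁻¹' Set.univ.pi s =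
      (Set.univ.pi (Function.update s i Set.univ)) ×ˢ (Function.eval i ⁻¹' s i) := by
    ext p
    simp only [Set.mem_preimage, Set.mem_pi, Set.mem_univ, true_imp_iff, Set.mem_prod, Function.eval]
    constructor
    · intro h
      refine ⟨fun j => ?_, by simpa using h i⟩
      by_cases hj : j = i
      · subst hj; simp
      · simpa [hj] using h j
    · rintro ⟨h1, h2⟩ j
      by_cases hj : j = i
      · subst hj; simpa using h2
      · simpa [hj] using h1 j
  rw [this, Measure.prod_prod, Measure.pi_pi, (measurePreserving_eval μ i).measure_preimage (hs i).nullMeasurableSet,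
    ← Finset.mul_prod_erase _ _ (Finset.mem_univ i), ← Finset.mul_prod_erase _ (fun j => μ j (s j)) (Finset.mem_univ i)]
  have : ∏ j ∈ Finset.univ.erase i, μ j (Function.update s i Set.univ j) = ∏ j ∈ Finset.univ.erase i, μ j (s j) :=
    Finset.prod_congr rfl fun j hj => by rw [Function.update_of_ne (Finset.ne_of_mem_erase hj)]
  rw [this]
  simp [mul_comm]

lemma lint_resample {ι : Type*} [Fintype ι] [DecidableEq ι] {E : ι → Type*} [∀ i, MeasurableSpace (E i)] (μ : ∀ i, Measure (E i))
    [∀ i, IsProbabilityMeasure (μ i)] (i : ι) {f : (∀ i, E i) → ℝ≥0∞} (hf : Measurable f) {c : ℝ≥0∞}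
    (h : ∀ p, ∫⁻ q, f (Function.update p i (q i)) ∂(Measure.pi μ) ≤ c) : ∫⁻ p, f p ∂(Measure.pi μ) ≤ c := by
  have hr := resample μ i
  rw [← hr.lintegral_comp hf]
  have e := lintegral_prod (μ := Measure.pi μ) (ν := Measure.pi μ) _ (hf.comp hr.measurable).aemeasurable
  simp only [Function.comp] at e
  rw [e]
  refine (lintegral_mono h).trans ?_
  simp

/-- measurable family of matrices -/
def MM {S : Type*} [MeasurableSpace S] {m n : ℕ} (A : S → Matrix (Fin m) (Fin n) ℝ) : Prop := ∀ i j, Measurable fun x => A x i j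

section
variable {S : Type*} [MeasurableSpace S] {k m n : ℕ}
lemma MM.mul {A : S → Matrix (Fin k) (Fin m) ℝ} {C : S → Matrix (Fin m) (Fin n) ℝ} (hA : MM A) (hC : MM C) :
    MM fun x => A x * C x := fun i j => by
  simp only [Matrix.mul_apply]
  exact Finset.measurable_fun_sum _ fun l _ => (hA i l).mul (hC l j)
lemma MM.add {A C : S → Matrix (Fin m) (Fin n) ℝ} (hA : MM A) (hC : MM C) : MM fun x => A x + C x :=
  fun i j => (hA i j).add (hC i j)
lemma MM.smul {A : S → Matrix (Fin m) (Fin n) ℝ} (hA : MM A) (c : ℝ) : MM fun x => c • A x :=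
  fun i j => (hA i j).const_mul c
lemma MM.const (A : Matrix (Fin m) (Fin n) ℝ) : MM fun _ : S => A := fun _ _ => measurable_const
lemma MM.det {A : S → Matrix (Fin n) (Fin n) ℝ} (hA : MM A) : Measurable fun x => (A x).det := by
  simp only [Matrix.det_apply, zsmul_eq_mul, Units.smul_def]
  exact Finset.measurable_fun_sum _ fun l _ => (Finset.measurable_fun_prod _ fun i _ => hA _ _).const_mul _
lemma MM.inv {A : S → Matrix (Fin n) (Fin n) ℝ} (hA : MM A) : MM fun x => (A x)⁻¹ := fun i j => by
  simp only [Matrix.inv_def, Ring.inverse_eq_inv', Matrix.smul_apply, smul_eq_mul, Matrix.adjugate_apply]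
  refine hA.det.inv.mul (MM.det fun a b => ?_)
  by_cases h : a = j
  · subst h; simp
  · simp only [Matrix.updateRow_apply, h, if_false]; exact hA a b
lemma MM.res {A : S → Matrix (Fin n) (Fin n) ℝ} (hA : MM A) (y : ℝ) : MM fun x => res (A x) y :=
  (hA.add (MM.const _)).inv
lemma MM.trace {A : S → Matrix (Fin n) (Fin n) ℝ} (hA : MM A) : Measurable fun x => (A x).trace :=
  Finset.measurable_fun_sum _ fun i _ => hA i i
lemma MM.quad {A : S → Matrix (Fin n) (Fin n) ℝ} (hA : MM A) {v : S → Fin n → ℝ} (hv : ∀ j, Measurable fun x => v x j) :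
    Measurable fun x => v x ⬝ᵥ (A x *ᵥ v x) := by
  simp only [dotProduct, Matrix.mulVec]
  exact Finset.measurable_fun_sum _ fun i _ => (hv i).mul (Finset.measurable_fun_sum _ fun j _ => (hA i j).mul (hv j))
lemma MM.cvM {d : ℕ} {Y : S → Fin d → Fin n → ℝ} (hY : ∀ i α, Measurable fun x => Y x i α) : MM fun x => cvM (Y x) :=
  fun α β => (Finset.measurable_fun_sum _ fun i _ => (hY i α).mul (hY i β)).const_mul _
lemma MM.upd {d : ℕ} {Y : S → Fin d → Fin n → ℝ} (hY : ∀ i α, Measurable fun x => Y x i α) (k : Fin d) (i : Fin d) (α : Fin n) :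
    Measurable fun x => Function.update (Y x) k 0 i α := by
  by_cases h : i = k
  · subst h; simp
  · simp only [Function.update_of_ne h]; exact hY i α
end

/-- linearised kernel -/
noncomputable def phit {m n : ℕ} (b : ℝ) (X : Matrix (Fin m) (Fin n) ℝ) : Matrix (Fin n) (Fin n) ℝ :=
  (1 - b ^ 2) • (1 : Matrix (Fin n) (Fin n) ℝ) + b ^ 2 • (Xᵀ * X)

lemma phit_apply {m n : ℕ} (b : ℝ) (X : Matrix (Fin m) (Fin n) ℝ) (α β : Fin n) :
    phit b X α β = (if α = β then 1 - b ^ 2 else 0) + b ^ 2 * ∑ j, X j α * X j β := by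
  simp [phit, Matrix.mul_apply, Matrix.one_apply]

lemma MM.phit {S : Type*} [MeasurableSpace S] {m n : ℕ} (b : ℝ) {X : S → Matrix (Fin m) (Fin n) ℝ} (hX : MM X) :
    MM fun x => phit b (X x) := by
  have h1 : MM fun x => (X x)ᵀ := fun i j => hX j i
  exact (MM.const _).add ((h1.mul hX).smul _)

lemma Psd_TT {m n : ℕ} (X : Matrix (Fin m) (Fin n) ℝ) : Psd (Xᵀ * X) := fun v => by
  rw [← Matrix.mulVec_mulVec, Matrix.dotProduct_mulVec, Matrix.vecMul_transpose]
  exact dot_self_nonneg' _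

lemma Psd_phit {m n : ℕ} {b : ℝ} (hb : b ^ 2 ≤ 1) (X : Matrix (Fin m) (Fin n) ℝ) : Psd (phit b X) := fun v => by
  rw [phit, Matrix.add_mulVec, Matrix.smul_mulVec, Matrix.smul_mulVec, Matrix.one_mulVec, dotProduct_add, dotProduct_smul,
    dotProduct_smul, smul_eq_mul, smul_eq_mul]
  have := dot_self_nonneg' v
  have := Psd_TT X v
  have : 0 ≤ 1 - b ^ 2 := by linarith
  positivity

lemma opNorm_phit {m n : ℕ} {b B : ℝ} (hb : b ^ 2 ≤ 1) (X : Matrix (Fin m) (Fin n) ℝ) (hX : opNorm X ≤ B) :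
    opNorm (phit b X) ≤ 1 + B ^ 2 := by
  refine (opNorm_add' _ _).trans ?_
  rw [opNorm_smul', opNorm_smul', opNorm_TT, abs_of_nonneg (by linarith), abs_of_nonneg (by positivity)]
  have h1 := opNorm_one' (n := n)
  have h0 := opNorm_nonneg' X
  have h2 : opNorm X * opNorm X ≤ B ^ 2 := by nlinarith
  have h3 := opNorm_nonneg' (1 : Matrix (Fin n) (Fin n) ℝ)
  have := sq_nonneg b
  have e1 : (1 - b ^ 2) * opNorm (1 : Matrix (Fin n) (Fin n) ℝ) ≤ 1 * 1 := mul_le_mul (by linarith) h1 h3 (by norm_num)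
  have e2 : b ^ 2 * (opNorm X * opNorm X) ≤ 1 * B ^ 2 := mul_le_mul hb h2 (by positivity) (by norm_num)
  linarith

variable {σ σ' σ'' : ℝ → ℝ} {l : ℝ}

/-- the truncated quadratic form fluctuation -/
noncomputable def Zq {d m n : ℕ} (b D y s : ℝ) (σ : ℝ → ℝ) (X : Matrix (Fin m) (Fin n) ℝ) (W : Fin d → Fin m → ℝ) : ℝ :=
  (d : ℝ)⁻¹ * ∑ i, (max (|eI (phit b X) (res (s • phit b X) y) y (Yv σ X W) i| - √(D * (1 + offd X)) * √n / y ^ 2) 0 / n) ^ 4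

lemma meas_eI {S : Type*} [MeasurableSpace S] {d m n : ℕ} (b y s : ℝ) (hσ : Continuous σ) {X : S → Matrix (Fin m) (Fin n) ℝ} (hX : MM X)
    {W : S → Fin d → Fin m → ℝ} (hW : ∀ i j, Measurable fun x => W x i j) (i : Fin d) :
    Measurable fun x => eI (phit b (X x)) (res (s • phit b (X x)) y) y (Yv σ (X x) (W x)) i := by
  have hY : ∀ i α, Measurable fun x => Yv σ (X x) (W x) i α := fun i α =>
    hσ.measurable.comp (Finset.measurable_fun_sum _ fun j _ => (hW i j).mul (hX j α))
  have hP := hX.phit b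
  have hA := ((hP.smul s).res y).mul ((MM.cvM (MM.upd hY i)).res y)
  exact (hA.quad (hY i)).sub (hP.mul hA).trace

lemma quad_final (h : ∀ x, HasDerivAt σ (σ' x) x) (h2 : ∀ x, HasDerivAt σ' (σ'' x) x)
    (hb : ∀ x, |σ' x| ≤ l) (hb2 : ∀ x, |σ'' x| ≤ l) (hmean : ∫ x, σ x ∂(gaussianReal 0 1) = 0)
    (hvar : ∫ x, σ x ^ 2 ∂(gaussianReal 0 1) = 1) (B : ℝ) :
    ∃ C D : ℝ, 0 ≤ C ∧ 0 ≤ D ∧ ∀ (d m n : ℕ) (X : Matrix (Fin m) (Fin n) ℝ), 0 < d → 0 < n → Good B X →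
      ∀ y s : ℝ, 0 < y → 0 ≤ s →
      ∫⁻ W, ENNReal.ofReal (Zq (∫ x, σ' x ∂(gaussianReal 0 1)) D y s σ X W) ∂(gaussianMat d m) ≤
        ENNReal.ofReal (C / y ^ 8 / (n : ℝ) ^ 2) := by
  have hc' : Continuous σ' := continuous_iff_continuousAt.2 fun x => (h2 x).continuousAt
  have hσc : Continuous σ := continuous_iff_continuousAt.2 fun x => (h x).continuousAt
  obtain ⟨C, hC, H⟩ := quad_conc h hc' hb B
  obtain ⟨D, hD, HD⟩ := frob_bound h h2 hb hb2 hmean hvar B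
  set b := ∫ x, σ' x ∂(gaussianReal 0 1) with hbdef
  have hb1 : b ^ 2 ≤ 1 := b_sq_le h hc' hb hvar
  refine ⟨C, D, hC, hD, fun d m n X hd hn hX y s hy hs => ?_⟩
  have hnR : (0 : ℝ) < n := by exact_mod_cast hn
  have hdR : (0 : ℝ) < d := by exact_mod_cast hd
  have hsP : Psd (s • phit b X) := fun v => by
    rw [Matrix.smul_mulVec, dotProduct_smul, smul_eq_mul]; exact mul_nonneg hs (Psd_phit hb1 X v)
  set t := √(D * (1 + offd X)) * √n / y ^ 2
  set Hm := res (s • phit b X) y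
  set E : Fin d → (Fin d → Fin m → ℝ) → ℝ := fun i W => eI (phit b X) Hm y (Yv σ X W) i
  have hE : ∀ i, Measurable (E i) := fun i => meas_eI (S := Fin d → Fin m → ℝ) b y s hσc (MM.const X) (W := fun W => W) (by fun_prop) i
  have key : ∀ i, ∫⁻ W, ENNReal.ofReal (max (|E i W| - t) 0 ^ 4) ∂(gaussianMat d m) ≤ ENNReal.ofReal (C * (1 / y ^ 2) ^ 4 * (n : ℝ) ^ 2) := by
    intro i
    refine lint_resample (fun _ : Fin d => gaussianVec m) i (by have := hE i; fun_prop) fun p => ?_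
    set A := Hm * res (cvM (Function.update (Yv σ X p) i 0)) y
    have hA : opNorm A ≤ 1 / y ^ 2 := by
      refine (opNorm_mul' _ _).trans ?_
      calc _ ≤ (1 / y) * (1 / y) := mul_le_mul (hsP.opNorm_res hy) ((Psd_cv _).opNorm_res hy) (opNorm_nonneg' _) (by positivity)
        _ = _ := by field_simp
    have hYe : ∀ q : Fin d → Fin m → ℝ, Function.update (Yv σ X (Function.update p i (q i))) i 0 = Function.update (Yv σ X p) i 0 := by
      intro q
      ext k α
      by_cases hk : k = i
      · subst hk; simp
      · simp [hk, Yv, pre]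
    have hYi : ∀ q : Fin d → Fin m → ℝ, Yv σ X (Function.update p i (q i)) i = Yv σ X q i := by
      intro q; ext α; simp [Yv, pre]
    have hEe : ∀ q : Fin d → Fin m → ℝ, E i (Function.update p i (q i)) = (∑ α, ∑ β, Yv σ X q i α * A α β * Yv σ X q i β) -
        ∑ α, ∑ β, A α β * phit b X α β := by
      intro q
      simp only [E, eI, hYe, hYi]
      congr 1
      · simp only [dotProduct, Matrix.mulVec, Finset.mul_sum, mul_assoc]
        rfl
      · rw [Matrix.trace_mul_comm]
        simp only [Matrix.trace, Matrix.diag]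
        refine Finset.sum_congr rfl fun α _ => ?_
        rw [Matrix.mul_apply]
        refine Finset.sum_congr rfl fun β _ => ?_
        have : phit b X β α = phit b X α β := by simp [phit_apply, eq_comm, mul_comm]
        rw [this]
    have hq : ∀ α β, PG (fun W : Fin d → Fin m → ℝ => Yv σ X W i α * A α β * Yv σ X W i β) := fun α β =>
      ((Yv_PG h hb X i α).mul (PG.const _)).mul (Yv_PG h hb X i β)
    refine lint_le (gaussianMat d m) (g := fun W => ((∑ α, ∑ β, Yv σ X W i α * A α β * Yv σ X W i β) -
        ∑ α, ∑ β, A α β * phi σ (fun j => X j α) (fun j => X j β)) ^ 4)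
      (((PG.sum _ fun α => PG.sum _ fun β => hq α β).sub (PG.const _)).pow 4) (fun q => ?_) (fun q => by positivity)
      ((H d m n X hX A i).trans ?_)
    · rw [hEe]
      set Q := ∑ α, ∑ β, Yv σ X q i α * A α β * Yv σ X q i β
      have hdiff : |(∑ α, ∑ β, A α β * phi σ (fun j => X j α) (fun j => X j β)) - ∑ α, ∑ β, A α β * phit b X α β| ≤ t := by
        rw [← Finset.sum_sub_distrib]
        simp only [← Finset.sum_sub_distrib, ← mul_sub]
        have hF := HD m n X hX
        simp only [← phit_apply] at hF
        refine abs_le_of_sq_le_sq ?_ (by positivity)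
        rw [← Fintype.sum_prod_type' (f := fun α β => A α β * (phi σ (fun j => X j α) (fun j => X j β) - phit b X α β))]
        refine (Finset.sum_mul_sq_le_sq_mul_sq _ _ _).trans ?_
        rw [Fintype.sum_prod_type, Fintype.sum_prod_type]
        have hoff : 0 ≤ offd X := Finset.sum_nonneg fun α _ => Finset.sum_nonneg fun β _ => by split_ifs <;> positivity
        simp only [t]
        rw [div_pow, mul_pow, Real.sq_sqrt (by positivity), Real.sq_sqrt (by positivity)]
        calc _ ≤ (n * (1 / y ^ 2) ^ 2) * (D * (1 + offd X)) :=
              mul_le_mul ((frob_le A).trans (by have := opNorm_nonneg' A; gcongr)) hF (by positivity) (by positivity)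
          _ = _ := by field_simp
      refine (pow_le_pow_left₀ (le_max_right _ _) (max_le ?_ (abs_nonneg (Q - ∑ α, ∑ β, A α β * phi σ (fun j => X j α) (fun j => X j β)))) 4).trans_eq ?_
      · rw [sub_le_iff_le_add]
        refine le_trans ?_ (add_le_add le_rfl hdiff)
        refine le_trans (le_of_eq ?_) (abs_add_le _ _)
        congr 1; ring
      · exact Even.pow_abs (by decide) _
    · have := opNorm_nonneg' A
      gcongr
  have e : ∀ W, ENNReal.ofReal (Zq b D y s σ X W) = ENNReal.ofReal ((d : ℝ)⁻¹ * ((n : ℝ)⁻¹) ^ 4) * ∑ i, ENNReal.ofReal (max (|E i W| - t) 0 ^ 4) := by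
    intro W
    rw [← ENNReal.ofReal_sum_of_nonneg (fun i _ => by positivity), ← ENNReal.ofReal_mul (by positivity)]
    change ENNReal.ofReal ((d : ℝ)⁻¹ * ∑ i, (max (|E i W| - t) 0 / n) ^ 4) = _
    congr 1
    simp only [div_pow, ← Finset.sum_div]
    rw [inv_pow]; ring
  simp_rw [e]
  rw [lintegral_const_mul _ (by have := hE; fun_prop), lintegral_finsetSum _ (fun i _ => by have := hE i; fun_prop)]
  calc _ ≤ ENNReal.ofReal ((d : ℝ)⁻¹ * ((n : ℝ)⁻¹) ^ 4) * ∑ i : Fin d, ENNReal.ofReal (C * (1 / y ^ 2) ^ 4 * (n : ℝ) ^ 2) :=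
        mul_le_mul' le_rfl (Finset.sum_le_sum fun i _ => key i)
    _ = _ := by
        rw [← ENNReal.ofReal_sum_of_nonneg (fun i _ => by positivity), ← ENNReal.ofReal_mul (by positivity)]
        congr 1
        simp
        field_simp
end

section
open scoped ENNReal NNReal
lemma cont_opNorm {m n : ℕ} : Continuous fun q : Fin m → Fin n → ℝ => opNorm (Matrix.of q) := by
  let T : (Fin m → Fin n → ℝ) →ₗ[ℝ] (EuclideanSpace ℝ (Fin n) →L[ℝ] EuclideanSpace ℝ (Fin m)) :=
    (LinearMap.toContinuousLinearMap.toLinearMap ∘ₗ (Matrix.toEuclideanLin (𝕜 := ℝ) (m := Fin m) (n := Fin n)).toLinearMap) ∘ₗ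
      (Matrix.ofLinearEquiv ℝ).toLinearMap
  have : Continuous T := T.continuous_of_finiteDimensional
  exact continuous_norm.comp this

section
variable {S : Type*} [MeasurableSpace S] {m n : ℕ} {X : S → Matrix (Fin m) (Fin n) ℝ}
lemma MM.toFun (hX : MM X) : Measurable fun x => (fun i j => X x i j : Fin m → Fin n → ℝ) :=
  measurable_pi_lambda _ fun i => measurable_pi_lambda _ fun j => hX i j
lemma MM.opNorm (hX : MM X) : Measurable fun x => opNorm (X x) := cont_opNorm.measurable.comp hX.toFun
lemma MM.good (hX : MM X) (B : ℝ) : MeasurableSet {x | Good B (X x)} := by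
  have e : {x | Good B (X x)} = {x | _root_.opNorm (X x) ≤ B} ∩ {x | ∑ α, ((∑ i, X x i α ^ 2) - 1) ^ 2 ≤ B ^ 2} := rfl
  rw [e]
  refine MeasurableSet.inter (measurableSet_le hX.opNorm measurable_const) (measurableSet_le ?_ measurable_const)
  refine Finset.measurable_fun_sum _ fun α _ => ((Finset.measurable_fun_sum _ fun i _ => (hX i α).pow_const 2).sub_const 1).pow_const 2
lemma MM.offd (hX : MM X) : Measurable fun x => offd (X x) := by
  refine Finset.measurable_fun_sum _ fun α _ => Finset.measurable_fun_sum _ fun β _ => ?_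
  split_ifs
  · exact measurable_const
  · exact (Finset.measurable_fun_sum _ fun i _ => (hX i α).mul (hX i β)).pow_const 4
lemma MM.Yv {d : ℕ} {σ : ℝ → ℝ} (hσ : Continuous σ) (hX : MM X) {W : S → Fin d → Fin m → ℝ}
    (hW : ∀ i j, Measurable fun x => W x i j) : ∀ i α, Measurable fun x => Yv σ (X x) (W x) i α := fun i α =>
    hσ.measurable.comp (Finset.measurable_fun_sum _ fun j _ => (hW i j).mul (hX j α))
end

lemma netLayer_congr (σ : ℝ → ℝ) (d : ℕ → ℕ) (n : ℕ) {W W' : (ℓ : ℕ) → Fin (d (ℓ + 1)) → Fin (d ℓ) → ℝ}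
    (X0 : Matrix (Fin (d 0)) (Fin n) ℝ) (ℓ : ℕ) (h : ∀ k < ℓ, W k = W' k) :
    netLayer σ d n W X0 ℓ = netLayer σ d n W' X0 ℓ := by
  induction ℓ with
  | zero => rfl
  | succ ℓ ih => simp only [netLayer]; rw [ih fun k hk => h k (by omega), h ℓ (by omega)]

lemma netLayer_succ (σ : ℝ → ℝ) (d : ℕ → ℕ) (n : ℕ) (W : (ℓ : ℕ) → Fin (d (ℓ + 1)) → Fin (d ℓ) → ℝ)
    (X0 : Matrix (Fin (d 0)) (Fin n) ℝ) (ℓ : ℕ) :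
    netLayer σ d n W X0 (ℓ + 1) = (√(d (ℓ + 1) : ℝ))⁻¹ • Matrix.of (Yv σ (netLayer σ d n W X0 ℓ) (W ℓ)) := rfl

def extW {L : ℕ} {d : ℕ → ℕ} (p : (k : Fin L) → Fin (d ((k : ℕ) + 1)) → Fin (d (k : ℕ)) → ℝ) (ℓ : ℕ) :
    Fin (d (ℓ + 1)) → Fin (d ℓ) → ℝ := if h : ℓ < L then p ⟨ℓ, h⟩ else 0

lemma MM_net {L : ℕ} {d : ℕ → ℕ} {n : ℕ} {σ : ℝ → ℝ} (hσ : Continuous σ) (X0 : Matrix (Fin (d 0)) (Fin n) ℝ) (ℓ : ℕ) :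
    MM fun p : (k : Fin L) → Fin (d ((k : ℕ) + 1)) → Fin (d (k : ℕ)) → ℝ => netLayer σ d n (extW p) X0 ℓ := by
  induction ℓ with
  | zero => exact MM.const X0
  | succ ℓ ih =>
    have : ∀ i j, Measurable fun p : (k : Fin L) → Fin (d ((k : ℕ) + 1)) → Fin (d (k : ℕ)) → ℝ => extW p ℓ i j := by
      intro i j
      by_cases h : ℓ < L
      · simp only [extW, h, dif_pos]; fun_prop
      · simp only [extW, h, dif_neg, not_false_iff]; exact measurable_const
    have h2 := MM.Yv hσ ih this
    exact MM.smul (A := fun p => Matrix.of (Yv σ (netLayer σ d n (extW p) X0 ℓ) (extW p ℓ))) h2 _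

open Classical in
lemma layer_int {L : ℕ} {d : ℕ → ℕ} {n : ℕ} {σ : ℝ → ℝ} (hσ : Continuous σ) (X0 : Matrix (Fin (d 0)) (Fin n) ℝ)
    {Ω : Type*} [MeasurableSpace Ω] (Pr : Measure Ω) (W : (ℓ : ℕ) → Ω → Fin (d (ℓ + 1)) → Fin (d ℓ) → ℝ)
    (hW : Measure.map (fun ω => fun ℓ : Fin L => W ℓ ω) Pr =
      Measure.pi (fun ℓ : Fin L => gaussianMat (d ((ℓ : ℕ) + 1)) (d (ℓ : ℕ)))) {ℓ : ℕ} (hℓ : ℓ < L) (B : ℝ)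
    (Z : Matrix (Fin (d ℓ)) (Fin n) ℝ → (Fin (d (ℓ + 1)) → Fin (d ℓ) → ℝ) → ℝ≥0∞)
    (hZ : Measurable fun q : (Fin (d ℓ) → Fin n → ℝ) × (Fin (d (ℓ + 1)) → Fin (d ℓ) → ℝ) => Z (Matrix.of q.1) q.2) :
    AEMeasurable (fun ω => if Good B (netLayer σ d n (fun k => W k ω) X0 ℓ) then Z (netLayer σ d n (fun k => W k ω) X0 ℓ) (W ℓ ω) else 0) Pr ∧
    ∀ c : ℝ≥0∞, (∀ X, Good B X → ∫⁻ w, Z X w ∂(gaussianMat (d (ℓ + 1)) (d ℓ)) ≤ c) →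
    ∫⁻ ω, (if Good B (netLayer σ d n (fun k => W k ω) X0 ℓ) then Z (netLayer σ d n (fun k => W k ω) X0 ℓ) (W ℓ ω) else 0) ∂Pr ≤ c := by
  have hae : AEMeasurable (fun ω => fun ℓ : Fin L => W ℓ ω) Pr := by
    by_contra h
    rw [Measure.map_of_not_aemeasurable h] at hW
    have := congrArg (fun μ => μ Set.univ) hW
    simp at this
  set f : ((k : Fin L) → Fin (d ((k : ℕ) + 1)) → Fin (d (k : ℕ)) → ℝ) → ℝ≥0∞ := fun p =>
    if Good B (netLayer σ d n (extW p) X0 ℓ) then Z (netLayer σ d n (extW p) X0 ℓ) (p ⟨ℓ, hℓ⟩) else 0 with hfd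
  have hN := MM_net (L := L) hσ X0 ℓ
  have hf : Measurable f := by
    refine Measurable.ite (hN.good B) ?_ measurable_const
    have h1 : Measurable fun p : (k : Fin L) → Fin (d ((k : ℕ) + 1)) → Fin (d (k : ℕ)) → ℝ => (p ⟨ℓ, hℓ⟩ : Fin (d (ℓ + 1)) → Fin (d ℓ) → ℝ) := measurable_pi_apply _
    exact hZ.comp (hN.toFun.prodMk h1)
  have hfe : (fun ω => if Good B (netLayer σ d n (fun k => W k ω) X0 ℓ) then Z (netLayer σ d n (fun k => W k ω) X0 ℓ) (W ℓ ω) else 0)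
      = fun ω => f (fun ℓ : Fin L => W ℓ ω) := by
    ext ω
    have : netLayer σ d n (fun k => W k ω) X0 ℓ = netLayer σ d n (extW (fun k : Fin L => W k ω)) X0 ℓ :=
      netLayer_congr _ _ _ _ _ fun k hk => by simp [extW, hk.trans hℓ]
    simp only [hfd, this]
  rw [hfe]
  refine ⟨hf.comp_aemeasurable hae, fun c hc => ?_⟩
  rw [← lintegral_map' hf.aemeasurable hae, hW]
  refine lint_resample (fun ℓ : Fin L => gaussianMat (d ((ℓ : ℕ) + 1)) (d (ℓ : ℕ))) ⟨ℓ, hℓ⟩ hf fun p => ?_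
  have hNp : ∀ q : (k : Fin L) → Fin (d ((k : ℕ) + 1)) → Fin (d (k : ℕ)) → ℝ,
      netLayer σ d n (extW (Function.update p ⟨ℓ, hℓ⟩ (q ⟨ℓ, hℓ⟩))) X0 ℓ = netLayer σ d n (extW p) X0 ℓ := fun q =>
    netLayer_congr _ _ _ _ _ fun k hk => by
      have : (⟨k, hk.trans hℓ⟩ : Fin L) ≠ ⟨ℓ, hℓ⟩ := by simp; omega
      simp [extW, hk.trans hℓ, Function.update_of_ne this]
  simp only [hfd, hNp, Function.update_self]
  by_cases hg : Good B (netLayer σ d n (extW p) X0 ℓ)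
  · simp only [hg, if_true]
    have hZm : Measurable (Z (netLayer σ d n (extW p) X0 ℓ)) :=
      hZ.comp (measurable_const (a := fun i j => netLayer σ d n (extW p) X0 ℓ i j).prodMk measurable_id)
    exact ((measurePreserving_eval (fun ℓ : Fin L => gaussianMat (d ((ℓ : ℕ) + 1)) (d (ℓ : ℕ))) ⟨ℓ, hℓ⟩).lintegral_comp hZm).trans_le
      (hc _ hg)
  · simp [hg]

lemma ae_tendsto_zero {Ω : Type*} [MeasurableSpace Ω] (Pr : Measure Ω) (f : ℕ → Ω → ℝ≥0∞) (hf : ∀ n, AEMeasurable (f n) Pr)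
    (C : ℝ) (h : ∀ᶠ n : ℕ in atTop, ∫⁻ ω, f n ω ∂Pr ≤ ENNReal.ofReal (C / (n : ℝ) ^ 2)) :
    ∀ᵐ ω ∂Pr, Tendsto (fun n => f n ω) atTop (𝓝 0) := by
  obtain ⟨N, hN⟩ := eventually_atTop.1 h
  have h1 : ∫⁻ ω, ∑' n, f (n + N) ω ∂Pr ≠ ⊤ := by
    rw [lintegral_tsum fun n => hf _]
    refine ne_top_of_le_ne_top ?_ (ENNReal.tsum_le_tsum fun n => hN (n + N) (by omega))
    have hs : Summable fun n : ℕ => |C| / (n : ℝ) ^ 2 := by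
      have := (Real.summable_one_div_nat_pow (p := 2)).2 (by norm_num)
      simpa [div_eq_mul_inv] using this.mul_left |C|
    have hs2 := (summable_nat_add_iff N).2 hs
    refine ne_top_of_le_ne_top hs2.tsum_ofReal_ne_top (ENNReal.tsum_le_tsum fun n => ENNReal.ofReal_le_ofReal ?_)
    gcongr
    exact le_abs_self C
  filter_upwards [ae_lt_top' (AEMeasurable.tsum fun n => hf _) h1] with ω hω
  exact (tendsto_add_atTop_iff_nat N).1 (ENNReal.tendsto_atTop_zero_of_tsum_ne_top hω.ne)

lemma layer_as {L : ℕ} {d : ℕ → ℕ → ℕ} {σ : ℝ → ℝ} (hσ : Continuous σ) (X0 : (n : ℕ) → Matrix (Fin (d n 0)) (Fin n) ℝ)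
    {Ω : Type*} [MeasurableSpace Ω] (Pr : Measure Ω) (W : (n : ℕ) → (ℓ : ℕ) → Ω → Fin (d n (ℓ + 1)) → Fin (d n ℓ) → ℝ)
    (hW : ∀ n : ℕ, Measure.map (fun ω => fun ℓ : Fin L => W n ℓ ω) Pr =
      Measure.pi (fun ℓ : Fin L => gaussianMat (d n ((ℓ : ℕ) + 1)) (d n (ℓ : ℕ)))) {ℓ : ℕ} (hℓ : ℓ < L) (B : ℝ)
    (Z : (n : ℕ) → Matrix (Fin (d n ℓ)) (Fin n) ℝ → (Fin (d n (ℓ + 1)) → Fin (d n ℓ) → ℝ) → ℝ)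
    (hZ0 : ∀ n X w, 0 ≤ Z n X w)
    (hZ : ∀ n, Measurable fun q : (Fin (d n ℓ) → Fin n → ℝ) × (Fin (d n (ℓ + 1)) → Fin (d n ℓ) → ℝ) => Z n (Matrix.of q.1) q.2)
    (C : ℝ) (hC : ∀ᶠ n : ℕ in atTop, ∀ X, Good B X → ∫⁻ w, ENNReal.ofReal (Z n X w) ∂(gaussianMat (d n (ℓ + 1)) (d n ℓ)) ≤ ENNReal.ofReal (C / (n : ℝ) ^ 2)) :
    ∀ᵐ ω ∂Pr, (∀ᶠ n : ℕ in atTop, Good B (netLayer σ (d n) n (fun k => W n k ω) (X0 n) ℓ)) →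
      Tendsto (fun n => Z n (netLayer σ (d n) n (fun k => W n k ω) (X0 n) ℓ) (W n ℓ ω)) atTop (𝓝 0) := by
  classical
  have H := fun n => layer_int (d := d n) hσ (X0 n) Pr (W n) (hW n) hℓ B (fun X w => ENNReal.ofReal (Z n X w)) (ENNReal.measurable_ofReal.comp (hZ n))
  have := ae_tendsto_zero Pr _ (fun n => (H n).1) C (hC.mono fun n hn => (H n).2 _ hn)
  filter_upwards [this] with ω hω hg
  have h2 : Tendsto (fun n => ENNReal.ofReal (Z n (netLayer σ (d n) n (fun k => W n k ω) (X0 n) ℓ) (W n ℓ ω))) atTop (𝓝 0) := by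
    refine hω.congr' ?_
    filter_upwards [hg] with n hn
    simp [hn]
  have h3 := (ENNReal.tendsto_toReal ENNReal.zero_ne_top).comp h2
  simpa [Function.comp_def, ENNReal.toReal_ofReal (hZ0 _ _ _)] using h3
end

section
open scoped ENNReal NNReal
lemma dim_ev {d : ℕ → ℕ} {γ : ℝ} (hγ : 0 < γ) (h : Tendsto (fun n : ℕ => (n : ℝ) / (d n : ℝ)) atTop (𝓝 γ)) :
    ∀ᶠ n : ℕ in atTop, 0 < d n ∧ 0 < n ∧ (n : ℝ) / d n ≤ 2 * γ := by
  filter_upwards [h.eventually (lt_mem_nhds (show 0 < γ from hγ)), h.eventually (gt_mem_nhds (show γ < 2 * γ by linarith))] with n h1 h2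
  refine ⟨Nat.pos_of_ne_zero fun h0 => ?_, Nat.pos_of_ne_zero fun h0 => ?_, h2.le⟩
  · simp [h0] at h1
  · simp [h0] at h1

lemma dim_bd {d n : ℕ} {C κ : ℝ} (hC : 0 ≤ C) (hd : 0 < d) (hn : 0 < n) (h : (n : ℝ) / d ≤ κ) :
    C * (n / d : ℝ) ^ 2 / (d : ℝ) ^ 2 ≤ C * κ ^ 4 / (n : ℝ) ^ 2 := by
  have hn' : (0 : ℝ) < n := by exact_mod_cast hn
  have hd' : (0 : ℝ) < d := by exact_mod_cast hd
  have : C * (n / d : ℝ) ^ 2 / (d : ℝ) ^ 2 = C * (n / d : ℝ) ^ 4 / (n : ℝ) ^ 2 := by field_simp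
  rw [this]
  gcongr

section
variable {d n : ℕ} (Y : Fin d → Fin n → ℝ)
lemma lay_dot (α β : Fin n) : ∑ i, ((√(d : ℝ))⁻¹ • Matrix.of Y) i α * ((√(d : ℝ))⁻¹ • Matrix.of Y) i β = cvY Y α β := by
  simp only [cvY, Finset.mul_sum]
  refine Finset.sum_congr rfl fun i _ => ?_
  have h : (√(d : ℝ))⁻¹ * (√(d : ℝ))⁻¹ = (d : ℝ)⁻¹ := by rw [← mul_inv, Real.mul_self_sqrt (Nat.cast_nonneg d)]
  simp only [Matrix.smul_apply, Matrix.of_apply, smul_eq_mul]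
  rw [← h]; ring
lemma lay_sq (α : Fin n) : ∑ i, ((√(d : ℝ))⁻¹ • Matrix.of Y) i α ^ 2 = cvY Y α α := by
  rw [← lay_dot]; simp only [pow_two]
lemma lay_gram : ((√(d : ℝ))⁻¹ • Matrix.of Y)ᵀ * ((√(d : ℝ))⁻¹ • Matrix.of Y) = cvM Y := by
  ext α β; rw [Matrix.mul_apply]; exact lay_dot Y α β
lemma lay_off : offd ((√(d : ℝ))⁻¹ • Matrix.of Y) = offY Y := by simp only [offd, offY, lay_dot]
end

section
variable {L : ℕ} {d : ℕ → ℕ → ℕ} {σ σ' σ'' : ℝ → ℝ} {l : ℝ}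

lemma step1 (h : ∀ x, HasDerivAt σ (σ' x) x) (h2 : ∀ x, HasDerivAt σ' (σ'' x) x)
    (hb : ∀ x, |σ' x| ≤ l) (hb2 : ∀ x, |σ'' x| ≤ l) (hmean : ∫ x, σ x ∂(gaussianReal 0 1) = 0)
    (hvar : ∫ x, σ x ^ 2 ∂(gaussianReal 0 1) = 1)
    (X0 : (n : ℕ) → Matrix (Fin (d n 0)) (Fin n) ℝ)
    {Ω : Type*} [MeasurableSpace Ω] (Pr : Measure Ω) (W : (n : ℕ) → (ℓ : ℕ) → Ω → Fin (d n (ℓ + 1)) → Fin (d n ℓ) → ℝ)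
    (hW : ∀ n : ℕ, Measure.map (fun ω => fun ℓ : Fin L => W n ℓ ω) Pr =
      Measure.pi (fun ℓ : Fin L => gaussianMat (d n ((ℓ : ℕ) + 1)) (d n (ℓ : ℕ)))) {ℓ : ℕ} (hℓ : ℓ < L) (B : ℝ)
    {γ : ℝ} (hγ : 0 < γ) (hdim : Tendsto (fun n : ℕ => (n : ℝ) / (d n (ℓ + 1) : ℝ)) atTop (𝓝 γ)) :
    ∃ B' : ℝ, ∀ᵐ ω ∂Pr, (∀ᶠ n : ℕ in atTop, Good B (netLayer σ (d n) n (fun k => W n k ω) (X0 n) ℓ)) →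
      Tendsto (fun n : ℕ => offd (netLayer σ (d n) n (fun k => W n k ω) (X0 n) ℓ) / n) atTop (𝓝 0) →
      (∀ᶠ n : ℕ in atTop, Good B' (netLayer σ (d n) n (fun k => W n k ω) (X0 n) (ℓ + 1))) ∧
      Tendsto (fun n : ℕ => offd (netLayer σ (d n) n (fun k => W n k ω) (X0 n) (ℓ + 1)) / n) atTop (𝓝 0) := by
  have hσ : Continuous σ := continuous_iff_continuousAt.2 fun x => (h x).continuousAt
  have hc' : Continuous σ' := continuous_iff_continuousAt.2 fun x => (h2 x).continuousAt
  obtain ⟨C1, hC1, H1⟩ := opn_exp h hc' hb hmean B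
  obtain ⟨C2, D2, hC2, hD2, H2⟩ := S_final h hc' hb hvar B
  obtain ⟨C3, D3, hC3, hD3, H3⟩ := off_final h h2 hb hb2 hmean hvar B
  have hev := dim_ev hγ hdim
  set κ := 2 * γ with hκ
  have hκ0 : 0 < κ := by positivity
  set B1 := 4 * (C1 * (1 + κ) + 1) with hB1
  have hB10 : 0 ≤ B1 := by positivity
  have hY : ∀ n, ∀ i α, Measurable fun q : (Fin (d n ℓ) → Fin n → ℝ) × (Fin (d n (ℓ + 1)) → Fin (d n ℓ) → ℝ) =>
      Yv σ (Matrix.of q.1) q.2 i α := fun n =>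
    MM.Yv hσ (X := fun q : (Fin (d n ℓ) → Fin n → ℝ) × (Fin (d n (ℓ + 1)) → Fin (d n ℓ) → ℝ) => Matrix.of q.1)
      (fun i j => by simp only [Matrix.of_apply]; fun_prop) (fun i j => by fun_prop)
  have hX : ∀ n, MM fun q : (Fin (d n ℓ) → Fin n → ℝ) × (Fin (d n (ℓ + 1)) → Fin (d n ℓ) → ℝ) => (Matrix.of q.1 : Matrix _ _ ℝ) :=
    fun n i j => by simp only [Matrix.of_apply]; fun_prop
  have hcv : ∀ n α β, Measurable fun q : (Fin (d n ℓ) → Fin n → ℝ) × (Fin (d n (ℓ + 1)) → Fin (d n ℓ) → ℝ) =>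
      cvY (Yv σ (Matrix.of q.1) q.2) α β := fun n => MM.cvM (hY n)
  have A1 := layer_as hσ X0 Pr W hW hℓ B
    (fun n X w => Real.exp (√(d n (ℓ + 1)) * opNorm (Matrix.of (Yv σ X w)) / 4 - d n (ℓ + 1) * B1 / 4)) (fun n X w => (Real.exp_pos _).le)
    (fun n => by
      have : Measurable fun q : (Fin (d n ℓ) → Fin n → ℝ) × (Fin (d n (ℓ + 1)) → Fin (d n ℓ) → ℝ) => opNorm (Matrix.of (Yv σ (Matrix.of q.1) q.2)) :=
        MM.opNorm (hY n)
      fun_prop) (2 * κ ^ 2) (by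
      filter_upwards [hev] with n ⟨hd, hn, hnd⟩ X hG
      have hn' : (0 : ℝ) < n := by exact_mod_cast hn
      have hd' : (0 : ℝ) < d n (ℓ + 1) := by exact_mod_cast hd
      have hnd' : (n : ℝ) ≤ κ * d n (ℓ + 1) := by rwa [div_le_iff₀ hd'] at hnd
      have e : ∀ w : Fin (d n (ℓ + 1)) → Fin (d n ℓ) → ℝ, ENNReal.ofReal (Real.exp (√(d n (ℓ + 1)) * opNorm (Matrix.of (Yv σ X w)) / 4 - d n (ℓ + 1) * B1 / 4)) =
          ENNReal.ofReal (Real.exp (- (d n (ℓ + 1) * B1 / 4))) * ENNReal.ofReal (Real.exp (√(d n (ℓ + 1)) * opNorm (Matrix.of (Yv σ X w)) / 4)) := by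
        intro w
        rw [← ENNReal.ofReal_mul (Real.exp_pos _).le, ← Real.exp_add]; congr 2; ring
      simp only [e]
      rw [lintegral_const_mul' _ _ ENNReal.ofReal_ne_top]
      refine (mul_le_mul_right (H1 _ _ _ X hG) _).trans ?_
      rw [← ENNReal.ofReal_mul (Real.exp_pos _).le, ← Real.exp_add]
      refine ENNReal.ofReal_le_ofReal ?_
      have : -(d n (ℓ + 1) * B1 / 4) + C1 * ((d n (ℓ + 1) : ℝ) + n) ≤ - d n (ℓ + 1) := by
        have := mul_le_mul_of_nonneg_left hnd' hC1
        rw [hB1]; nlinarith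
      refine (Real.exp_le_exp.2 this).trans ?_
      rw [Real.exp_neg]
      have h3 := Real.quadratic_le_exp_of_nonneg hd'.le
      have h4 : (n : ℝ) ^ 2 / (2 * κ ^ 2) ≤ Real.exp (d n (ℓ + 1)) := by
        rw [div_le_iff₀ (by positivity)]
        have : (n : ℝ) ^ 2 ≤ (κ * d n (ℓ + 1)) ^ 2 := by gcongr
        nlinarith [sq_nonneg κ]
      refine (inv_anti₀ (by positivity) h4).trans_eq ?_
      rw [inv_div])
  have A2 := layer_as hσ X0 Pr W hW hℓ B
    (fun n X w => max ((∑ α, (cvY (Yv σ X w) α α - 1) ^ 2) - D2 * (1 + (n / d n (ℓ + 1) : ℝ))) 0 ^ 4) (fun n X w => by positivity)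
    (fun n => by
      refine (Measurable.max (Measurable.sub_const (Finset.measurable_fun_sum _ fun α _ => ((hcv n α α).sub_const 1).pow_const 2) _) measurable_const).pow_const 4) (C2 * κ ^ 4) (by
      filter_upwards [hev] with n ⟨hd, hn, hnd⟩ X hG
      exact (H2 _ _ _ X hd hG).trans (ENNReal.ofReal_le_ofReal (dim_bd hC2 hd hn hnd)))
  have A3 := layer_as hσ X0 Pr W hW hℓ B
    (fun n X w => (max (offY (Yv σ X w) - D3 * (1 + offd X)) 0 / n) ^ 2) (fun n X w => by positivity)
    (fun n => by
      refine ((Measurable.max (Measurable.sub ?_ (((hX n).offd.const_add 1).const_mul D3)) measurable_const).div_const _).pow_const 2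
      refine Finset.measurable_fun_sum _ fun α _ => Finset.measurable_fun_sum _ fun β _ => ?_
      split_ifs
      · exact measurable_const
      · exact (hcv n α β).pow_const 4) (C3 * κ ^ 4) (by
      filter_upwards [hev] with n ⟨hd, hn, hnd⟩ X hG
      exact (H3 _ _ _ X hd hn hG).trans (ENNReal.ofReal_le_ofReal (dim_bd hC3 hd hn hnd)))
  refine ⟨B1 + (1 + (D2 * (1 + κ) + 1)), ?_⟩
  filter_upwards [A1, A2, A3] with ω a1 a2 a3 hG hO
  replace a1 := a1 hG
  replace a2 := a2 hG
  replace a3 := a3 hG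
  constructor
  · filter_upwards [a1.eventually (gt_mem_nhds one_pos), a2.eventually (gt_mem_nhds one_pos), hev] with n e1 e2 ⟨hd, hn, hnd⟩
    have hd' : (0 : ℝ) < d n (ℓ + 1) := by exact_mod_cast hd
    rw [netLayer_succ]
    set X := netLayer σ (d n) n (fun k => W n k ω) (X0 n) ℓ
    constructor
    · rw [opNorm_smul', abs_of_nonneg (by positivity)]
      rw [Real.exp_lt_one_iff] at e1
      have hs := Real.mul_self_sqrt hd'.le
      have hs0 := Real.sqrt_pos.2 hd'
      have : opNorm (Matrix.of (Yv σ X (W n ℓ ω))) ≤ √(d n (ℓ + 1)) * B1 := by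
        refine le_of_mul_le_mul_left ?_ hs0
        rw [← mul_assoc, hs]; linarith
      calc (√(d n (ℓ + 1) : ℝ))⁻¹ * opNorm (Matrix.of (Yv σ X (W n ℓ ω))) ≤ (√(d n (ℓ + 1) : ℝ))⁻¹ * (√(d n (ℓ + 1)) * B1) := by gcongr
        _ = B1 := by field_simp
        _ ≤ _ := by
          have : 0 ≤ D2 * (1 + κ) := by positivity
          linarith
    · simp only [lay_sq]
      set S := ∑ α, (cvY (Yv σ X (W n ℓ ω)) α α - 1) ^ 2
      have hm : max (S - D2 * (1 + (n / d n (ℓ + 1) : ℝ))) 0 < 1 := by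
        by_contra hcon
        push Not at hcon
        exact absurd (one_le_pow₀ (n := 4) hcon) (not_le.2 e2)
      have h5 := (le_max_left _ _).trans_lt hm
      have h6 : D2 * (1 + (n / d n (ℓ + 1) : ℝ)) ≤ D2 * (1 + κ) := by gcongr
      have h7 : 0 ≤ D2 * (1 + κ) := by positivity
      nlinarith
  · have b3 : Tendsto (fun n : ℕ => max (offY (Yv σ (netLayer σ (d n) n (fun k => W n k ω) (X0 n) ℓ) (W n ℓ ω)) - D3 * (1 + offd (netLayer σ (d n) n (fun k => W n k ω) (X0 n) ℓ))) 0 / (n : ℝ)) atTop (𝓝 0) := by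
      have := (Real.continuous_sqrt.tendsto 0).comp a3
      rw [Real.sqrt_zero] at this
      refine this.congr fun n => ?_
      simp only [Function.comp]
      rw [Real.sqrt_sq (by positivity)]
    have b4 : Tendsto (fun n : ℕ => D3 * ((n : ℝ)⁻¹ + offd (netLayer σ (d n) n (fun k => W n k ω) (X0 n) ℓ) / n)) atTop (𝓝 0) := by
      have := ((tendsto_inv_atTop_nhds_zero_nat (𝕜 := ℝ)).add hO).const_mul D3
      simpa using this
    have b5 := b3.add b4
    rw [add_zero] at b5
    refine squeeze_zero (fun n => ?_) (fun n => ?_) b5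
    · refine div_nonneg (Finset.sum_nonneg fun α _ => Finset.sum_nonneg fun β _ => ?_) (Nat.cast_nonneg n)
      split_ifs <;> positivity
    · rw [netLayer_succ, lay_off]
      have h0 : (0 : ℝ) ≤ (n : ℝ)⁻¹ := by positivity
      rw [div_eq_mul_inv, div_eq_mul_inv, div_eq_mul_inv]
      have := mul_le_mul_of_nonneg_right (le_max_left (offY (Yv σ (netLayer σ (d n) n (fun k => W n k ω) (X0 n) ℓ) (W n ℓ ω)) - D3 * (1 + offd (netLayer σ (d n) n (fun k => W n k ω) (X0 n) ℓ))) 0) h0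
      linarith
end
end

section
open scoped ENNReal NNReal
section
variable {L : ℕ} {d : ℕ → ℕ → ℕ} {σ σ' σ'' : ℝ → ℝ} {l : ℝ}

lemma mean_four {d : ℕ} (hd : 0 < d) (p : Fin d → ℝ) (hp : ∀ i, 0 ≤ p i) :
    (d : ℝ)⁻¹ * ∑ i, p i ≤ √√((d : ℝ)⁻¹ * ∑ i, p i ^ 4) := by
  have hd' : (0 : ℝ) < d := by exact_mod_cast hd
  have := Real.pow_arith_mean_le_arith_mean_pow Finset.univ (fun _ : Fin d => (d : ℝ)⁻¹) p (fun _ _ => by positivity)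
    (by simp [hd'.ne']) (fun i _ => hp i) 4
  rw [← Finset.mul_sum, ← Finset.mul_sum] at this
  have h0 : 0 ≤ (d : ℝ)⁻¹ * ∑ i, p i := mul_nonneg (by positivity) (Finset.sum_nonneg fun i _ => hp i)
  refine Real.le_sqrt_of_sq_le (Real.le_sqrt_of_sq_le ?_)
  rw [← pow_mul]; exact this

lemma step2 (h : ∀ x, HasDerivAt σ (σ' x) x) (h2 : ∀ x, HasDerivAt σ' (σ'' x) x)
    (hb : ∀ x, |σ' x| ≤ l) (hb2 : ∀ x, |σ'' x| ≤ l) (hmean : ∫ x, σ x ∂(gaussianReal 0 1) = 0)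
    (hvar : ∫ x, σ x ^ 2 ∂(gaussianReal 0 1) = 1)
    (X0 : (n : ℕ) → Matrix (Fin (d n 0)) (Fin n) ℝ)
    {Ω : Type*} [MeasurableSpace Ω] (Pr : Measure Ω) (W : (n : ℕ) → (ℓ : ℕ) → Ω → Fin (d n (ℓ + 1)) → Fin (d n ℓ) → ℝ)
    (hW : ∀ n : ℕ, Measure.map (fun ω => fun ℓ : Fin L => W n ℓ ω) Pr =
      Measure.pi (fun ℓ : Fin L => gaussianMat (d n ((ℓ : ℕ) + 1)) (d n (ℓ : ℕ)))) {ℓ : ℕ} (hℓ : ℓ < L) (B : ℝ)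
    {γ : ℝ} (hγ : 0 < γ) (hdim : Tendsto (fun n : ℕ => (n : ℝ) / (d n (ℓ + 1) : ℝ)) atTop (𝓝 γ)) {y s : ℝ} (hy : 0 < y) (hs : 0 ≤ s) :
    ∀ᵐ ω ∂Pr, (∀ᶠ n : ℕ in atTop, Good B (netLayer σ (d n) n (fun k => W n k ω) (X0 n) ℓ)) →
      Tendsto (fun n : ℕ => offd (netLayer σ (d n) n (fun k => W n k ω) (X0 n) ℓ) / n) atTop (𝓝 0) →
      ∃ δ : ℕ → ℝ, Tendsto δ atTop (𝓝 0) ∧ ∀ᶠ n : ℕ in atTop,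
        |(n : ℝ)⁻¹ * (res ((netLayer σ (d n) n (fun k => W n k ω) (X0 n) (ℓ + 1))ᵀ * netLayer σ (d n) n (fun k => W n k ω) (X0 n) (ℓ + 1)) y).trace
          - (n : ℝ)⁻¹ * (res (s • phit (∫ x, σ' x ∂(gaussianReal 0 1)) (netLayer σ (d n) n (fun k => W n k ω) (X0 n) ℓ)) y).trace| ≤
        |s - (1 - n / d n (ℓ + 1) + y * (n / d n (ℓ + 1)) * ((n : ℝ)⁻¹ * (res ((netLayer σ (d n) n (fun k => W n k ω) (X0 n) (ℓ + 1))ᵀ * netLayer σ (d n) n (fun k => W n k ω) (X0 n) (ℓ + 1)) y).trace))|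
          * ((1 + B ^ 2) / y ^ 2) + δ n := by
  have hσ : Continuous σ := continuous_iff_continuousAt.2 fun x => (h x).continuousAt
  have hc' : Continuous σ' := continuous_iff_continuousAt.2 fun x => (h2 x).continuousAt
  have hb1 := b_sq_le h hc' hb hvar
  obtain ⟨C, D, hC, hD, H⟩ := quad_final h h2 hb hb2 hmean hvar B
  set b := ∫ x, σ' x ∂(gaussianReal 0 1)
  have hev := dim_ev hγ hdim
  have A := layer_as hσ X0 Pr W hW hℓ B (fun n X w => Zq b D y s σ X w) (fun n X w => by unfold Zq; positivity)
    (fun n => by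
      have hX : MM fun q : (Fin (d n ℓ) → Fin n → ℝ) × (Fin (d n (ℓ + 1)) → Fin (d n ℓ) → ℝ) => (Matrix.of q.1 : Matrix _ _ ℝ) :=
        fun i j => by simp only [Matrix.of_apply]; fun_prop
      refine Measurable.const_mul (Finset.measurable_fun_sum _ fun i _ => ?_) _
      have h1 := meas_eI b y s hσ hX (W := fun q => q.2) (fun i j => by fun_prop) i
      have h2 := hX.offd
      refine Measurable.pow_const (Measurable.div_const (Measurable.max (Measurable.sub (measurable_norm.comp h1) ?_) measurable_const) _) 4
      exact (((h2.const_add 1).const_mul D).sqrt.mul_const _).div_const _) (C / y ^ 8) (by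
      filter_upwards [hev] with n ⟨hd, hn, hnd⟩ X hG
      exact H _ _ _ X hd hn hG y s hy hs)
  filter_upwards [A] with ω a hG hO
  replace a := a hG
  refine ⟨fun n => √√(Zq b D y s σ (netLayer σ (d n) n (fun k => W n k ω) (X0 n) ℓ) (W n ℓ ω)) +
    √(D * ((n : ℝ)⁻¹ + offd (netLayer σ (d n) n (fun k => W n k ω) (X0 n) ℓ) / n)) / y ^ 2 + (1 + B ^ 2) / y ^ 2 * (n : ℝ)⁻¹, ?_, ?_⟩
  · have t1 := (Real.continuous_sqrt.comp Real.continuous_sqrt).tendsto 0 |>.comp a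
    have t0 := (tendsto_inv_atTop_nhds_zero_nat (𝕜 := ℝ))
    have t2 := ((Real.continuous_sqrt.tendsto _).comp ((t0.add hO).const_mul D)).div_const (y ^ 2)
    have := (t1.add t2).add (t0.const_mul ((1 + B ^ 2) / y ^ 2))
    simpa [Function.comp_def] using this
  · filter_upwards [hG, hev] with n hg ⟨hd, hn, hnd⟩
    have hn' : (0 : ℝ) < n := by exact_mod_cast hn
    have hd' : (0 : ℝ) < d n (ℓ + 1) := by exact_mod_cast hd
    rw [netLayer_succ, lay_gram]
    set X := netLayer σ (d n) n (fun k => W n k ω) (X0 n) ℓ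
    set dd := d n (ℓ + 1)
    have R := resolvent_main hd (Yv σ X (W n ℓ ω)) (phit b X) (Psd_phit hb1 X) (opNorm_phit hb1 X hg.1) hy hs
    set T := (res (cvM (Yv σ X (W n ℓ ω))) y).trace
    set T2 := (res (s • phit b X) y).trace
    set t := √(D * (1 + offd X)) * √n / y ^ 2 with ht
    have e1 : 1 - (n : ℝ) / dd + y * (n / dd) * ((n : ℝ)⁻¹ * T) = 1 - n / dd + y / dd * T := by field_simp
    rw [e1, ← mul_sub, abs_mul, abs_of_pos (inv_pos.2 hn')]
    refine (mul_le_mul_of_nonneg_left R (inv_pos.2 hn').le).trans ?_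
    have m4 := mean_four hd (fun i => max (|eI (phit b X) (res (s • phit b X) y) y (Yv σ X (W n ℓ ω)) i| - t) 0 / n) (fun i => by positivity)
    have e2 : (dd : ℝ)⁻¹ * ∑ i, (max (|eI (phit b X) (res (s • phit b X) y) y (Yv σ X (W n ℓ ω)) i| - t) 0 / n) ^ 4 = Zq b D y s σ X (W n ℓ ω) := rfl
    rw [e2] at m4
    have m5 : (n : ℝ)⁻¹ * ((dd : ℝ)⁻¹ * ∑ i, |eI (phit b X) (res (s • phit b X) y) y (Yv σ X (W n ℓ ω)) i|) ≤
        (dd : ℝ)⁻¹ * ∑ i, max (|eI (phit b X) (res (s • phit b X) y) y (Yv σ X (W n ℓ ω)) i| - t) 0 / n + t / n := by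
      have : t / n = (dd : ℝ)⁻¹ * ∑ i : Fin dd, t / n := by simp; field_simp
      rw [this, ← mul_add, ← Finset.sum_add_distrib, mul_left_comm, Finset.mul_sum]
      gcongr with i
      have := le_max_left (|eI (phit b X) (res (s • phit b X) y) y (Yv σ X (W n ℓ ω)) i| - t) 0
      rw [← add_div, div_eq_inv_mul]
      gcongr
      linarith
    have m6 : t / n = √(D * ((n : ℝ)⁻¹ + offd X / n)) / y ^ 2 := by
      have : D * ((n : ℝ)⁻¹ + offd X / n) = D * (1 + offd X) / n := by field_simp
      rw [this, Real.sqrt_div' _ hn'.le, ht]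
      have := Real.mul_self_sqrt hn'.le
      have hs0 := Real.sqrt_pos.2 hn'
      field_simp
      rw [pow_two, this]
    rw [m6] at m5
    have e3 : (n : ℝ)⁻¹ * (|s - (1 - n / dd + y / dd * T)| * (n * ((1 + B ^ 2) / y ^ 2))) = |s - (1 - n / dd + y / dd * T)| * ((1 + B ^ 2) / y ^ 2) := by
      field_simp
    rw [mul_add, mul_add, e3, mul_comm (n : ℝ)⁻¹ ((1 + B ^ 2) / y ^ 2)]
    linarith
end
end

section
open scoped ENNReal NNReal
section
variable {m n : ℕ} (X : Matrix (Fin m) (Fin n) ℝ)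
lemma psdTT : (Xᵀ * X).PosSemidef := by
  have := Matrix.posSemidef_conjTranspose_mul_self X
  rwa [Matrix.conjTranspose_eq_transpose_of_trivial] at this

noncomputable def lam (α : Fin n) : ℝ := (psdTT X).1.eigenvalues α

lemma lam_nonneg (α : Fin n) : 0 ≤ lam X α := (psdTT X).eigenvalues_nonneg α

lemma lam_le {B : ℝ} (hX : opNorm X ≤ B) (α : Fin n) : lam X α ≤ B ^ 2 := by
  have h := (psdTT X).1.eigenvalues_eq α
  set v := ((psdTT X).1.eigenvectorBasis α).ofLp with hv
  have h1 : v ⬝ᵥ v = 1 := by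
    have := ((psdTT X).1.eigenvectorBasis).orthonormal.1 α
    rw [EuclideanSpace.norm_eq, Real.sqrt_eq_one] at this
    simpa [dotProduct, pow_two] using this
  have h2 := (le_abs_self _).trans (quad_le_opNorm (Xᵀ * X) v)
  rw [h1, mul_one, opNorm_TT] at h2
  have h3 : lam X α = v ⬝ᵥ ((Xᵀ * X) *ᵥ v) := by rw [lam, h]; simp
  have := opNorm_nonneg' X
  rw [h3]; nlinarith

lemma esd_eq (f : ℝ → ℝ) : esd (Xᵀ * X) f = (n : ℝ)⁻¹ * ∑ α, f (lam X α) := by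
  rw [esd, dif_pos (psdTT X).1]; rfl

lemma trace_res {c t y : ℝ} (hc : 0 ≤ c) (ht : 0 < t + y) :
    (res (t • (1 : Matrix (Fin n) (Fin n) ℝ) + c • (Xᵀ * X)) y).trace = ∑ α, (t + c * lam X α + y)⁻¹ := by
  set φ := Unitary.conjStarAlgAut ℝ (Matrix (Fin n) (Fin n) ℝ) (psdTT X).1.eigenvectorUnitary with hφ
  have hs : Xᵀ * X = φ (diagonal (lam X)) := (psdTT X).1.spectral_theorem
  have h1 : t • (1 : Matrix (Fin n) (Fin n) ℝ) + c • (Xᵀ * X) + y • (1 : Matrix (Fin n) (Fin n) ℝ) = φ (diagonal fun α => t + c * lam X α + y) := by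
    conv_lhs => rw [hs, ← map_one φ, ← map_smul, ← map_smul, ← map_smul, ← map_add, ← map_add]
    congr 1
    ext i j
    by_cases h : i = j
    · subst h; simp
    · simp [h]
  have h2 : φ (diagonal fun α => t + c * lam X α + y) * φ (diagonal fun α => (t + c * lam X α + y)⁻¹) = 1 := by
    rw [← map_mul, diagonal_mul_diagonal]
    have : (fun i => (t + c * lam X i + y) * (t + c * lam X i + y)⁻¹) = fun _ => 1 := by
      ext i
      have : 0 ≤ c * lam X i := mul_nonneg hc (lam_nonneg X i)
      exact mul_inv_cancel₀ (by linarith)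
    rw [this, diagonal_one, map_one]
  rw [res, h1, Matrix.inv_eq_right_inv h2, hφ, Unitary.conjStarAlgAut_apply, Matrix.trace_mul_cycle]
  simp [Matrix.trace]

lemma trace_res1 {y : ℝ} (hy : 0 < y) : (n : ℝ)⁻¹ * (res (Xᵀ * X) y).trace = (n : ℝ)⁻¹ * ∑ α, (lam X α + y)⁻¹ := by
  have := trace_res X (c := 1) (t := 0) (y := y) zero_le_one (by linarith)
  simp only [zero_smul, zero_add, one_smul, one_mul] at this
  rw [this]

lemma trace_res2 {b s y : ℝ} (hb : b ^ 2 ≤ 1) (hs : 0 ≤ s) (hy : 0 < y) :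
    (n : ℝ)⁻¹ * (res (s • phit b X) y).trace = (n : ℝ)⁻¹ * ∑ α, (s * ((1 - b ^ 2) + b ^ 2 * lam X α) + y)⁻¹ := by
  have h0 : 0 ≤ s * (1 - b ^ 2) := mul_nonneg hs (by linarith)
  have := trace_res X (c := s * b ^ 2) (t := s * (1 - b ^ 2)) (y := y) (by positivity) (by linarith)
  rw [phit, smul_add, smul_smul, smul_smul, this]
  congr 1
  refine Finset.sum_congr rfl fun α _ => ?_
  ring_nf
end

/-- bounds for differences of powers -/
lemma pow_diff {a c : ℝ} (hc : 0 ≤ c) (h : c ≤ a) (k : ℕ) :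
    a * (a ^ k - c ^ k) ≤ k * a ^ k * (a - c) ∧ k * c ^ k * (a - c) ≤ c * (a ^ k - c ^ k) := by
  have ha : 0 ≤ a := hc.trans h
  induction k with
  | zero => simp
  | succ k ih =>
    have hk : c ^ k ≤ a ^ k := pow_le_pow_left₀ hc h k
    have hd : 0 ≤ a - c := by linarith
    have h1 := mul_le_mul_of_nonneg_left ih.1 ha
    have h2 := mul_le_mul_of_nonneg_left ih.2 hc
    have h3 := mul_le_mul_of_nonneg_right hk (mul_nonneg ha hd)
    have h4 := mul_le_mul_of_nonneg_right hk (mul_nonneg hc hd)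
    push_cast
    constructor <;> ring_nf at * <;> nlinarith

section
variable (lm : (n : ℕ) → Fin n → ℝ) (μ : Measure ℝ)
def Cv (g : ℝ → ℝ) : Prop := Integrable g μ ∧ Tendsto (fun n : ℕ => (n : ℝ)⁻¹ * ∑ α, g (lm n α)) atTop (𝓝 (∫ x, g x ∂μ))

variable {lm μ}
lemma Cv.lin {g1 g2 : ℝ → ℝ} (h1 : Cv lm μ g1) (h2 : Cv lm μ g2) (c1 c2 : ℝ) : Cv lm μ fun x => c1 * g1 x + c2 * g2 x := by
  refine ⟨(h1.1.const_mul c1).add (h2.1.const_mul c2), ?_⟩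
  have := (h1.2.const_mul c1).add (h2.2.const_mul c2)
  rw [integral_add (h1.1.const_mul c1) (h2.1.const_mul c2), integral_const_mul, integral_const_mul]
  refine this.congr fun n => ?_
  rw [Finset.sum_add_distrib, ← Finset.mul_sum, ← Finset.mul_sum]; ring

lemma Cv.closed [IsProbabilityMeasure μ] (hμ : ∀ᵐ x ∂μ, 0 ≤ x) (hl : ∀ n α, 0 ≤ lm n α) {g : ℝ → ℝ} (hg : AEStronglyMeasurable g μ)
    (h : ∀ ε > 0, ∃ f, Cv lm μ f ∧ ∀ x, 0 ≤ x → |g x - f x| ≤ ε) : Cv lm μ g := by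
  have hi : Integrable g μ := by
    obtain ⟨f, hf, hfg⟩ := h 1 one_pos
    have : Integrable (fun x => g x - f x) μ := Integrable.of_bound (hg.sub hf.1.aestronglyMeasurable) 1
      (hμ.mono fun x hx => hfg x hx)
    exact (this.add hf.1).congr (ae_of_all _ fun x => by simp)
  refine ⟨hi, ?_⟩
  rw [Metric.tendsto_atTop]
  intro ε hε
  obtain ⟨f, hf, hfg⟩ := h (ε / 4) (by positivity)
  obtain ⟨N, hN⟩ := Metric.tendsto_atTop.1 hf.2 (ε / 4) (by positivity)
  refine ⟨N, fun n hn => ?_⟩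
  have h1 := hN n hn
  rw [Real.dist_eq] at h1 ⊢
  have h2 : |∫ x, g x ∂μ - ∫ x, f x ∂μ| ≤ ε / 4 := by
    rw [← integral_sub hi hf.1]
    have := norm_integral_le_of_norm_le_const (μ := μ) (f := fun x => g x - f x) (C := ε / 4) (hμ.mono fun x hx => hfg x hx)
    simpa using this
  have h3 : |(n : ℝ)⁻¹ * ∑ α, g (lm n α) - (n : ℝ)⁻¹ * ∑ α, f (lm n α)| ≤ ε / 4 := by
    rw [← mul_sub, ← Finset.sum_sub_distrib, abs_mul, abs_of_nonneg (by positivity)]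
    have : |∑ α, (g (lm n α) - f (lm n α))| ≤ n * (ε / 4) := by
      refine (Finset.abs_sum_le_sum_abs _ _).trans ((Finset.sum_le_sum fun α _ => hfg _ (hl n α)).trans ?_)
      simp
    rcases Nat.eq_zero_or_pos n with h0 | h0
    · subst h0; simp; positivity
    · have : (0 : ℝ) < n := by exact_mod_cast h0
      rw [inv_mul_le_iff₀ this]; assumption
  have := abs_le.1 h1.le
  rw [abs_le] at h2 h3
  rw [abs_lt]
  constructor <;> linarith

lemma Cv.congr {g1 g2 : ℝ → ℝ} (h1 : Cv lm μ g1) (hμ : ∀ᵐ x ∂μ, 0 ≤ x) (hl : ∀ n α, 0 ≤ lm n α) (h : ∀ x, 0 ≤ x → g1 x = g2 x) :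
    Cv lm μ g2 := by
  have he : g1 =ᵐ[μ] g2 := hμ.mono fun x hx => h x hx
  refine ⟨h1.1.congr he, ?_⟩
  rw [← integral_congr_ae he]
  exact h1.2.congr fun n => by simp only [h _ (hl n _)]

lemma Cv.pow [IsProbabilityMeasure μ] (hμ : ∀ᵐ x ∂μ, 0 ≤ x) (hl : ∀ n α, 0 ≤ lm n α) {Y : ℝ} (hY : 1 ≤ Y)
    (H : ∀ q : ℚ, Y ≤ q → Cv lm μ fun x => (x + q)⁻¹) (k : ℕ) : ∀ q : ℚ, Y ≤ q → Cv lm μ fun x => (x + q)⁻¹ ^ (k + 1) := by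
  induction k with
  | zero => simpa using H
  | succ k ih =>
    intro q hq
    refine Cv.closed hμ hl (by fun_prop) fun ε hε => ?_
    obtain ⟨j, hj⟩ := exists_nat_gt (((k : ℝ) + 1) / ε)
    have hj0 : (0 : ℝ) < j := lt_of_le_of_lt (by positivity) hj
    have c1 := ih q hq
    have c2 := ih (q + (j : ℚ)⁻¹) (by push_cast; have : (0 : ℝ) ≤ (j : ℝ)⁻¹ := by positivity
                                      linarith)
    refine ⟨_, c1.lin c2 (j / (k + 1)) (-(j / (k + 1))), fun x hx => ?_⟩
    set a := (x + (q : ℝ))⁻¹ with ha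
    have hc : ((q + (j : ℚ)⁻¹ : ℚ) : ℝ) = q + (j : ℝ)⁻¹ := by push_cast; rfl
    rw [hc]
    set c := (x + ((q : ℝ) + (j : ℝ)⁻¹))⁻¹ with hcd
    have hp : 0 < x + q := by linarith
    have hp2 : 0 < (j : ℝ)⁻¹ := by positivity
    have ha0 : 0 < a := inv_pos.2 hp
    have hc0 : 0 < c := inv_pos.2 (by linarith)
    have hac : j * (a - c) = a * c := by
      rw [ha, hcd]
      have : x + ((q : ℝ) + (j : ℝ)⁻¹) ≠ 0 := by linarith
      rw [inv_sub_inv hp.ne' this]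
      field_simp
      ring
    have hle : c ≤ a := by
      have := mul_pos ha0 hc0
      nlinarith
    have ha1 : a ≤ 1 := inv_le_one_of_one_le₀ (by linarith)
    obtain ⟨d1, d2⟩ := pow_diff hc0.le hle (k + 1)
    push_cast at d1 d2
    set A := a ^ (k + 1) with hA
    set C := c ^ (k + 1) with hC
    have hA1 : A ≤ 1 := pow_le_one₀ ha0.le ha1
    have hCA : C ≤ A := pow_le_pow_left₀ hc0.le hle _
    have hA0 : 0 < A := by positivity
    have hC0 : 0 < C := by positivity
    -- upper and lower estimates
    have u1 : j * (A - C) ≤ (k + 1) * A * c := by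
      refine le_of_mul_le_mul_left ?_ ha0
      calc a * (j * (A - C)) = j * (a * (A - C)) := by ring
        _ ≤ j * ((k + 1) * A * (a - c)) := by gcongr
        _ = (k + 1) * A * (j * (a - c)) := by ring
        _ = a * ((k + 1) * A * c) := by rw [hac]; ring
    have u2 : (k + 1) * C * a ≤ j * (A - C) := by
      refine le_of_mul_le_mul_left ?_ hc0
      calc c * ((k + 1) * C * a) = (k + 1) * C * (a * c) := by ring
        _ = j * ((k + 1) * C * (a - c)) := by rw [← hac]; ring
        _ ≤ j * (c * (A - C)) := by gcongr
        _ = c * (j * (A - C)) := by ring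
    have e : a ^ (k + 1 + 1) - (j / (k + 1) * A + -(j / (k + 1)) * C) = ((k + 1) * (A * a) - j * (A - C)) / (k + 1) := by
      rw [pow_succ, ← hA]; field_simp; ring
    rw [e, abs_div, abs_of_pos (by positivity : (0 : ℝ) < k + 1), div_le_iff₀ (by positivity)]
    have v1 : 0 ≤ (k + 1) * (A * a) - j * (A - C) := by
      have : (k + 1) * A * c ≤ (k + 1) * A * a := by gcongr
      linarith
    rw [abs_of_nonneg v1]
    have v2 : (k + 1) * (A * a) - j * (A - C) ≤ (k + 1) * (a * (A - C)) := by linarith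
    have v3 : a * (A - C) ≤ A - C := by nlinarith
    have v4 : j * (A - C) ≤ k + 1 := by
      refine u1.trans ?_
      have : A * c ≤ 1 := by nlinarith
      have : 0 ≤ (k : ℝ) := by positivity
      nlinarith
    have v5 : A - C ≤ ε := by
      have : k + 1 < ε * j := by rwa [div_lt_iff₀ hε, mul_comm] at hj
      nlinarith
    have : 0 ≤ (k : ℝ) := by positivity
    nlinarith

lemma weak_of_stieltjes [IsProbabilityMeasure μ] (hμ : ∀ᵐ x ∂μ, 0 ≤ x) (hl : ∀ n α, 0 ≤ lm n α) {Y R : ℝ} (hY : 1 ≤ Y)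
    (hR : ∀ᶠ n in atTop, ∀ α, lm n α ≤ R)
    (H : ∀ q : ℚ, Y ≤ q → Cv lm μ fun x => (x + q)⁻¹) (f : BoundedContinuousFunction ℝ ℝ) :
    Tendsto (fun n : ℕ => (n : ℝ)⁻¹ * ∑ α, f (lm n α)) atTop (𝓝 (∫ x, f x ∂μ)) := by
  obtain ⟨q, hq, -⟩ := exists_rat_btwn (show Y < Y + 1 by linarith)
  have hq0 : (0 : ℝ) < q := by linarith
  have key0 : Cv lm μ fun _ => (1 : ℝ) := by
    refine ⟨integrable_const _, ?_⟩
    simp only [integral_const, probReal_univ, smul_eq_mul, mul_one]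
    refine (tendsto_const_nhds (x := (1 : ℝ))).congr' ?_
    filter_upwards [eventually_gt_atTop 0] with n hn
    have : (0 : ℝ) < n := by exact_mod_cast hn
    simp [this.ne']
  have key1 : ∀ p : Polynomial ℝ, Cv lm μ fun x => p.eval (x + (q : ℝ))⁻¹ := by
    intro p
    induction p using Polynomial.induction_on' with
    | add p1 p2 h1 h2 => simpa using h1.lin h2 1 1
    | monomial k c =>
      cases k with
      | zero => simpa using key0.lin key0 c 0
      | succ k =>
        have := Cv.pow hμ hl hY H k q hq.le
        simpa using this.lin this c 0
  -- all functions g(x)/(x+q)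
  have key2 : ∀ g : ℝ → ℝ, Continuous g → (∃ K, ∀ x, |g x| ≤ K) → Cv lm μ fun x => (x + (q : ℝ))⁻¹ * g (max x 0) := by
    intro g hg ⟨K, hK⟩
    have hK0 : 0 ≤ K := (abs_nonneg _).trans (hK 0)
    have hm : Measurable fun x : ℝ => (x + (q : ℝ))⁻¹ * g (max x 0) :=
      (by fun_prop : Measurable fun x : ℝ => (x + (q : ℝ))⁻¹).mul (hg.measurable.comp (by fun_prop))
    refine Cv.closed hμ hl hm.aestronglyMeasurable fun ε hε => ?_
    have hcont : ContinuousOn (fun u : ℝ => u * g (u⁻¹ - q)) (Set.Icc 0 1) := by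
      intro u hu
      rcases hu.1.eq_or_lt with h0 | h0
      · subst h0
        refine ContinuousAt.continuousWithinAt ?_
        rw [ContinuousAt, zero_mul]
        refine squeeze_zero_norm (a := fun u => |u| * K) (fun u => ?_) ?_
        · rw [Real.norm_eq_abs, abs_mul]; gcongr; exact hK _
        · have : Continuous fun u : ℝ => |u| * K := by fun_prop
          simpa using this.tendsto 0
      · refine ContinuousAt.continuousWithinAt (continuousAt_id.mul (hg.continuousAt.comp ?_))
        exact (continuousAt_inv₀ h0.ne').sub continuousAt_const
    obtain ⟨p, hp⟩ := exists_polynomial_near_of_continuousOn 0 1 _ hcont ε hε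
    refine ⟨_, key1 p, fun x hx => ?_⟩
    have h1 : (x + (q : ℝ))⁻¹ ∈ Set.Icc (0 : ℝ) 1 := ⟨by positivity, inv_le_one_of_one_le₀ (by linarith)⟩
    have h2 := hp _ h1
    simp only [inv_inv, add_sub_cancel_right] at h2
    rw [max_eq_left hx, abs_sub_comm]
    exact h2.le
  have hsupp : ∀ᵐ x ∂μ, x ≤ R := by
    have h1 := key2 (fun x => min (max (x - R) 0) 1) (by fun_prop) ⟨1, fun x => by
      rw [abs_of_nonneg (by positivity)]; exact min_le_right _ _⟩
    have h2 : ∫ x, (x + (q : ℝ))⁻¹ * min (max (max x 0 - R) 0) 1 ∂μ = 0 := by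
      refine tendsto_nhds_unique h1.2 ((tendsto_const_nhds (x := (0 : ℝ))).congr' ?_)
      filter_upwards [hR] with n hn
      have : ∀ α, max (max (lm n α) 0 - R) 0 = 0 := fun α => by
        rw [max_eq_left (hl n α), max_eq_right]; linarith [hn α]
      simp [this]
    rw [integral_eq_zero_iff_of_nonneg_ae (hμ.mono fun x hx => by simp only [Pi.zero_apply]; positivity) h1.1] at h2
    filter_upwards [h2, hμ] with x hx h0
    by_contra hcon
    push Not at hcon
    have : 0 < (x + (q : ℝ))⁻¹ * min (max (max x 0 - R) 0) 1 := by
      refine mul_pos (by positivity) (lt_min (lt_max_of_lt_left ?_) one_pos)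
      rw [max_eq_left h0]; linarith
    exact this.ne' hx
  have h3 := (key2 (fun x => f x * min (|x| + q) (|R| + q)) (by fun_prop) ⟨‖f‖ * (|R| + q), fun x => by
    rw [abs_mul]
    gcongr
    · exact f.norm_coe_le_norm x
    · rw [abs_of_nonneg (by positivity)]; exact min_le_right _ _⟩).2
  have e : ∀ x, 0 ≤ x → x ≤ R → (x + (q : ℝ))⁻¹ * (f (max x 0) * min (|max x 0| + q) (|R| + q)) = f x := by
    intro x h0 hx
    rw [max_eq_left h0, min_eq_left (by have := abs_le_abs_of_nonneg h0 hx; linarith), abs_of_nonneg h0]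
    field_simp
  rw [integral_congr_ae (g := f) (by filter_upwards [hμ, hsupp] with x h0 hx using e x h0 hx)] at h3
  refine h3.congr' ?_
  filter_upwards [hR] with n hn
  simp only [e _ (hl n _) (hn _)]
end
end

section
open scoped ENNReal NNReal
lemma inv_le_y {w : ℂ} {y : ℝ} (hy : 0 < y) (h : y ≤ w.re) : ‖w⁻¹‖ ≤ y⁻¹ := by
  rw [norm_inv]
  exact inv_anti₀ hy (h.trans ((le_abs_self _).trans (Complex.abs_re_le_norm w)))

lemma ae_nonneg {μ : Measure ℝ} (h : μ (Set.Iio 0) = 0) : ∀ᵐ x ∂μ, 0 ≤ x := by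
  rw [ae_iff]; convert h using 2; ext x; simp

lemma mp_real {γ b : ℝ} (hb : b ^ 2 ≤ 1) {μ ν : Measure ℝ} [IsProbabilityMeasure μ] (hμ : ∀ᵐ x ∂μ, 0 ≤ x)
    (h : IsMPMap γ (Measure.map (fun x => (1 - b ^ 2) + b ^ 2 * x) μ) ν) :
    ∃ Y0 : ℝ, 1 ≤ Y0 ∧ ∀ y, Y0 ≤ y → 0 ≤ 1 - γ + γ * y * ∫ x, (x + y)⁻¹ ∂ν ∧
      ∫ x, (x + y)⁻¹ ∂ν = ∫ x, ((1 - γ + γ * y * ∫ x, (x + y)⁻¹ ∂ν) * ((1 - b ^ 2) + b ^ 2 * x) + y)⁻¹ ∂μ := by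
  obtain ⟨hν, hν0, heq⟩ := h
  have hν0 := ae_nonneg hν0
  -- y * m(y) → 1
  have t1 : Tendsto (fun y : ℝ => ∫ x, y * (x + y)⁻¹ ∂ν) atTop (𝓝 (∫ x, (1 : ℝ) ∂ν)) := by
    refine tendsto_integral_filter_of_dominated_convergence (fun _ => 1) (Eventually.of_forall fun y => by fun_prop) ?_ (integrable_const _) ?_
    · filter_upwards [eventually_gt_atTop 0] with y hy
      filter_upwards [hν0] with x hx
      rw [Real.norm_eq_abs, abs_of_nonneg (by positivity), ← div_eq_mul_inv, div_le_one (by positivity)]; linarith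
    · filter_upwards [hν0] with x hx
      have h1 : Tendsto (fun y : ℝ => 1 - x * (x + y)⁻¹) atTop (𝓝 (1 - x * 0)) :=
        tendsto_const_nhds.sub (tendsto_const_nhds.mul (tendsto_inv_atTop_zero.comp (tendsto_atTop_add_const_left _ x tendsto_id)))
      rw [mul_zero, sub_zero] at h1
      refine h1.congr' ?_
      filter_upwards [eventually_gt_atTop 0] with y hy
      have : x + y ≠ 0 := by positivity
      field_simp; ring
  have t2 : Tendsto (fun y : ℝ => 1 - γ + γ * ∫ x, y * (x + y)⁻¹ ∂ν) atTop (𝓝 1) := by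
    have := (t1.const_mul γ).const_add (1 - γ)
    simpa using this
  obtain ⟨Y1, hY1⟩ := eventually_atTop.1 (t2.eventually (lt_mem_nhds (zero_lt_one' ℝ)))
  refine ⟨max 1 Y1, le_max_left _ _, fun y hy => ?_⟩
  have hy1 : 1 ≤ y := (le_max_left _ _).trans hy
  have hy0 : 0 < y := by linarith
  have ha := hY1 y ((le_max_right _ _).trans hy)
  rw [integral_const_mul, ← mul_assoc] at ha
  refine ⟨ha.le, ?_⟩
  set m := ∫ x, (x + y)⁻¹ ∂ν with hm
  set a := 1 - γ + γ * y * m with had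
  set z : ℕ → ℂ := fun k => -(y : ℂ) + ((((k : ℝ) + 1)⁻¹ : ℝ) : ℂ) * Complex.I with hz
  have hzre : ∀ k, (z k).re = -y := fun k => by simp [hz]
  have hzim : ∀ k, 0 < (z k).im := fun k => by
    have : (z k).im = ((k : ℝ) + 1)⁻¹ := by
      simp only [hz, Complex.add_im, Complex.neg_im, Complex.ofReal_im, Complex.mul_im, Complex.ofReal_re, Complex.I_im, Complex.I_re]; ring
    rw [this]; positivity
  have hzt : Tendsto z atTop (𝓝 (-(y : ℂ))) := by
    have h1 : Tendsto (fun k : ℕ => ((k : ℝ) + 1)⁻¹) atTop (𝓝 0) := by simpa using tendsto_one_div_add_atTop_nhds_zero_nat (𝕜 := ℝ)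
    have h2 := ((Complex.continuous_ofReal.tendsto 0).comp h1).mul_const Complex.I |>.const_add (-(y : ℂ))
    simp only [Complex.ofReal_zero, zero_mul, add_zero] at h2
    exact h2
  have s1 : Tendsto (fun k => stieltjesT ν (z k)) atTop (𝓝 (m : ℂ)) := by
    have e : (m : ℂ) = ∫ x, ((x : ℂ) - -(y : ℂ))⁻¹ ∂ν := by
      rw [hm, ← integral_complex_ofReal]; congr 1; ext x; push_cast; rw [sub_neg_eq_add]
    rw [e]
    refine tendsto_integral_of_dominated_convergence (fun _ => y⁻¹) (fun k => ?_) (integrable_const _) (fun k => ?_) ?_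
    · exact (by fun_prop : Measurable fun x : ℝ => ((x : ℂ) - z k)⁻¹).aestronglyMeasurable
    · filter_upwards [hν0] with x hx
      refine inv_le_y hy0 ?_
      rw [Complex.sub_re, hzre, Complex.ofReal_re]; linarith
    · filter_upwards [hν0] with x hx
      refine (hzt.const_sub (x : ℂ)).inv₀ ?_
      rw [sub_neg_eq_add, ← Complex.ofReal_add, Complex.ofReal_ne_zero]; positivity
  set A : ℕ → ℂ := fun k => 1 - γ - γ * z k * stieltjesT ν (z k) with hA
  have s2 : Tendsto A atTop (𝓝 (a : ℂ)) := by
    have := ((hzt.const_mul (γ : ℂ)).mul s1).const_sub (1 - (γ : ℂ))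
    have e : (a : ℂ) = 1 - (γ : ℂ) - γ * -(y : ℂ) * m := by rw [had]; push_cast; ring
    rw [e]; exact this
  have s3 : ∀ k, stieltjesT ν (z k) = ∫ x, ((((1 - b ^ 2) + b ^ 2 * x : ℝ) : ℂ) * A k - z k)⁻¹ ∂μ := by
    intro k
    rw [heq _ (hzim k), integral_map (by fun_prop)]
    exact (by fun_prop : Measurable fun x : ℝ => ((x : ℂ) * (1 - γ - γ * z k * stieltjesT ν (z k)) - z k)⁻¹).aestronglyMeasurable
  have hre : ∀ᶠ k in atTop, 0 < (A k).re := by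
    have := (Complex.continuous_re.tendsto _).comp s2
    exact this.eventually (lt_mem_nhds (by simpa using ha))
  have s4 : Tendsto (fun k => stieltjesT ν (z k)) atTop (𝓝 ((∫ x, (a * ((1 - b ^ 2) + b ^ 2 * x) + y)⁻¹ ∂μ : ℝ) : ℂ)) := by
    have e : ((∫ x, (a * ((1 - b ^ 2) + b ^ 2 * x) + y)⁻¹ ∂μ : ℝ) : ℂ) = ∫ x, ((((1 - b ^ 2) + b ^ 2 * x : ℝ) : ℂ) * a - -(y : ℂ))⁻¹ ∂μ := by
      rw [← integral_complex_ofReal]; congr 1; ext x; push_cast; rw [sub_neg_eq_add, mul_comm (a : ℂ)]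
    rw [e]
    simp only [s3]
    have hφ : ∀ x : ℝ, 0 ≤ x → 0 ≤ (1 - b ^ 2) + b ^ 2 * x := fun x hx => by
      have : 0 ≤ b ^ 2 * x := by positivity
      linarith
    refine tendsto_integral_filter_of_dominated_convergence (fun _ => y⁻¹) (Eventually.of_forall fun k => ?_) ?_ (integrable_const _) ?_
    · exact (by fun_prop : Measurable fun x : ℝ => ((((1 - b ^ 2) + b ^ 2 * x : ℝ) : ℂ) * A k - z k)⁻¹).aestronglyMeasurable
    · filter_upwards [hre] with k hk
      filter_upwards [hμ] with x hx
      refine inv_le_y hy0 ?_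
      rw [Complex.sub_re, hzre, Complex.re_ofReal_mul]
      have := mul_nonneg (hφ x hx) hk.le
      linarith
    · filter_upwards [hμ] with x hx
      refine ((s2.const_mul _).sub hzt).inv₀ ?_
      rw [sub_neg_eq_add, ← Complex.ofReal_mul, ← Complex.ofReal_add, Complex.ofReal_ne_zero]
      have := mul_nonneg (hφ x hx) ha.le
      linarith
  exact_mod_cast tendsto_nhds_unique s1 s4

/-- the fixed point argument -/
lemma fixed_pt {T h g δ : ℕ → ℝ} {γ m y M : ℝ} (hy : 0 < y) (hγ : 0 < γ) (hM : 0 ≤ M) (hyM : 4 * γ * M ≤ y)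
    (hg : Tendsto g atTop (𝓝 γ)) (hh : Tendsto h atTop (𝓝 m)) (hδ : Tendsto δ atTop (𝓝 0)) (hg0 : ∀ n, 0 ≤ g n)
    (H : ∀ᶠ n in atTop, |T n - h n| ≤ |1 - γ + γ * y * m - (1 - g n + y * g n * T n)| * (M / y ^ 2) + δ n) :
    Tendsto T atTop (𝓝 m) := by
  rw [← tendsto_sub_nhds_zero_iff]
  have b : Tendsto (fun n => 2 * (|h n - m| + |g n - γ| * (|1 - y * m| * (M / y ^ 2)) + δ n)) atTop (𝓝 0) := by
    have h1 := (hh.sub_const m).abs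
    have h2 := (hg.sub_const γ).abs.mul_const (|1 - y * m| * (M / y ^ 2))
    have := ((h1.add h2).add hδ).const_mul 2
    simpa using this
  refine squeeze_zero_norm' ?_ b
  filter_upwards [H, hg.eventually (gt_mem_nhds (show γ < 2 * γ by linarith))] with n hn hgn
  rw [Real.norm_eq_abs]
  have e : 1 - γ + γ * y * m - (1 - g n + y * g n * T n) = (g n - γ) * (1 - y * m) + y * g n * (m - T n) := by ring
  have h1 : |(g n - γ) * (1 - y * m) + y * g n * (m - T n)| ≤ |g n - γ| * |1 - y * m| + y * g n * |T n - m| := by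
    refine (abs_add_le _ _).trans ?_
    rw [abs_mul, abs_mul, abs_of_nonneg (mul_nonneg hy.le (hg0 n)), abs_sub_comm m]
  rw [e] at hn
  have h2 : y * g n * (M / y ^ 2) ≤ 1 / 2 := by
    have : y * g n * (M / y ^ 2) = g n * M / y := by field_simp
    rw [this, div_le_iff₀ hy]
    nlinarith
  have h3 := mul_le_mul_of_nonneg_right h1 (show 0 ≤ M / y ^ 2 by positivity)
  have h4 := mul_le_mul_of_nonneg_right h2 (abs_nonneg (T n - m))
  have h5 : |T n - m| ≤ |T n - h n| + |h n - m| := by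
    have := abs_add_le (T n - h n) (h n - m)
    rwa [sub_add_sub_cancel] at this
  nlinarith
end

section
open scoped ENNReal NNReal
section
variable {L : ℕ} {d : ℕ → ℕ → ℕ} {σ σ' σ'' : ℝ → ℝ} {l : ℝ}

lemma step (h : ∀ x, HasDerivAt σ (σ' x) x) (h2 : ∀ x, HasDerivAt σ' (σ'' x) x)
    (hb : ∀ x, |σ' x| ≤ l) (hb2 : ∀ x, |σ'' x| ≤ l) (hmean : ∫ x, σ x ∂(gaussianReal 0 1) = 0)
    (hvar : ∫ x, σ x ^ 2 ∂(gaussianReal 0 1) = 1)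
    (X0 : (n : ℕ) → Matrix (Fin (d n 0)) (Fin n) ℝ)
    {Ω : Type*} [MeasurableSpace Ω] (Pr : Measure Ω) (W : (n : ℕ) → (ℓ : ℕ) → Ω → Fin (d n (ℓ + 1)) → Fin (d n ℓ) → ℝ)
    (hW : ∀ n : ℕ, Measure.map (fun ω => fun ℓ : Fin L => W n ℓ ω) Pr =
      Measure.pi (fun ℓ : Fin L => gaussianMat (d n ((ℓ : ℕ) + 1)) (d n (ℓ : ℕ)))) {ℓ : ℕ} (hℓ : ℓ < L) (B : ℝ)
    {γ : ℝ} (hγ : 0 < γ) (hdim : Tendsto (fun n : ℕ => (n : ℝ) / (d n (ℓ + 1) : ℝ)) atTop (𝓝 γ))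
    {μ ν : Measure ℝ} [IsProbabilityMeasure μ] (hμ : ∀ᵐ x ∂μ, 0 ≤ x)
    (hMP : IsMPMap γ (Measure.map (fun x => (1 - (∫ x, σ' x ∂(gaussianReal 0 1)) ^ 2) + (∫ x, σ' x ∂(gaussianReal 0 1)) ^ 2 * x) μ) ν) :
    ∃ B' : ℝ, ∀ᵐ ω ∂Pr, (∀ᶠ n : ℕ in atTop, Good B (netLayer σ (d n) n (fun k => W n k ω) (X0 n) ℓ)) →
      Tendsto (fun n : ℕ => offd (netLayer σ (d n) n (fun k => W n k ω) (X0 n) ℓ) / n) atTop (𝓝 0) →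
      (∀ f : BoundedContinuousFunction ℝ ℝ, Tendsto (fun n : ℕ => esd ((netLayer σ (d n) n (fun k => W n k ω) (X0 n) ℓ)ᵀ *
        netLayer σ (d n) n (fun k => W n k ω) (X0 n) ℓ) f) atTop (𝓝 (∫ x, f x ∂μ))) →
      (∀ᶠ n : ℕ in atTop, Good B' (netLayer σ (d n) n (fun k => W n k ω) (X0 n) (ℓ + 1))) ∧
      Tendsto (fun n : ℕ => offd (netLayer σ (d n) n (fun k => W n k ω) (X0 n) (ℓ + 1)) / n) atTop (𝓝 0) ∧
      (∀ f : BoundedContinuousFunction ℝ ℝ, Tendsto (fun n : ℕ => esd ((netLayer σ (d n) n (fun k => W n k ω) (X0 n) (ℓ + 1))ᵀ *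
        netLayer σ (d n) n (fun k => W n k ω) (X0 n) (ℓ + 1)) f) atTop (𝓝 (∫ x, f x ∂ν))) := by
  have hc' : Continuous σ' := continuous_iff_continuousAt.2 fun x => (h2 x).continuousAt
  have hb1 := b_sq_le h hc' hb hvar
  obtain ⟨B', H1⟩ := step1 h h2 hb hb2 hmean hvar X0 Pr W hW hℓ B hγ hdim
  obtain ⟨Y0, hY0, HY⟩ := mp_real hb1 hμ hMP
  haveI := hMP.1
  have hν := ae_nonneg hMP.2.1
  have H2 := fun (y s : ℝ) (hy : 0 < y) (hs : 0 ≤ s) => step2 h h2 hb hb2 hmean hvar X0 Pr W hW hℓ B hγ hdim hy hs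
  set b := ∫ x, σ' x ∂(gaussianReal 0 1)
  set Y := max Y0 (4 * γ * (1 + B ^ 2)) with hYd
  have H3 := (ae_all_iff (μ := Pr)).2 fun q : {q : ℚ // Y ≤ q} => H2 (q : ℚ) (1 - γ + γ * (q : ℚ) * ∫ x, (x + ((q : ℚ) : ℝ))⁻¹ ∂ν)
    (by have := (le_max_left _ _).trans q.2; linarith) (HY _ ((le_max_left _ _).trans q.2)).1
  refine ⟨B', ?_⟩
  filter_upwards [H1, H3] with ω h1 h3 hG hO hE
  obtain ⟨hG', hO'⟩ := h1 hG hO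
  refine ⟨hG', hO', fun f => ?_⟩
  simp only [esd_eq] at hE ⊢
  refine weak_of_stieltjes (lm := fun n => lam (netLayer σ (d n) n (fun k => W n k ω) (X0 n) (ℓ + 1))) hν (fun n α => lam_nonneg _ α)
    (Y := Y) (R := B' ^ 2) (hY0.trans (le_max_left _ _)) (hG'.mono fun n hn α => lam_le _ hn.1 α) (fun q hq => ?_) f
  have hq0 : (0 : ℝ) < q := by have := (le_max_left _ _).trans hq; linarith
  obtain ⟨δ, hδ, hR⟩ := h3 ⟨q, hq⟩ hG hO
  obtain ⟨ha, hm⟩ := HY q ((le_max_left _ _).trans hq)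
  constructor
  · refine Integrable.of_bound (by fun_prop) (q : ℝ)⁻¹ (hν.mono fun x hx => ?_)
    rw [Real.norm_eq_abs, abs_of_nonneg (by positivity)]
    exact inv_anti₀ hq0 (by linarith)
  simp only [trace_res1 _ hq0, trace_res2 _ hb1 ha hq0] at hR
  refine fixed_pt (M := 1 + B ^ 2) hq0 hγ (by positivity) ((le_max_right _ _).trans hq) hdim ?_ hδ (fun n => by positivity) hR
  set s := 1 - γ + γ * q * ∫ x, (x + (q : ℝ))⁻¹ ∂ν
  rw [hm]
  have hφ : ∀ x : ℝ, 0 ≤ s * ((1 - b ^ 2) + b ^ 2 * max x 0) := fun x => by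
    have : 0 ≤ b ^ 2 * max x 0 := by positivity
    exact mul_nonneg ha (by linarith)
  let F : BoundedContinuousFunction ℝ ℝ := BoundedContinuousFunction.ofNormedAddCommGroup
    (fun x => (s * ((1 - b ^ 2) + b ^ 2 * max x 0) + q)⁻¹)
    (Continuous.inv₀ (by fun_prop) fun x => by have := hφ x; positivity) (q : ℝ)⁻¹ fun x => by
      rw [Real.norm_eq_abs, abs_of_nonneg (by have := hφ x; positivity)]
      exact inv_anti₀ hq0 (by linarith [hφ x])
  have hF := hE F
  have e : ∀ x, 0 ≤ x → F x = (s * ((1 - b ^ 2) + b ^ 2 * x) + q)⁻¹ := fun x hx => by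
    simp only [F, BoundedContinuousFunction.coe_ofNormedAddCommGroup, max_eq_left hx]
  rw [integral_congr_ae (hμ.mono fun x hx => e x hx)] at hF
  simpa only [e _ (lam_nonneg _ _)] using hF
end
end

theorem ck_spectrum
    (L : ℕ) (hL : 1 ≤ L)
    (d : ℕ → ℕ → ℕ)
    (σ σ' σ'' : ℝ → ℝ) (lamσ : ℝ)
    (hderiv1 : ∀ x, HasDerivAt σ (σ' x) x)
    (hderiv2 : ∀ x, HasDerivAt σ' (σ'' x) x)
    (hσ'bdd : ∀ x, |σ' x| ≤ lamσ) (hσ''bdd : ∀ x, |σ'' x| ≤ lamσ)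
    (hmean : (∫ x, σ x ∂stdGaussian) = 0)
    (hvar : (∫ x, (σ x) ^ 2 ∂stdGaussian) = 1)
    (Ω : Type*) [MeasurableSpace Ω] (Pr : Measure Ω) [IsProbabilityMeasure Pr]
    (W : (n : ℕ) → (ℓ : ℕ) → Ω → Fin (d n (ℓ + 1)) → Fin (d n ℓ) → ℝ)
    (hW : ∀ n : ℕ, Measure.map (fun ω => fun ℓ : Fin L => W n ℓ ω) Pr =
      Measure.pi (fun ℓ : Fin L => gaussianMat (d n ((ℓ : ℕ) + 1)) (d n (ℓ : ℕ))))
    (X0 : (n : ℕ) → Matrix (Fin (d n 0)) (Fin n) ℝ)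
    (ε : ℕ → ℝ) (B : ℝ)
    (hX0orth : ∀ n, IsOrthonormal (ε n) B (X0 n))
    (hε : Tendsto (fun n : ℕ => ε n * (n : ℝ) ^ ((1 : ℝ) / 4)) atTop (𝓝 0))
    (γ : ℕ → ℝ) (hγ : ∀ ℓ, 1 ≤ ℓ → ℓ ≤ L → 0 < γ ℓ)
    (hdim : ∀ ℓ, 1 ≤ ℓ → ℓ ≤ L →
      Tendsto (fun n : ℕ => (n : ℝ) / (d n ℓ : ℝ)) atTop (𝓝 (γ ℓ)))
    (μ : ℕ → Measure ℝ)
    (hμ0prob : IsProbabilityMeasure (μ 0))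
    (hμ0supp : (μ 0) (Set.Iio 0) = 0)
    (hμ0conv : ∀ f : BoundedContinuousFunction ℝ ℝ,
      Tendsto (fun n : ℕ => esd ((X0 n)ᵀ * X0 n) f) atTop (𝓝 (∫ x, f x ∂(μ 0))))
    (hμrec : ∀ ℓ < L, IsMPMap (γ (ℓ + 1))
      (Measure.map
        (fun x => (1 - (∫ x, σ' x ∂stdGaussian) ^ 2) + (∫ x, σ' x ∂stdGaussian) ^ 2 * x)
        (μ ℓ))
      (μ (ℓ + 1))) :
    ∃ C : ℝ, 0 < C ∧ ∀ᵐ ω ∂Pr,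
      (∀ ℓ, 1 ≤ ℓ → ℓ ≤ L → ∀ f : BoundedContinuousFunction ℝ ℝ,
        Tendsto
          (fun n : ℕ =>
            esd ((netLayer σ (d n) n (fun m => W n m ω) (X0 n) ℓ)ᵀ *
              netLayer σ (d n) n (fun m => W n m ω) (X0 n) ℓ) f)
          atTop (𝓝 (∫ x, f x ∂(μ ℓ)))) ∧
      (∀ᶠ n : ℕ in atTop,
        opNorm ((netLayer σ (d n) n (fun m => W n m ω) (X0 n) L)ᵀ *
          netLayer σ (d n) n (fun m => W n m ω) (X0 n) L) ≤ C) := by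

  have hMPs : ∀ ℓ ≤ L, IsProbabilityMeasure (μ ℓ) ∧ (μ ℓ) (Set.Iio 0) = 0 := by
    intro ℓ hℓ
    cases ℓ with
    | zero => exact ⟨hμ0prob, hμ0supp⟩
    | succ k => exact ⟨(hμrec k (by omega)).1, (hμrec k (by omega)).2.1⟩
  have key : ∀ ℓ ≤ L, ∃ B' : ℝ, ∀ᵐ ω ∂Pr,
      (∀ᶠ n : ℕ in atTop, Good B' (netLayer σ (d n) n (fun k => W n k ω) (X0 n) ℓ)) ∧
      Tendsto (fun n : ℕ => offd (netLayer σ (d n) n (fun k => W n k ω) (X0 n) ℓ) / n) atTop (𝓝 0) ∧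
      (∀ f : BoundedContinuousFunction ℝ ℝ, Tendsto (fun n : ℕ => esd ((netLayer σ (d n) n (fun k => W n k ω) (X0 n) ℓ)ᵀ *
        netLayer σ (d n) n (fun k => W n k ω) (X0 n) ℓ) f) atTop (𝓝 (∫ x, f x ∂(μ ℓ)))) := by
    intro ℓ
    induction ℓ with
    | zero =>
      intro _
      refine ⟨B, Eventually.of_forall fun ω => ⟨Eventually.of_forall fun n => (hX0orth n).2.2, ?_, hμ0conv⟩⟩
      have h4 : Tendsto (fun n : ℕ => (ε n * (n : ℝ) ^ ((1 : ℝ) / 4)) ^ 4) atTop (𝓝 0) := by simpa using hε.pow 4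
      refine squeeze_zero (fun n => ?_) (fun n => ?_) h4
      · refine div_nonneg (Finset.sum_nonneg fun α _ => Finset.sum_nonneg fun β _ => ?_) (Nat.cast_nonneg n)
        split_ifs <;> positivity
      · change offd (X0 n) / n ≤ _
        have e4 : ((n : ℝ) ^ ((1 : ℝ) / 4)) ^ 4 = n := by
          rw [← Real.rpow_natCast, ← Real.rpow_mul (Nat.cast_nonneg n)]; norm_num
        rw [mul_pow, e4]
        refine div_le_of_le_mul₀ (Nat.cast_nonneg n) (by positivity) ?_
        have : ∀ α β : Fin n, (if α = β then 0 else (∑ j, X0 n j α * X0 n j β) ^ 4) ≤ ε n ^ 4 := by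
          intro α β
          split_ifs with hab
          · positivity
          · have := pow_le_pow_left₀ (abs_nonneg _) ((hX0orth n).2.1 α β hab) 4
            rwa [show |∑ i, X0 n i α * X0 n i β| ^ 4 = (∑ i, X0 n i α * X0 n i β) ^ 4 from by
              rw [show 4 = 2 * 2 from rfl, pow_mul, sq_abs, ← pow_mul]] at this
        refine (Finset.sum_le_sum fun α _ => Finset.sum_le_sum fun β _ => this α β).trans_eq ?_
        simp; ring
    | succ ℓ ih =>
      intro hℓ
      obtain ⟨B1, h1⟩ := ih (by omega)
      obtain ⟨hp, hs⟩ := hMPs ℓ (by omega)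
      obtain ⟨B2, h2⟩ := step hderiv1 hderiv2 hσ'bdd hσ''bdd hmean hvar X0 Pr W hW (ℓ := ℓ) (by omega) B1 (hγ (ℓ + 1) (by omega) hℓ)
        (hdim (ℓ + 1) (by omega) hℓ) (ae_nonneg hs) (hμrec ℓ (by omega))
      refine ⟨B2, ?_⟩
      filter_upwards [h1, h2] with ω a1 a2
      exact a2 a1.1 a1.2.1 a1.2.2
  obtain ⟨BL, hBL⟩ := key L le_rfl
  refine ⟨BL ^ 2 + 1, by positivity, ?_⟩
  have hall : ∀ᵐ ω ∂Pr, ∀ ℓ : ℕ, 1 ≤ ℓ → ℓ ≤ L → ∀ f : BoundedContinuousFunction ℝ ℝ, Tendsto (fun n : ℕ => esd ((netLayer σ (d n) n (fun k => W n k ω) (X0 n) ℓ)ᵀ *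
        netLayer σ (d n) n (fun k => W n k ω) (X0 n) ℓ) f) atTop (𝓝 (∫ x, f x ∂(μ ℓ))) := by
    refine ae_all_iff.2 fun ℓ => ?_
    by_cases hℓ : ℓ ≤ L
    · obtain ⟨B', hB'⟩ := key ℓ hℓ
      filter_upwards [hB'] with ω hω _ _ using hω.2.2
    · exact Eventually.of_forall fun ω _ h => absurd h hℓ
  filter_upwards [hBL, hall] with ω h1 h2
  refine ⟨h2, h1.1.mono fun n hn => ?_⟩
  rw [opNorm_TT]
  have := opNorm_nonneg' (netLayer σ (d n) n (fun k => W n k ω) (X0 n) L)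
  have := hn.1
  nlinarith
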